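/- Let d ≥ 1, suppose S satisfies Assumptions Ω and J with constants M, K, ζ, and suppose additionally that ĥ^{(μ)}(0) ≥ M⁻¹ for all μ ∈ ∂Ω. (i) If d > 2, there exist R > 0 and 0 < c ≤ C, depending only on d, M, K, ζ, such that for all x ∈ ℤ^d with |x|_S ≥ R, c F(x) ≤ S(x) ≤ C F(x), where F(x) = (max{1, m_S|x|_S})^{(d−3)/2} |x|_S^{−(d−2)} e^{−m_S|x|_S}. (ii) If d ≤ 2, then for every s₀ > 0 there exist R > 0 and 0 < c ≤ C, depending only on d, M, K, ζ, s₀, such that for all x ∈ ℤ^d with |x|_S ≥ max{R, s₀/m_S}, c G(x) ≤ S(x) ≤ C G(x), where G(x) = m_S^{−(3−d)/2} |x|_S^{−(d−1)/2} e^{−m_S|x|_S}. -/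

import Mathlib

open scoped BigOperators ENNReal Real Topology Pointwise
open MeasureTheory Matrix Filter

noncomputable section

namespace OZpaper

variable {d : ℕ}

/-- Dot product of a real vector with a lattice point. -/
def rdotZ (μ : Fin d → ℝ) (x : Fin d → ℤ) : ℝ := ∑ i, μ i * (x i : ℝ)

/-- Dot product of two real vectors. -/
def rdot (μ x : Fin d → ℝ) : ℝ := ∑ i, μ i * x i

/-- Euclidean norm of a lattice point. -/
def enormZ (x : Fin d → ℤ) : ℝ := Real.sqrt (∑ i, ((x i : ℝ)) ^ 2)

/-- Euclidean norm of a real vector. -/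
def enormR (x : Fin d → ℝ) : ℝ := Real.sqrt (∑ i, (x i) ^ 2)

/-- ℓ¹ norm of a real vector. -/
def l1R (x : Fin d → ℝ) : ℝ := ∑ i, |x i|

/-- ℓ∞ norm of a real vector. -/
def linftyR (x : Fin d → ℝ) : ℝ := ⨆ i, |x i|

/-- The vector `t • e₁`. -/
def e1R (d : ℕ) (t : ℝ) : Fin d → ℝ := fun i => if (i : ℕ) = 0 then t else 0

/-- The lattice point `n • e₁`. -/
def e1Z (d : ℕ) (n : ℤ) : Fin d → ℤ := fun i => if (i : ℕ) = 0 then n else 0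

/-- Cast of a lattice point to a real vector. -/
def toR (x : Fin d → ℤ) : Fin d → ℝ := fun i => (x i : ℝ)

/-- ℤ^d-symmetry: invariance under coordinate permutations and sign flips. -/
def ZdSymmetric (f : (Fin d → ℤ) → ℝ) : Prop :=
  (∀ (σ : Equiv.Perm (Fin d)) (x : Fin d → ℤ), f (fun i => x (σ i)) = f x) ∧
  (∀ (ε : Fin d → Bool) (x : Fin d → ℤ), f (fun i => if ε i then -(x i) else x i) = f x)

/-- Tilted susceptibility `χ^{(μ)}`, valued in `ℝ≥0∞`. -/
def chi (S : (Fin d → ℤ) → ℝ) (μ : Fin d → ℝ) : ℝ≥0∞ :=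
  ∑' x, ENNReal.ofReal (S x * Real.exp (rdotZ μ x))

/-- The set `Ω = {μ : χ^{(μ)} < ∞}`. -/
def Omega (S : (Fin d → ℤ) → ℝ) : Set (Fin d → ℝ) := {μ | chi S μ < ⊤}

/-- The mass `m_S`. -/
def mass (S : (Fin d → ℤ) → ℝ) : ℝ := sSup {t : ℝ | 0 ≤ t ∧ chi S (e1R d t) < ⊤}

/-- Assumption Ω. -/
structure AssumptionOmega (S : (Fin d → ℤ) → ℝ) : Prop where
  nonneg : ∀ x, 0 ≤ S x
  symm : ZdSymmetric S
  open_Omega : IsOpen (Omega S)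
  zero_mem : (0 : Fin d → ℝ) ∈ Omega S
  exists_not_mem : ∃ μ₁ : ℝ, 0 < μ₁ ∧ e1R d μ₁ ∉ Omega S

/-- Fourier transform `Q̂(k) = ∑_y Q(y) e^{-i k·y}`. -/
def fourierZ (Q : (Fin d → ℤ) → ℝ) (k : Fin d → ℝ) : ℂ :=
  ∑' y, (Q y : ℂ) * Complex.exp (-Complex.I * (rdotZ k y : ℂ))

/-- ℓ^p norm of a function on ℤ^d, valued in `ℝ≥0∞`. -/
def lpNorm (f : (Fin d → ℤ) → ℝ) (p : ℝ) : ℝ≥0∞ :=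
  (∑' y, ENNReal.ofReal (|f y| ^ p)) ^ (1 / p)

/-- The exponent `p_d`. -/
def pExp (d : ℕ) (ζ : ℝ) : ℝ := if d = 1 then 2 else (d : ℝ) / ((d : ℝ) - 2 + min ζ 2)

/-- The class 𝒬_{M,K,ζ} without the (d-1)-th moment bounds. -/
structure MemQweak (M K ζ : ℝ) (Q g : (Fin d → ℤ) → ℝ) : Prop where
  Q_l1 : lpNorm Q 1 ≤ ENNReal.ofReal M
  Q_moment : lpNorm (fun y => enormZ y ^ (2 + ζ) * Q y) 1 ≤ ENNReal.ofReal M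
  infrared : ∀ k : Fin d → ℝ, (∀ i, |k i| ≤ π) →
    K * enormR k ^ 2 ≤ (fourierZ Q 0 - fourierZ Q k).re
  g_l1 : lpNorm g 1 ≤ ENNReal.ofReal M
  g_zeta : lpNorm (fun y => enormZ y ^ ζ * g y) 1 ≤ ENNReal.ofReal M
  g_two : lpNorm (fun y => enormZ y ^ (2 : ℝ) * g y) (min (pExp d ζ) 2) ≤ ENNReal.ofReal M

/-- The class 𝒬_{M,K,ζ}. -/
structure MemQ (M K ζ : ℝ) (Q g : (Fin d → ℤ) → ℝ) : Prop where
  Q_l1 : lpNorm Q 1 ≤ ENNReal.ofReal M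
  Q_moment : lpNorm (fun y => enormZ y ^ (2 + ζ) * Q y) 1 ≤ ENNReal.ofReal M
  infrared : ∀ k : Fin d → ℝ, (∀ i, |k i| ≤ π) →
    K * enormR k ^ 2 ≤ (fourierZ Q 0 - fourierZ Q k).re
  g_l1 : lpNorm g 1 ≤ ENNReal.ofReal M
  g_zeta : lpNorm (fun y => enormZ y ^ ζ * g y) 1 ≤ ENNReal.ofReal M
  g_two : lpNorm (fun y => enormZ y ^ (2 : ℝ) * g y) (min (pExp d ζ) 2) ≤ ENNReal.ofReal M
  Q_dm1 : 4 ≤ d →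
    lpNorm (fun y => enormZ y ^ ((d : ℝ) - 1) * Q y) (min ((d : ℝ) / 3) 2) ≤ ENNReal.ofReal M
  g_dm1 : 4 ≤ d →
    lpNorm (fun y => enormZ y ^ ((d : ℝ) - 1) * g y) 2 ≤ ENNReal.ofReal M

/-- Convolution on ℤ^d. -/
def conv (f g : (Fin d → ℤ) → ℝ) (x : Fin d → ℤ) : ℝ := ∑' y, f (x - y) * g y

/-- Exponential tilt `f^{(μ)}`. -/
def tilt (f : (Fin d → ℤ) → ℝ) (μ : Fin d → ℝ) : (Fin d → ℤ) → ℝ :=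
  fun x => f x * Real.exp (rdotZ μ x)

/-- `∑_y f(y) e^{μ·y}`, i.e. `f̂^{(μ)}(0)`. -/
def tiltSum (f : (Fin d → ℤ) → ℝ) (μ : Fin d → ℝ) : ℝ := ∑' y, f y * Real.exp (rdotZ μ y)

/-- Assumption J. -/
structure AssumptionJ (S J h : (Fin d → ℤ) → ℝ) (M K ζ : ℝ) : Prop where
  M_pos : 0 < M
  K_pos : 0 < K
  zeta_pos : 0 < ζ
  J_symm : ZdSymmetric J
  h_symm : ZdSymmetric h
  J_summable : Summable fun x => |J x|
  h_summable : Summable fun x => |h x|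
  OZ_eq : ∀ x, S x = h x + conv J S x
  memQ : ∀ μ ∈ closure (Omega S), MemQ M K ζ (tilt J μ) (tilt h μ)
  hhat_pos : ∀ μ ∈ closure (Omega S), 0 < tiltSum h μ

/-- Assumption J, without the (d-1)-th moment bounds of the class 𝒬. -/
structure AssumptionJweak (S J h : (Fin d → ℤ) → ℝ) (M K ζ : ℝ) : Prop where
  M_pos : 0 < M
  K_pos : 0 < K
  zeta_pos : 0 < ζ
  J_symm : ZdSymmetric J
  h_symm : ZdSymmetric h
  J_summable : Summable fun x => |J x|
  h_summable : Summable fun x => |h x|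
  OZ_eq : ∀ x, S x = h x + conv J S x
  memQ : ∀ μ ∈ closure (Omega S), MemQweak M K ζ (tilt J μ) (tilt h μ)
  hhat_pos : ∀ μ ∈ closure (Omega S), 0 < tiltSum h μ

/-- `μ` is the optimal tilt `μ_x̂` for direction `x`. -/
def IsOptTilt (S : (Fin d → ℤ) → ℝ) (x μ : Fin d → ℝ) : Prop :=
  μ ∈ frontier (Omega S) ∧ ∀ ν ∈ closure (Omega S), rdot ν x ≤ rdot μ x

/-- The norm `|x|_S = (max_{μ ∈ Ω̄} μ·x)/m_S`. -/
def normS (S : (Fin d → ℤ) → ℝ) (x : Fin d → ℝ) : ℝ :=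
  sSup ((fun μ => rdot μ x) '' closure (Omega S)) / mass S

/-- The drift vector `η` of the tilted kernel. -/
def etaOf (J : (Fin d → ℤ) → ℝ) (μ : Fin d → ℝ) : Fin d → ℝ :=
  fun j => ∑' y, (y j : ℝ) * J y * Real.exp (rdotZ μ y)

/-- The covariance matrix `Λ` of the tilted kernel. -/
def LambdaOf (J : (Fin d → ℤ) → ℝ) (μ : Fin d → ℝ) : Matrix (Fin d) (Fin d) ℝ :=
  Matrix.of fun j l => ∑' y, (y j : ℝ) * (y l : ℝ) * J y * Real.exp (rdotZ μ y)

/-- The Brownian heat kernel `ρ_t(x; η, Λ)`. -/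
def heatKer (d : ℕ) (t : ℝ) (x η : Fin d → ℝ) (Λ : Matrix (Fin d) (Fin d) ℝ) : ℝ :=
  (1 / Real.sqrt Λ.det) * (1 / (2 * π * t) ^ ((d : ℝ) / 2)) *
    Real.exp (-(1 / (2 * t)) * rdot (x - t • η) (Λ⁻¹ *ᵥ (x - t • η)))

/-- The Brownian Green function `𝒞(x; η, Λ)`. -/
def greenC (d : ℕ) (x η : Fin d → ℝ) (Λ : Matrix (Fin d) (Fin d) ℝ) : ℝ :=
  ∫ t in Set.Ioi (0 : ℝ), heatKer d t x η Λ

/-- The massive continuum Green function `𝔾_a(x)`. -/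
def massiveG (d : ℕ) (a : ℝ) (x : Fin d → ℝ) : ℝ :=
  ∫ t in Set.Ioi (0 : ℝ),
    (1 / (2 * π * t) ^ ((d : ℝ) / 2)) * Real.exp (-enormR x ^ 2 / (2 * t)) *
      Real.exp (-(t * a ^ 2) / 2)

/-- The constant `A_φ = ∫_{ℝ^d} ‖y‖₂^φ 𝔾₁(y) dy`. -/
def Aconst (d : ℕ) (φ : ℝ) : ℝ := ∫ y : Fin d → ℝ, enormR y ^ φ * massiveG d 1 y

/-- The torus `[-π, π]^d`. -/
def torus (d : ℕ) : Set (Fin d → ℝ) := Set.univ.pi fun _ => Set.Icc (-π) π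

/-- The Fourier integral `I_t(x)`. -/
def It (Q g : (Fin d → ℤ) → ℝ) (t : ℝ) (x : Fin d → ℤ) : ℂ :=
  (((2 * π) ^ d : ℝ) : ℂ)⁻¹ *
    ∫ k in torus d, Complex.exp (Complex.I * (rdotZ k x : ℂ)) * fourierZ g k *
      Complex.exp (-(t : ℂ) * (fourierZ Q 0 - fourierZ Q k))

/-- The quantity `G_Q(x)`. -/
def GQ (Q g : (Fin d → ℤ) → ℝ) (x : Fin d → ℤ) : ℂ :=
  ∫ t in Set.Ioi (0 : ℝ), It Q g t x

/-- The Kronecker delta at the origin. -/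
def deltaZ (d : ℕ) : (Fin d → ℤ) → ℝ := fun x => if x = 0 then 1 else 0

/-- n-fold convolution power. -/
def convPow (D : (Fin d → ℤ) → ℝ) : ℕ → (Fin d → ℤ) → ℝ
  | 0 => deltaZ d
  | n + 1 => conv D (convPow D n)

/-- Random-walk Green function `S_z(x) = ∑_n z^n D^{*n}(x)`. -/
def rwG (D : (Fin d → ℤ) → ℝ) (z : ℝ) (x : Fin d → ℤ) : ℝ :=
  ∑' n : ℕ, z ^ n * convPow D n x

/-- `σ² = ∑_x ‖x‖₂² J(x)`. -/
def sigmaSq (J : (Fin d → ℤ) → ℝ) : ℝ := ∑' x, enormZ x ^ 2 * J x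

/-- Susceptibility `χ = ∑_x S(x)`. -/
def suscept (S : (Fin d → ℤ) → ℝ) : ℝ := ∑' x, S x

/-- `ĥ(0) = ∑_x h(x)`. -/
def h0 (h : (Fin d → ℤ) → ℝ) : ℝ := ∑' x, h x

/-- Correlation length of order φ. -/
def xiPhi (S : (Fin d → ℤ) → ℝ) (φ : ℝ) : ℝ :=
  ((∑' x, enormZ x ^ φ * S x) / suscept S) ^ (1 / φ)

/-- A critical family of OZ systems. -/
structure CriticalFamily (d : ℕ) (δ zc M K ζ : ℝ) (S J h : ℝ → (Fin d → ℤ) → ℝ) : Prop where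
  δ_pos : 0 < δ
  assumOmega : ∀ z ∈ Set.Ico (zc - δ) zc, AssumptionOmega (S z)
  assumJ : ∀ z ∈ Set.Ico (zc - δ) zc, AssumptionJ (S z) (J z) (h z) M K ζ
  mass_tendsto : Tendsto (fun z => mass (S z)) (𝓝[<] zc) (𝓝 0)

/-- Convolution on ℤ. -/
def convZ (f g : ℤ → ℝ) (x : ℤ) : ℝ := ∑' y, f (x - y) * g y

/-- n-fold convolution power on ℤ. -/
def convZPow (f : ℤ → ℝ) : ℕ → ℤ → ℝ
  | 0 => fun x => if x = 0 then 1 else 0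
  | n + 1 => convZ f (convZPow f n)

/-! ### Fourier coefficients on the torus -/

section Torus

open UnitAddTorus

local instance : MeasureSpace UnitAddCircle := ⟨AddCircle.haarAddCircle⟩

local instance : IsProbabilityMeasure (volume : Measure UnitAddCircle) :=
  inferInstanceAs (IsProbabilityMeasure AddCircle.haarAddCircle)

/-- Continuous functions on the `d`-dimensional torus. -/
abbrev Tor (d : ℕ) := C(UnitAddTorus (Fin d), ℂ)

/-- The projection of `ℝ^d` onto the torus. -/
def kap (θ : Fin d → ℝ) : UnitAddTorus (Fin d) := fun i => (θ i : UnitAddCircle)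

/-- The fundamental domain of the torus. -/
def cube (d : ℕ) : Set (Fin d → ℝ) := {θ | ∀ i, θ i ∈ Set.Ioc (-1/2 : ℝ) (-1/2 + 1)}

/-- The Fourier coefficient of a continuous function on the torus. -/
def co (F : Tor d) (x : Fin d → ℤ) : ℂ := ∫ θ in cube d, mFourier (-x) (kap θ) * F (kap θ)

/-- The Fourier series with coefficients `f`. -/
def hatf (f : (Fin d → ℤ) → ℝ) : Tor d := ∑' y, (f y : ℂ) • mFourier y

lemma co_eq (F : Tor d) (x : Fin d → ℤ) : co F x = mFourierCoeff F x := by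
  rw [mFourierCoeff_eq_integral F x (fun _ => -1/2)]
  rfl

lemma measurableSet_cube : MeasurableSet (cube d) := by
  have : cube d = Set.univ.pi fun _ : Fin d => Set.Ioc (-1/2 : ℝ) (-1/2 + 1) := by
    ext; simp [cube]
  rw [this]
  exact MeasurableSet.univ_pi fun i => measurableSet_Ioc

lemma volume_cube : volume (cube d) = 1 := by
  have : cube d = Set.univ.pi fun _ : Fin d => Set.Ioc (-1/2 : ℝ) (-1/2 + 1) := by
    ext; simp [cube]
  rw [this, volume_pi_pi]
  simp

instance : IsProbabilityMeasure (volume.restrict (cube d)) := ⟨by simp [volume_cube]⟩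

lemma continuous_kap : Continuous (kap (d := d)) :=
  continuous_pi fun i => (AddCircle.continuous_mk' 1).comp (continuous_apply i)

lemma mFourier_kap (y : Fin d → ℤ) (θ : Fin d → ℝ) :
    mFourier y (kap θ) = Complex.exp (2 * π * Complex.I * (rdotZ θ y : ℂ)) := by
  simp only [mFourier, kap, ContinuousMap.coe_mk, fourier_coe_apply]
  rw [← Complex.exp_sum]
  congr 1
  simp only [rdotZ]
  push_cast
  rw [Finset.mul_sum]
  refine Finset.sum_congr rfl fun i _ => ?_
  ring

lemma norm_mFourier_apply (y : Fin d → ℤ) (z : UnitAddTorus (Fin d)) : ‖mFourier y z‖ = 1 := by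
  simp only [mFourier, ContinuousMap.coe_mk, norm_prod]
  exact Finset.prod_eq_one fun b _ => by rw [fourier_apply]; exact Circle.norm_coe _

lemma integrable_cube (F : Tor d) : IntegrableOn (fun θ => F (kap θ)) (cube d) := by
  refine Integrable.mono' (integrable_const ‖F‖)
    (F.continuous.comp continuous_kap).aestronglyMeasurable ?_
  exact Eventually.of_forall fun θ => F.norm_coe_le_norm _

lemma norm_co_le_integral (F : Tor d) (x : Fin d → ℤ) :
    ‖co F x‖ ≤ ∫ θ in cube d, ‖F (kap θ)‖ := by
  refine (norm_integral_le_integral_norm _).trans_eq ?_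
  simp [norm_mFourier_apply]

lemma norm_co_le (F : Tor d) (x : Fin d → ℤ) : ‖co F x‖ ≤ ‖F‖ := by
  refine (norm_co_le_integral F x).trans ?_
  calc ∫ θ in cube d, ‖F (kap θ)‖ ≤ ∫ θ in cube d, ‖F‖ :=
        integral_mono (integrable_cube F).norm (integrable_const _)
          fun θ => F.norm_coe_le_norm _
    _ = ‖F‖ := by simp [Measure.real]

/-- Fourier coefficients as continuous linear functionals. -/
def coL (x : Fin d → ℤ) : Tor d →L[ℂ] ℂ :=
  LinearMap.mkContinuous
    { toFun := fun F => co F x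
      map_add' := fun F G => by
        have h1 := integrable_cube (mFourier (-x) * F)
        have h2 := integrable_cube (mFourier (-x) * G)
        simp only [co, ContinuousMap.add_apply, mul_add]
        exact integral_add h1 h2
      map_smul' := fun c F => by
        simp only [co, ContinuousMap.smul_apply, RingHom.id_apply, smul_eq_mul,
          ← integral_const_mul]
        congr 1
        ext θ
        ring }
    1 fun F => by simpa using norm_co_le F x

lemma coL_apply (x : Fin d → ℤ) (F : Tor d) : coL x F = co F x := rfl

lemma co_mFourier_mul (y x : Fin d → ℤ) (F : Tor d) :
    co (mFourier y * F) x = co F (x - y) := by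
  simp only [co, ContinuousMap.mul_apply, ← mul_assoc, ← mFourier_add]
  congr 3
  ext θ
  congr 3
  abel

lemma co_one (x : Fin d → ℤ) : co (1 : Tor d) x = if x = 0 then 1 else 0 := by
  have h := (orthonormal_iff_ite.mp (orthonormal_mFourier (d := Fin d))) x 0
  have h2 : inner ℂ (mFourierLp 2 x) (mFourierLp 2 (0 : Fin d → ℤ))
      = mFourierCoeff (1 : Tor d) x := by
    rw [ContinuousMap.inner_toLp, mFourier_zero, mFourierCoeff]
    simp [mFourier_neg]
  rw [co_eq, ← h2, h]

lemma hasSum_hatf {f : (Fin d → ℤ) → ℝ} (hf : Summable fun x => |f x|) :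
    HasSum (fun y => (f y : ℂ) • mFourier y) (hatf f) := by
  refine Summable.hasSum (Summable.of_norm ?_)
  simpa [norm_smul, mFourier_norm] using hf

lemma norm_hatf_le {f : (Fin d → ℤ) → ℝ} (hf : Summable fun x => |f x|) :
    ‖hatf f‖ ≤ ∑' x, |f x| := by
  refine (norm_tsum_le_tsum_norm ?_).trans_eq ?_
  · simpa [norm_smul, mFourier_norm] using hf
  · simp [norm_smul, mFourier_norm]

lemma hasSum_co_hatf_mul {f : (Fin d → ℤ) → ℝ} (hf : Summable fun x => |f x|) (F : Tor d)
    (x : Fin d → ℤ) : HasSum (fun y => (f y : ℂ) * co F (x - y)) (co (hatf f * F) x) := by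
  have h := ((hasSum_hatf hf).mul_right F).mapL (coL x)
  refine h.congr_fun fun y => ?_
  simp only [smul_mul_assoc, map_smul, coL_apply, co_mFourier_mul, smul_eq_mul]

lemma co_hatf {f : (Fin d → ℤ) → ℝ} (hf : Summable fun x => |f x|) (x : Fin d → ℤ) :
    co (hatf f) x = f x := by
  have h := hasSum_co_hatf_mul hf 1 x
  rw [mul_one] at h
  have h2 : HasSum (fun y => (f y : ℂ) * co (1 : Tor d) (x - y)) (f x : ℂ) := by
    convert hasSum_ite_eq x (f x : ℂ) using 2 with y
    rw [co_one]
    by_cases hy : y = x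
    · simp [hy]
    · simp [hy, sub_eq_zero, Ne.symm hy]
  exact h.unique h2

lemma hasSum_hatf_apply {f : (Fin d → ℤ) → ℝ} (hf : Summable fun x => |f x|)
    (z : UnitAddTorus (Fin d)) : HasSum (fun y => (f y : ℂ) * mFourier y z) (hatf f z) := by
  have := (hasSum_hatf hf).mapL (ContinuousMap.evalCLM ℂ z)
  simpa using this

lemma co_sq (F : Tor d) : Summable (fun x => ‖co F x‖ ^ 2) ∧
    ∑' x, ‖co F x‖ ^ 2 ≤ ∫ θ in cube d, ‖F (kap θ)‖ ^ 2 := by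
  have h := hasSum_sq_mFourierCoeff (ContinuousMap.toLp (E := ℂ) 2 volume ℂ F)
  simp only [mFourierCoeff_toLp, ← co_eq] at h
  refine ⟨h.summable, h.tsum_eq.le.trans_eq ?_⟩
  have h3 : ∫ t, ‖(ContinuousMap.toLp (E := ℂ) 2 volume ℂ F) t‖ ^ 2 =
      ∫ t : UnitAddTorus (Fin d), ‖F t‖ ^ 2 := by
    refine integral_congr_ae ?_
    filter_upwards [ContinuousMap.coeFn_toLp (p := 2) (𝕜 := ℂ) volume F] with t ht
    rw [ht]
  rw [h3, integral_preimage _ (fun _ => -1/2)]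
  rfl

lemma eq_zero_of_co_eq_zero {D : Tor d} (h : ∀ x, co D x = 0) : D = 0 := by
  have h0 : mFourierCoeff D = fun _ => (0 : ℂ) := funext fun x => by rw [← co_eq, h]
  have h1 : HasSum (fun i => mFourierCoeff D i • mFourier i) D :=
    hasSum_mFourier_series_of_summable (by rw [h0]; exact summable_zero)
  have h2 : (fun i => mFourierCoeff D i • mFourier i) = fun _ => (0 : Tor d) := by
    funext i
    rw [h0]
    exact zero_smul ℂ (mFourier i : Tor d)
  rw [h2] at h1
  exact h1.unique hasSum_zero

lemma co_injective {F G : Tor d} (h : ∀ x, co F x = co G x) : F = G := by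
  refine sub_eq_zero.mp (eq_zero_of_co_eq_zero fun x => ?_)
  have : co (F - G) x = co F x - co G x := map_sub (coL x) F G
  rw [this, h, sub_self]

lemma hatf_of_conv {S J h : (Fin d → ℤ) → ℝ} (hS : Summable fun x => |S x|)
    (hJ : Summable fun x => |J x|) (hh : Summable fun x => |h x|)
    (H : ∀ x, S x = h x + conv J S x) : hatf S = hatf h + hatf J * hatf S := by
  refine co_injective fun x => ?_
  rw [← coL_apply, ← coL_apply, map_add, coL_apply, coL_apply, coL_apply, co_hatf hS, co_hatf hh,
    H x, ← (hasSum_co_hatf_mul hJ (hatf S) x).tsum_eq]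
  simp only [co_hatf hS]
  push_cast
  rw [conv, ← (Equiv.subLeft x).tsum_eq]
  push_cast
  simp

end Torus

/-! ### Exponentials of functions on the torus -/

section TorusExp

open NormedSpace

lemma kap_surj (z : UnitAddTorus (Fin d)) : ∃ θ ∈ cube d, kap θ = z := by
  refine ⟨fun i => (AddCircle.equivIoc (1 : ℝ) (-1/2) (z i)).1, fun i => ?_, ?_⟩
  · exact (AddCircle.equivIoc (1 : ℝ) (-1/2) (z i)).2
  · funext i
    exact (AddCircle.equivIoc (1 : ℝ) (-1/2)).symm_apply_apply (z i)

lemma tor_exp_apply (F : Tor d) (z : UnitAddTorus (Fin d)) : exp F z = Complex.exp (F z) := by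
  have h1 := (exp_series_hasSum_exp' (𝕂 := ℂ) F).mapL (ContinuousMap.evalCLM ℂ z)
  have h2 := exp_series_hasSum_exp' (𝕂 := ℂ) (F z)
  rw [← Complex.exp_eq_exp_ℂ] at h2
  exact h1.unique (h2.congr_fun fun n => rfl)

lemma norm_tor_exp_le (F : Tor d) {c : ℝ} (h : ∀ z, (F z).re ≤ c) : ‖exp F‖ ≤ Real.exp c := by
  refine (ContinuousMap.norm_le _ (Real.exp_pos c).le).mpr fun z => ?_
  rw [tor_exp_apply, Complex.norm_exp]
  exact Real.exp_le_exp.mpr (h z)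

lemma continuous_co_exp (G F : Tor d) (x : Fin d → ℤ) :
    Continuous fun t : ℝ => co (G * exp (t • F)) x := by
  have h : Continuous fun t : ℝ => exp (t • F) :=
    continuous_iff_continuousAt.mpr fun t => (hasDerivAt_exp_smul_const (𝕂 := ℝ) F t).continuousAt
  exact (coL x).continuous.comp (continuous_const.mul h)

lemma norm_co_exp_le (G u : Tor d) {ε : ℝ} (hu : ∀ z, ε ≤ (u z).re) (x : Fin d → ℤ) {t : ℝ}
    (ht : 0 ≤ t) : ‖co (G * exp (t • (-u))) x‖ ≤ ‖G‖ * Real.exp (-(ε * t)) := by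
  refine (norm_co_le _ _).trans ((norm_mul_le _ _).trans ?_)
  gcongr
  refine norm_tor_exp_le _ fun z => ?_
  have := mul_le_mul_of_nonneg_left (hu z) ht
  simp
  linarith

lemma integral_co_exp {A G u : Tor d} (hA : A * u = G) {ε : ℝ} (hε : 0 < ε)
    (hu : ∀ z, ε ≤ (u z).re) (x : Fin d → ℤ) :
    ∫ t in Set.Ioi (0 : ℝ), co (G * exp (t • (-u))) x = co A x := by
  have hint : IntegrableOn (fun t : ℝ => co (G * exp (t • (-u))) x) (Set.Ioi 0) := by
    have h1 : IntegrableOn (fun t : ℝ => ‖G‖ * Real.exp (-(ε * t))) (Set.Ioi 0) := by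
      have := (exp_neg_integrableOn_Ioi 0 hε).const_mul ‖G‖
      simpa only [IntegrableOn, neg_mul] using this
    refine Integrable.mono' h1 (continuous_co_exp G (-u) x).aestronglyMeasurable ?_
    refine (ae_restrict_iff' measurableSet_Ioi).mpr (Eventually.of_forall fun t ht => ?_)
    exact norm_co_exp_le G u hu x (le_of_lt ht)
  have hd : ∀ t : ℝ, HasDerivAt (fun t : ℝ => -co (A * exp (t • (-u))) x)
      (co (G * exp (t • (-u))) x) t := fun t => by
    have h1 := ((hasDerivAt_exp_smul_const (𝕂 := ℝ) (-u) t).const_mul A)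
    have h2 := (((coL x).restrictScalars ℝ).hasFDerivAt.comp_hasDerivAt t h1).neg
    refine h2.congr_deriv ?_
    simp only [ContinuousLinearMap.coe_restrictScalars', coL_apply]
    rw [← hA, show A * (exp (t • -u) * -u) = -(A * u * exp (t • -u)) by ring,
      ← coL_apply, map_neg, neg_neg, coL_apply]
  have hlim : Tendsto (fun t : ℝ => -co (A * exp (t • (-u))) x) atTop (𝓝 0) := by
    rw [← neg_zero]
    refine Tendsto.neg ?_
    refine squeeze_zero_norm' (a := fun t => ‖A‖ * Real.exp (-(ε * t))) ?_ ?_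
    · filter_upwards [eventually_ge_atTop 0] with t ht
      exact norm_co_exp_le A u hu x ht
    · rw [← mul_zero ‖A‖]
      refine Tendsto.const_mul _ (Real.tendsto_exp_neg_atTop_nhds_zero.comp ?_)
      exact tendsto_id.const_mul_atTop hε
  have := MeasureTheory.integral_Ioi_of_hasDerivAt_of_tendsto'
    (a := 0) (fun t _ => hd t) hint hlim
  rw [this, show (0 : ℝ) • (-u) = 0 from zero_smul ℝ (-u), exp_zero, mul_one, zero_sub, neg_neg]

lemma hatf_smul (t : ℝ) (f : (Fin d → ℤ) → ℝ) : hatf (fun x => t * f x) = t • hatf f := by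
  have : (fun y : Fin d → ℤ => ((t * f y : ℝ) : ℂ) • (UnitAddTorus.mFourier y : Tor d)) =
      fun y => t • ((f y : ℂ) • (UnitAddTorus.mFourier y : Tor d)) := by
    funext y
    ext z
    simp [mul_assoc]
  rw [hatf, this, hatf, tsum_const_smul'']

lemma rdotZ_sub (μ : Fin d → ℝ) (x y : Fin d → ℤ) : rdotZ μ (x - y) = rdotZ μ x - rdotZ μ y := by
  simp [rdotZ, mul_sub, Finset.sum_sub_distrib]

lemma co_pow_tilt {f : (Fin d → ℤ) → ℝ} {l : Fin d → ℝ} (hf : Summable fun x => |f x|)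
    (hl : Summable fun x => |tilt f l x|) (n : ℕ) (x : Fin d → ℤ) :
    co (hatf (tilt f l) ^ n) x = Real.exp (rdotZ l x) * co (hatf f ^ n) x := by
  induction n generalizing x with
  | zero =>
    rw [pow_zero, pow_zero, co_one]
    split_ifs with h
    · simp [h, rdotZ]
    · simp
  | succ n ih =>
    rw [pow_succ', pow_succ']
    have h1 := hasSum_co_hatf_mul hl (hatf (tilt f l) ^ n) x
    have h2 := (hasSum_co_hatf_mul hf (hatf f ^ n) x).mul_left (Real.exp (rdotZ l x) : ℂ)
    refine h1.unique (h2.congr_fun fun y => ?_)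
    rw [ih, rdotZ_sub, Real.exp_sub, tilt]
    push_cast
    field_simp

lemma co_exp_tilt {f : (Fin d → ℤ) → ℝ} {l : Fin d → ℝ} (hf : Summable fun x => |f x|)
    (hl : Summable fun x => |tilt f l x|) (x : Fin d → ℤ) :
    co (exp (hatf (tilt f l))) x = Real.exp (rdotZ l x) * co (exp (hatf f)) x := by
  have h1 := (exp_series_hasSum_exp' (𝕂 := ℂ) (hatf (tilt f l))).mapL (coL x)
  have h2 := ((exp_series_hasSum_exp' (𝕂 := ℂ) (hatf f)).mapL (coL x)).mul_left
    (Real.exp (rdotZ l x) : ℂ)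
  refine h1.unique (h2.congr_fun fun n => ?_)
  simp only [map_smul, coL_apply, co_pow_tilt hf hl, smul_eq_mul]
  ring

end TorusExp

/-! ### Euclidean norms -/

section Norms

lemma enormR_eq_norm (x : Fin d → ℝ) : enormR x = ‖WithLp.toLp 2 x‖ := by
  simp [enormR, EuclideanSpace.norm_eq]

lemma enormZ_eq (y : Fin d → ℤ) : enormZ y = enormR (toR y) := rfl

lemma rdotZ_eq (μ : Fin d → ℝ) (y : Fin d → ℤ) : rdotZ μ y = rdot μ (toR y) := rfl

lemma enormR_nonneg (x : Fin d → ℝ) : 0 ≤ enormR x := Real.sqrt_nonneg _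

lemma enormZ_nonneg (x : Fin d → ℤ) : 0 ≤ enormZ x := Real.sqrt_nonneg _

lemma enormR_sq (x : Fin d → ℝ) : enormR x ^ 2 = ∑ i, x i ^ 2 :=
  Real.sq_sqrt (Finset.sum_nonneg fun _ _ => sq_nonneg _)

lemma enormR_add_le (x y : Fin d → ℝ) : enormR (x + y) ≤ enormR x + enormR y := by
  simp only [enormR_eq_norm]
  exact norm_add_le (WithLp.toLp 2 x) (WithLp.toLp 2 y)

lemma enormR_smul (t : ℝ) (x : Fin d → ℝ) : enormR (t • x) = |t| * enormR x := by
  simp only [enormR_eq_norm, WithLp.toLp_smul, norm_smul, Real.norm_eq_abs]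

lemma enormR_neg (x : Fin d → ℝ) : enormR (-x) = enormR x := by
  simp [enormR]

lemma abs_rdot_le (x y : Fin d → ℝ) : |rdot x y| ≤ enormR x * enormR y := by
  have h := Finset.sum_mul_sq_le_sq_mul_sq Finset.univ x y
  refine Real.abs_le_sqrt h |>.trans_eq ?_
  rw [Real.sqrt_mul (Finset.sum_nonneg fun i _ => sq_nonneg _)]
  rfl

lemma abs_rdotZ_le (x : Fin d → ℝ) (y : Fin d → ℤ) : |rdotZ x y| ≤ enormR x * enormZ y :=
  abs_rdot_le x (toR y)

lemma rdot_self (x : Fin d → ℝ) : rdot x x = enormR x ^ 2 := by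
  rw [enormR_sq]
  exact Finset.sum_congr rfl fun i _ => (sq (x i)).symm

lemma rdot_smul_left (t : ℝ) (x y : Fin d → ℝ) : rdot (t • x) y = t * rdot x y := by
  simp [rdot, Finset.mul_sum, mul_assoc]

lemma rdot_sub_left (x x' y : Fin d → ℝ) : rdot (x - x') y = rdot x y - rdot x' y := by
  simp [rdot, sub_mul, Finset.sum_sub_distrib]

lemma rdot_add_left (x x' y : Fin d → ℝ) : rdot (x + x') y = rdot x y + rdot x' y := by
  simp [rdot, add_mul, Finset.sum_add_distrib]

lemma rdot_comm (x y : Fin d → ℝ) : rdot x y = rdot y x := by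
  simp [rdot, mul_comm]

lemma rdotZ_smul (t : ℝ) (x : Fin d → ℝ) (y : Fin d → ℤ) :
    rdotZ (t • x) y = t * rdotZ x y := rdot_smul_left t x (toR y)

lemma rdotZ_add_left (x x' : Fin d → ℝ) (y : Fin d → ℤ) :
    rdotZ (x + x') y = rdotZ x y + rdotZ x' y := rdot_add_left x x' (toR y)

lemma abs_apply_le_enormR (x : Fin d → ℝ) (i : Fin d) : |x i| ≤ enormR x := by
  rw [enormR_eq_norm]
  exact PiLp.norm_apply_le (WithLp.toLp 2 x) i

lemma one_le_enormZ {y : Fin d → ℤ} (hy : y ≠ 0) : 1 ≤ enormZ y := by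
  obtain ⟨i, hi⟩ := Function.ne_iff.mp hy
  have h1 : (1 : ℝ) ≤ |(y i : ℝ)| := by
    exact_mod_cast Int.one_le_abs hi
  exact h1.trans (abs_apply_le_enormR (toR y) i)

lemma enormZ_zero : enormZ (0 : Fin d → ℤ) = 0 := by simp [enormZ]

lemma enormZ_rpow_le {s t : ℝ} (hs : 0 < s) (hst : s ≤ t) (y : Fin d → ℤ) :
    enormZ y ^ s ≤ enormZ y ^ t := by
  rcases eq_or_ne y 0 with rfl | hy
  · rw [enormZ_zero, Real.zero_rpow hs.ne', Real.zero_rpow (by linarith)]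
  · exact Real.rpow_le_rpow_of_exponent_le (one_le_enormZ hy) hst

end Norms

/-! ### Uniform bounds on a kernel -/

section Kernel

/-- Half the decay exponent of the kernel. -/
def aExp (d : ℕ) : ℝ := if d ≤ 3 then 1 else ((d : ℝ) - 1) / 2

/-- The integrability exponent of the kernel. -/
def pQ (d : ℕ) : ℝ := if d ≤ 3 then 1 else min ((d : ℝ) / 3) 2

lemma one_le_aExp : 1 ≤ aExp d := by
  unfold aExp
  split_ifs with h
  · exact le_rfl
  · have : (4 : ℝ) ≤ d := by exact_mod_cast (by omega : 4 ≤ d)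
    linarith

lemma one_le_pQ : 1 ≤ pQ d := by
  unfold pQ
  split_ifs with h
  · exact le_rfl
  · have : (4 : ℝ) ≤ d := by exact_mod_cast (by omega : 4 ≤ d)
    exact le_min (by linarith) (by norm_num)

lemma pQ_le_two : pQ d ≤ 2 := by
  unfold pQ
  split_ifs
  · norm_num
  · exact min_le_right _ _

/-- The summability and infrared bounds for a kernel `Q` and a prefactor `g`. -/
structure Ker (M κ ζ : ℝ) (Q g : (Fin d → ℤ) → ℝ) : Prop where
  Q_sum : Summable fun y => |Q y|
  Q_le : ∑' y, |Q y| ≤ M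
  Qm_sum : Summable fun y => enormZ y ^ (2 + ζ) * |Q y|
  Qm_le : ∑' y, enormZ y ^ (2 + ζ) * |Q y| ≤ M
  Qp_sum : Summable fun y => (enormZ y ^ (2 * aExp d) * |Q y|) ^ pQ d
  Qp_le : ∑' y, (enormZ y ^ (2 * aExp d) * |Q y|) ^ pQ d ≤ M
  g_sum : Summable fun y => |g y|
  g_le : ∑' y, |g y| ≤ M
  gz_sum : Summable fun y => enormZ y ^ ζ * |g y|
  gz_le : ∑' y, enormZ y ^ ζ * |g y| ≤ M
  g2_sum : Summable fun y => (enormZ y ^ (2 * aExp d) * |g y|) ^ (2 : ℝ)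
  g2_le : ∑' y, (enormZ y ^ (2 * aExp d) * |g y|) ^ (2 : ℝ) ≤ M
  infrared : ∀ θ ∈ cube d, κ * enormR θ ^ 2 ≤ (∑' y, Q y) - (hatf Q (kap θ)).re

lemma summable_of_lpNorm_le {f : (Fin d → ℤ) → ℝ} {p M : ℝ} (hp : 0 < p) (hM : 0 ≤ M)
    (h : lpNorm f p ≤ ENNReal.ofReal M) :
    (Summable fun y => |f y| ^ p) ∧ ∑' y, |f y| ^ p ≤ M ^ p := by
  have h1 : ∑' y, ENNReal.ofReal (|f y| ^ p) ≤ ENNReal.ofReal (M ^ p) := by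
    have h2 := ENNReal.rpow_le_rpow h hp.le
    rwa [lpNorm, ← ENNReal.rpow_mul, one_div, inv_mul_cancel₀ hp.ne', ENNReal.rpow_one,
      ENNReal.ofReal_rpow_of_nonneg hM hp.le] at h2
  have h0 : ∀ y, 0 ≤ |f y| ^ p := fun y => by positivity
  have hs : Summable fun y => |f y| ^ p := by
    have := ENNReal.summable_toReal (h1.trans_lt ENNReal.ofReal_lt_top).ne
    simpa [ENNReal.toReal_ofReal (h0 _)] using this
  refine ⟨hs, ?_⟩
  rw [← ENNReal.ofReal_tsum_of_nonneg h0 hs] at h1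
  exact (ENNReal.ofReal_le_ofReal_iff (by positivity)).mp h1

lemma summable_sq_of_summable_rpow {f : (Fin d → ℤ) → ℝ} {p M : ℝ} (hf : ∀ y, 0 ≤ f y) (hp : 0 < p)
    (hp2 : p ≤ 2) (hM : 0 ≤ M) (hs : Summable fun y => f y ^ p) (h : ∑' y, f y ^ p ≤ M ^ p) :
    (Summable fun y => f y ^ (2 : ℝ)) ∧ ∑' y, f y ^ (2 : ℝ) ≤ M ^ (2 : ℝ) := by
  have h1 : ∀ y, f y ≤ M := fun y => by
    have := (hs.le_tsum y fun z _ => Real.rpow_nonneg (hf z) p).trans h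
    exact (Real.rpow_le_rpow_iff (hf y) hM hp).mp this
  have h2 : ∀ y, f y ^ (2 : ℝ) ≤ M ^ (2 - p) * f y ^ p := fun y => by
    rcases (hf y).eq_or_lt with h0 | h0
    · rw [← h0, Real.zero_rpow two_ne_zero, Real.zero_rpow hp.ne', mul_zero]
    · calc f y ^ (2 : ℝ) = f y ^ (2 - p) * f y ^ p := by
            rw [← Real.rpow_add h0]; congr 1; ring
        _ ≤ _ := by
            have := Real.rpow_le_rpow (hf y) (h1 y) (by linarith : 0 ≤ 2 - p)
            have h3 := Real.rpow_nonneg (hf y) p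
            gcongr
  have h4 : Summable fun y => f y ^ (2 : ℝ) :=
    Summable.of_nonneg_of_le (fun y => Real.rpow_nonneg (hf y) 2) h2 (hs.mul_left _)
  refine ⟨h4, ?_⟩
  calc ∑' y, f y ^ (2 : ℝ) ≤ ∑' y, M ^ (2 - p) * f y ^ p := h4.tsum_le_tsum h2 (hs.mul_left _)
    _ = M ^ (2 - p) * ∑' y, f y ^ p := tsum_mul_left
    _ ≤ M ^ (2 - p) * M ^ p := by
        have := Real.rpow_nonneg hM (2 - p)
        gcongr
    _ = M ^ (2 : ℝ) := by
        rcases hM.eq_or_lt with h0 | h0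
        · rw [← h0, Real.zero_rpow hp.ne', Real.zero_rpow two_ne_zero, mul_zero]
        · rw [← Real.rpow_add h0]; congr 1; ring

lemma abs_enormZ_rpow_mul (y : Fin d → ℤ) (s q : ℝ) :
    |enormZ y ^ s * q| = enormZ y ^ s * |q| := by
  rw [abs_mul, abs_of_nonneg (Real.rpow_nonneg (enormZ_nonneg y) s)]

lemma hatf_kap_eq_fourierZ {Q : (Fin d → ℤ) → ℝ} (hQ : Summable fun y => |Q y|) (θ : Fin d → ℝ) :
    hatf Q (kap θ) = fourierZ Q ((-(2 * π)) • θ) := by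
  rw [← (hasSum_hatf_apply hQ (kap θ)).tsum_eq, fourierZ]
  refine tsum_congr fun y => ?_
  rw [mFourier_kap, rdotZ_smul]
  congr 2
  push_cast
  ring

lemma fourierZ_zero (Q : (Fin d → ℤ) → ℝ) : fourierZ Q 0 = ((∑' y, Q y : ℝ) : ℂ) := by
  rw [fourierZ, Complex.ofReal_tsum]
  refine tsum_congr fun y => ?_
  simp [rdotZ]

lemma MemQ.ker {M K ζ : ℝ} {Q g : (Fin d → ℤ) → ℝ} (h : MemQ M K ζ Q g) (hd : 1 ≤ d)
    (hM : 0 < M) (hζ : 0 < ζ) : Ker ((M + 1) ^ 2) (4 * π ^ 2 * K) (min ζ 1) Q g := by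
  have hM1 : M ≤ (M + 1) ^ 2 := by nlinarith
  have hMp : ∀ p : ℝ, p ≤ 2 → 0 ≤ p → M ^ p ≤ (M + 1) ^ 2 := fun p hp hp0 => by
    calc M ^ p ≤ (M + 1) ^ p := Real.rpow_le_rpow hM.le (by linarith) hp0
      _ ≤ (M + 1) ^ (2 : ℝ) := Real.rpow_le_rpow_of_exponent_le (by linarith) hp
      _ = _ := by norm_cast
  have hz0 : 0 < min ζ 1 := lt_min hζ one_pos
  obtain ⟨a1, a2⟩ := summable_of_lpNorm_le one_pos hM.le h.Q_l1
  obtain ⟨b1, b2⟩ := summable_of_lpNorm_le one_pos hM.le h.Q_moment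
  obtain ⟨c1, c2⟩ := summable_of_lpNorm_le one_pos hM.le h.g_l1
  obtain ⟨e1, e2⟩ := summable_of_lpNorm_le one_pos hM.le h.g_zeta
  simp only [Real.rpow_one, abs_enormZ_rpow_mul] at a1 a2 b1 b2 c1 c2 e1 e2
  have hmono : ∀ (s t : ℝ) (f : (Fin d → ℤ) → ℝ), 0 < s → s ≤ t →
      (Summable fun y => enormZ y ^ t * |f y|) → ∑' y, enormZ y ^ t * |f y| ≤ M →
      (Summable fun y => enormZ y ^ s * |f y|) ∧ ∑' y, enormZ y ^ s * |f y| ≤ M := by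
    intro s t f hs hst hf1 hf2
    have h3 : ∀ y, enormZ y ^ s * |f y| ≤ enormZ y ^ t * |f y| := fun y =>
      mul_le_mul_of_nonneg_right (enormZ_rpow_le hs hst y) (abs_nonneg _)
    have h4 : Summable fun y => enormZ y ^ s * |f y| := Summable.of_nonneg_of_le
      (fun y => mul_nonneg (Real.rpow_nonneg (enormZ_nonneg y) s) (abs_nonneg _)) h3 hf1
    exact ⟨h4, (h4.tsum_le_tsum h3 hf1).trans hf2⟩
  obtain ⟨b3, b4⟩ := hmono (2 + min ζ 1) (2 + ζ) Q (by linarith)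
    (by linarith [min_le_left ζ 1]) b1 b2
  obtain ⟨e3, e4⟩ := hmono (min ζ 1) ζ g hz0 (min_le_left ζ 1) e1 e2
  obtain ⟨b5, b6⟩ := hmono 2 (2 + ζ) Q (by linarith) (by linarith) b1 b2
  have hQp : (Summable fun y => (enormZ y ^ (2 * aExp d) * |Q y|) ^ pQ d) ∧
      ∑' y, (enormZ y ^ (2 * aExp d) * |Q y|) ^ pQ d ≤ (M + 1) ^ 2 := by
    by_cases h3 : d ≤ 3
    · simp only [aExp, pQ, h3, if_true, mul_one, Real.rpow_one]
      exact ⟨b5, b6.trans hM1⟩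
    · obtain ⟨f1, f2⟩ := summable_of_lpNorm_le (zero_lt_one.trans_le (one_le_pQ (d := d))) hM.le
        (by simpa only [pQ, if_neg h3] using h.Q_dm1 (by omega))
      simp only [abs_enormZ_rpow_mul] at f1 f2
      have : 2 * aExp d = (d : ℝ) - 1 := by rw [aExp, if_neg h3]; ring
      rw [this]
      exact ⟨f1, f2.trans (hMp _ pQ_le_two (zero_le_one.trans one_le_pQ))⟩
  have hg2 : (Summable fun y => (enormZ y ^ (2 * aExp d) * |g y|) ^ (2 : ℝ)) ∧
      ∑' y, (enormZ y ^ (2 * aExp d) * |g y|) ^ (2 : ℝ) ≤ (M + 1) ^ 2 := by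
    by_cases h3 : d ≤ 3
    · have hp : 0 < min (pExp d ζ) 2 := by
        refine lt_min ?_ two_pos
        have hz2 : 0 < min ζ 2 := lt_min hζ two_pos
        unfold pExp
        split_ifs with h1
        · norm_num
        · have : (2 : ℝ) ≤ d := by exact_mod_cast (by omega : 2 ≤ d)
          exact div_pos (by linarith) (by linarith)
      obtain ⟨f1, f2⟩ := summable_of_lpNorm_le hp hM.le h.g_two
      simp only [abs_enormZ_rpow_mul] at f1 f2
      obtain ⟨f3, f4⟩ := summable_sq_of_summable_rpow
        (fun y => mul_nonneg (Real.rpow_nonneg (enormZ_nonneg y) 2) (abs_nonneg _))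
        hp (min_le_right _ _) hM.le f1 f2
      simp only [aExp, h3, if_true, mul_one]
      exact ⟨f3, f4.trans (hMp 2 le_rfl zero_le_two)⟩
    · obtain ⟨f1, f2⟩ := summable_of_lpNorm_le two_pos hM.le (h.g_dm1 (by omega))
      simp only [abs_enormZ_rpow_mul] at f1 f2
      have : 2 * aExp d = (d : ℝ) - 1 := by rw [aExp, if_neg h3]; ring
      rw [this]
      exact ⟨f1, f2.trans (hMp 2 le_rfl zero_le_two)⟩
  exact
    { Q_sum := a1
      Q_le := a2.trans hM1
      Qm_sum := b3
      Qm_le := b4.trans hM1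
      Qp_sum := hQp.1
      Qp_le := hQp.2
      g_sum := c1
      g_le := c2.trans hM1
      gz_sum := e3
      gz_le := e4.trans hM1
      g2_sum := hg2.1
      g2_le := hg2.2
      infrared := fun θ hθ => by
        have h1 := h.infrared ((-(2 * π)) • θ) fun i => by
          have h2 : |θ i| ≤ 1 / 2 := abs_le.mpr ⟨by linarith [(hθ i).1], by linarith [(hθ i).2]⟩
          rw [Pi.smul_apply, smul_eq_mul, abs_mul, abs_neg, abs_of_pos Real.two_pi_pos]
          nlinarith [Real.pi_pos]
        rw [enormR_smul, abs_neg, abs_of_pos Real.two_pi_pos, fourierZ_zero,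
          ← hatf_kap_eq_fourierZ a1, Complex.sub_re, Complex.ofReal_re] at h1
        calc 4 * π ^ 2 * K * enormR θ ^ 2 = K * (2 * π * enormR θ) ^ 2 := by ring
          _ ≤ _ := h1 }

end Kernel

/-! ### Gaussian bounds on the torus -/

section GaussCube

open NormedSpace

lemma exp_neg_mul_enormR_sq (b : ℝ) (θ : Fin d → ℝ) :
    Real.exp (-(b * enormR θ ^ 2)) = ∏ i, Real.exp (-b * θ i ^ 2) := by
  rw [← Real.exp_sum, enormR_sq, Finset.mul_sum, ← Finset.sum_neg_distrib]
  simp [neg_mul]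

lemma integrable_gauss {b : ℝ} (hb : 0 < b) :
    Integrable fun θ : Fin d → ℝ => Real.exp (-(b * enormR θ ^ 2)) := by
  simp only [exp_neg_mul_enormR_sq]
  exact Integrable.fintype_prod (f := fun _ x => Real.exp (-b * x ^ 2))
    fun _ => integrable_exp_neg_mul_sq hb

lemma integral_gauss (b : ℝ) :
    ∫ θ : Fin d → ℝ, Real.exp (-(b * enormR θ ^ 2)) = Real.sqrt (π / b) ^ d := by
  simp only [exp_neg_mul_enormR_sq]
  rw [integral_fintype_prod_volume_eq_pow (fun x : ℝ => Real.exp (-b * x ^ 2)), integral_gaussian]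
  simp

lemma sqrt_pow_eq_rpow {x : ℝ} (hx : 0 ≤ x) : Real.sqrt x ^ d = x ^ ((d : ℝ) / 2) := by
  rw [Real.sqrt_eq_rpow, ← Real.rpow_natCast, ← Real.rpow_mul hx]
  congr 1
  ring

lemma integrable_gauss_cube (c : ℝ) :
    IntegrableOn (fun θ : Fin d → ℝ => Real.exp (-(c * enormR θ ^ 2))) (cube d) := by
  have hc : Continuous fun θ : Fin d → ℝ => Real.exp (-(c * enormR θ ^ 2)) := by
    unfold enormR
    fun_prop
  have hK : IsCompact (Set.univ.pi fun _ : Fin d => Set.Icc (-1/2 : ℝ) (-1/2 + 1)) :=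
    isCompact_univ_pi fun _ => isCompact_Icc
  exact (hc.continuousOn.integrableOn_compact hK).mono_set
    fun θ hθ i _ => Set.Ioc_subset_Icc_self (hθ i)

/-- The constant in the Gaussian bound on the torus. -/
def cGauss (d : ℕ) (κ : ℝ) : ℝ := max 1 ((π / κ) ^ ((d : ℝ) / 2))

lemma cGauss_pos (κ : ℝ) : 0 < cGauss d κ := zero_lt_one.trans_le (le_max_left _ _)

lemma integral_gauss_cube_le {κ t : ℝ} (hκ : 0 < κ) (ht : 0 ≤ t) :
    ∫ θ in cube d, Real.exp (-(t * κ * enormR θ ^ 2)) ≤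
      cGauss d κ * (max t 1) ^ (-((d : ℝ) / 2)) := by
  rcases le_total t 1 with h | h
  · rw [max_eq_right h, Real.one_rpow, mul_one]
    refine le_trans ?_ (le_max_left _ _)
    calc ∫ θ in cube d, Real.exp (-(t * κ * enormR θ ^ 2)) ≤ ∫ θ in cube d, (1 : ℝ) :=
          integral_mono (integrable_gauss_cube _) (integrable_const _) fun θ => by
            refine Real.exp_le_one_iff.mpr (neg_nonpos.mpr ?_)
            positivity
      _ = 1 := by simp [Measure.real]
  · have ht0 : 0 < t := by linarith
    rw [max_eq_left h]
    calc ∫ θ in cube d, Real.exp (-(t * κ * enormR θ ^ 2))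
        ≤ ∫ θ : Fin d → ℝ, Real.exp (-(t * κ * enormR θ ^ 2)) :=
          setIntegral_le_integral (integrable_gauss (by positivity))
            (Eventually.of_forall fun θ => (Real.exp_pos _).le)
      _ = (π / κ) ^ ((d : ℝ) / 2) * t ^ (-((d : ℝ) / 2)) := by
          rw [integral_gauss, sqrt_pow_eq_rpow (by positivity), Real.rpow_neg ht0.le,
            ← div_eq_mul_inv, ← Real.div_rpow (by positivity) ht0.le]
          congr 1
          field_simp
      _ ≤ _ := by
          gcongr
          exact le_max_right _ _

lemma norm_co_le_gauss {F : Tor d} {κ t B : ℝ} (hκ : 0 < κ) (ht : 0 ≤ t) (hB : 0 ≤ B)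
    (hF : ∀ θ ∈ cube d, ‖F (kap θ)‖ ≤ B * Real.exp (-(t * κ * enormR θ ^ 2))) (x : Fin d → ℤ) :
    ‖co F x‖ ≤ B * cGauss d κ * (max t 1) ^ (-((d : ℝ) / 2)) := by
  calc ‖co F x‖ ≤ ∫ θ in cube d, ‖F (kap θ)‖ := norm_co_le_integral F x
    _ ≤ ∫ θ in cube d, B * Real.exp (-(t * κ * enormR θ ^ 2)) :=
        setIntegral_mono_on (integrable_cube F).norm ((integrable_gauss_cube _).const_mul _)
          measurableSet_cube hF
    _ = B * ∫ θ in cube d, Real.exp (-(t * κ * enormR θ ^ 2)) := integral_const_mul _ _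
    _ ≤ B * (cGauss d κ * (max t 1) ^ (-((d : ℝ) / 2))) := by
        gcongr
        exact integral_gauss_cube_le hκ ht
    _ = _ := by ring

lemma tsum_co_sq_le_gauss {F : Tor d} {κ t B : ℝ} (hκ : 0 < κ) (ht : 0 ≤ t)
    (hF : ∀ θ ∈ cube d, ‖F (kap θ)‖ ≤ B * Real.exp (-(t * κ * enormR θ ^ 2))) :
    ∑' x, ‖co F x‖ ^ 2 ≤ B ^ 2 * cGauss d κ * (max t 1) ^ (-((d : ℝ) / 2)) := by
  calc ∑' x, ‖co F x‖ ^ 2 ≤ ∫ θ in cube d, ‖F (kap θ)‖ ^ 2 := (co_sq F).2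
    _ ≤ ∫ θ in cube d, B ^ 2 * Real.exp (-(t * κ * enormR θ ^ 2)) := by
        refine setIntegral_mono_on ?_ ((integrable_gauss_cube _).const_mul _)
          measurableSet_cube fun θ hθ => ?_
        · refine Integrable.mono' (integrable_const (‖F‖ ^ 2))
            ((F.continuous.comp continuous_kap).norm.pow 2).aestronglyMeasurable ?_
          refine Eventually.of_forall fun θ => ?_
          rw [Real.norm_of_nonneg (by positivity)]
          gcongr
          exact F.norm_coe_le_norm _
        · have h1 : Real.exp (-(t * κ * enormR θ ^ 2)) ≤ 1 :=
            Real.exp_le_one_iff.mpr (neg_nonpos.mpr (by positivity))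
          calc ‖F (kap θ)‖ ^ 2 ≤ (B * Real.exp (-(t * κ * enormR θ ^ 2))) ^ 2 :=
                pow_le_pow_left₀ (norm_nonneg _) (hF θ hθ) 2
            _ = B ^ 2 * (Real.exp (-(t * κ * enormR θ ^ 2)) *
                  Real.exp (-(t * κ * enormR θ ^ 2))) := by ring
            _ ≤ B ^ 2 * (Real.exp (-(t * κ * enormR θ ^ 2)) * 1) := by gcongr
            _ = _ := by rw [mul_one]
    _ = B ^ 2 * ∫ θ in cube d, Real.exp (-(t * κ * enormR θ ^ 2)) := integral_const_mul _ _
    _ ≤ B ^ 2 * (cGauss d κ * (max t 1) ^ (-((d : ℝ) / 2))) := by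
        gcongr
        exact integral_gauss_cube_le hκ ht
    _ = _ := by ring

lemma norm_co_hatf_mul_le {f : (Fin d → ℤ) → ℝ} (hf : Summable fun x => |f x|) {F : Tor d} {B : ℝ}
    (hF : ∀ x, ‖co F x‖ ≤ B) (x : Fin d → ℤ) : ‖co (hatf f * F) x‖ ≤ (∑' y, |f y|) * B := by
  have h1 : ∀ y, ‖(f y : ℂ) * co F (x - y)‖ ≤ |f y| * B := fun y => by
    rw [norm_mul, Complex.norm_real, Real.norm_eq_abs]
    have := hF (x - y)
    gcongr
  rw [← (hasSum_co_hatf_mul hf F x).tsum_eq, ← tsum_mul_right]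
  exact tsum_of_norm_bounded (hf.mul_right B).hasSum h1

/-- An interpolated Hölder inequality. -/
lemma norm_tsum_mul_le {ι : Type*} {q e : ι → ℝ} {p A V N C : ℝ} (hp : 1 ≤ p) (hp2 : p ≤ 2)
    (hA : 0 < A) (hV : 0 < V) (hC : 0 ≤ C) (hq : ∀ i, 0 ≤ q i) (he : ∀ i, 0 ≤ e i)
    (hqs : Summable fun i => q i ^ p) (hqN : ∑' i, q i ^ p ≤ N * A ^ p)
    (heC : ∀ i, e i ≤ C * V ^ p) (hes : Summable fun i => e i ^ 2)
    (heS : ∑' i, e i ^ 2 ≤ C * V ^ p) :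
    (Summable fun i => q i * e i) ∧ ∑' i, q i * e i ≤ (C * N + N + C) * (A * V) := by
  have hAV : 0 < A * V := mul_pos hA hV
  have key : ∀ i, q i * e i ≤ ((C + 1) * (A ^ (1 - p) * V)) * q i ^ p +
      (A * V ^ (1 - p)) * e i ^ 2 := fun i => by
    have e1 : A ^ (1 - p) * V = (A * V) ^ (1 - p) * V ^ p := by
      rw [Real.mul_rpow hA.le hV.le, mul_assoc, ← Real.rpow_add hV, sub_add_cancel, Real.rpow_one]
    rcases (hq i).eq_or_lt with h0 | h0
    · rw [← h0, zero_mul, Real.zero_rpow (by linarith)]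
      positivity
    rcases le_total (A * V) (q i) with h | h
    · have h1 : q i ≤ (A * V) ^ (1 - p) * q i ^ p := by
        have h2 : q i ^ (1 - p) ≤ (A * V) ^ (1 - p) :=
          Real.rpow_le_rpow_of_nonpos hAV h (by linarith)
        calc q i = q i ^ (1 - p) * q i ^ p := by
              rw [← Real.rpow_add h0, sub_add_cancel, Real.rpow_one]
          _ ≤ _ := by gcongr
      calc q i * e i ≤ ((A * V) ^ (1 - p) * q i ^ p) * (C * V ^ p) :=
            mul_le_mul h1 (heC i) (he i) (by positivity)
        _ = C * ((A * V) ^ (1 - p) * V ^ p) * q i ^ p := by ring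
        _ = C * (A ^ (1 - p) * V) * q i ^ p := by rw [e1]
        _ ≤ (C + 1) * (A ^ (1 - p) * V) * q i ^ p := by gcongr; linarith
        _ ≤ _ := le_add_of_nonneg_right (by positivity)
    · have h1 : q i ^ 2 ≤ (A * V) ^ (2 - p) * q i ^ p := by
        have h2 : q i ^ (2 - p) ≤ (A * V) ^ (2 - p) :=
          Real.rpow_le_rpow h0.le h (by linarith)
        calc q i ^ 2 = q i ^ (2 - p) * q i ^ p := by
              rw [← Real.rpow_add h0, sub_add_cancel]; norm_cast
          _ ≤ _ := by gcongr
      set k := V ^ (p - 1) / A with hk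
      have hk0 : 0 < k := by positivity
      have hkinv : k⁻¹ = A * V ^ (1 - p) := by
        rw [hk, inv_div, div_eq_mul_inv, ← Real.rpow_neg hV.le, neg_sub]
      have hk2 : k * (A * V) ^ (2 - p) = A ^ (1 - p) * V := by
        rw [hk, Real.mul_rpow hA.le hV.le, show A ^ (1 - p) = A ^ (2 - p) / A by
          rw [← Real.rpow_sub_one hA.ne']; congr 1; ring]
        have : V ^ (p - 1) * V ^ (2 - p) = V := by
          rw [← Real.rpow_add hV, show p - 1 + (2 - p) = 1 by ring, Real.rpow_one]
        calc V ^ (p - 1) / A * (A ^ (2 - p) * V ^ (2 - p))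
            = A ^ (2 - p) / A * (V ^ (p - 1) * V ^ (2 - p)) := by ring
          _ = _ := by rw [this]
      have h3 : q i * e i ≤ k * q i ^ 2 + k⁻¹ * e i ^ 2 := by
        have h4 : k * (k⁻¹ * e i) = e i := by field_simp
        have h5 : 0 ≤ k * (q i - k⁻¹ * e i) ^ 2 := by positivity
        have h6 : k * (q i - k⁻¹ * e i) ^ 2 = k * q i ^ 2 - 2 * q i * (k * (k⁻¹ * e i))
          + (k * (k⁻¹ * e i)) * (k⁻¹ * e i) := by ring
        rw [h6, h4] at h5
        nlinarith [mul_nonneg (hq i) (he i)]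
      calc q i * e i ≤ k * q i ^ 2 + k⁻¹ * e i ^ 2 := h3
        _ ≤ k * ((A * V) ^ (2 - p) * q i ^ p) + k⁻¹ * e i ^ 2 := by gcongr
        _ = (A ^ (1 - p) * V) * q i ^ p + (A * V ^ (1 - p)) * e i ^ 2 := by
            rw [← hk2, hkinv]; ring
        _ ≤ _ := by
            have h7 : 0 ≤ C * (A ^ (1 - p) * V) := by positivity
            refine add_le_add (mul_le_mul_of_nonneg_right ?_ (by positivity)) le_rfl
            linarith
  have hsum := (hqs.mul_left ((C + 1) * (A ^ (1 - p) * V))).add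
    (hes.mul_left (A * V ^ (1 - p)))
  have hs : Summable fun i => q i * e i :=
    Summable.of_nonneg_of_le (fun i => mul_nonneg (hq i) (he i)) key hsum
  refine ⟨hs, ?_⟩
  calc ∑' i, q i * e i ≤ ∑' i, (((C + 1) * (A ^ (1 - p) * V)) * q i ^ p +
        (A * V ^ (1 - p)) * e i ^ 2) := hs.tsum_le_tsum key hsum
    _ = ((C + 1) * (A ^ (1 - p) * V)) * ∑' i, q i ^ p + (A * V ^ (1 - p)) * ∑' i, e i ^ 2 := by
        rw [(hqs.mul_left _).tsum_add (hes.mul_left _), tsum_mul_left, tsum_mul_left]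
    _ ≤ ((C + 1) * (A ^ (1 - p) * V)) * (N * A ^ p) + (A * V ^ (1 - p)) * (C * V ^ p) := by
        gcongr
    _ = (C + 1) * N * (A ^ (1 - p) * A ^ p) * V + C * A * (V ^ (1 - p) * V ^ p) := by ring
    _ = (C * N + N + C) * (A * V) := by
        rw [← Real.rpow_add hA, ← Real.rpow_add hV, sub_add_cancel, Real.rpow_one, Real.rpow_one]
        ring

end GaussCube

/-! ### Truncation and tilting of a kernel -/

section Truncation

open NormedSpace

/-- Restriction of `f` to a ball. -/
def trunc (L : ℝ) (f : (Fin d → ℤ) → ℝ) : (Fin d → ℤ) → ℝ :=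
  fun y => if enormZ y ≤ L then f y else 0

/-- Restriction of `f` to the complement of a ball. -/
def tail (L : ℝ) (f : (Fin d → ℤ) → ℝ) : (Fin d → ℤ) → ℝ :=
  fun y => if enormZ y ≤ L then 0 else f y

lemma trunc_add_tail (L : ℝ) (f : (Fin d → ℤ) → ℝ) (y : Fin d → ℤ) :
    trunc L f y + tail L f y = f y := by
  unfold trunc tail
  split_ifs <;> simp

lemma abs_trunc_le (L : ℝ) (f : (Fin d → ℤ) → ℝ) (y : Fin d → ℤ) : |trunc L f y| ≤ |f y| := by
  unfold trunc
  split_ifs <;> simp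

lemma abs_tail_le (L : ℝ) (f : (Fin d → ℤ) → ℝ) (y : Fin d → ℤ) : |tail L f y| ≤ |f y| := by
  unfold tail
  split_ifs <;> simp

lemma summable_trunc {f : (Fin d → ℤ) → ℝ} (hf : Summable fun y => |f y|) (L : ℝ) :
    Summable fun y => |trunc L f y| :=
  Summable.of_nonneg_of_le (fun _ => abs_nonneg _) (abs_trunc_le L f) hf

lemma summable_tail {f : (Fin d → ℤ) → ℝ} (hf : Summable fun y => |f y|) (L : ℝ) :
    Summable fun y => |tail L f y| :=
  Summable.of_nonneg_of_le (fun _ => abs_nonneg _) (abs_tail_le L f) hf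

lemma hatf_trunc_add_tail {f : (Fin d → ℤ) → ℝ} (hf : Summable fun y => |f y|) (L : ℝ) :
    hatf (trunc L f) + hatf (tail L f) = hatf f := by
  have h := (hasSum_hatf (summable_trunc hf L)).add (hasSum_hatf (summable_tail hf L))
  refine h.unique ((hasSum_hatf hf).congr_fun fun y => ?_)
  have e : (f y : ℂ) = (trunc L f y : ℂ) + (tail L f y : ℂ) := by
    rw [← Complex.ofReal_add, trunc_add_tail]
  rw [e]
  exact (add_smul (trunc L f y : ℂ) (tail L f y : ℂ) (UnitAddTorus.mFourier y : Tor d)).symm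

lemma summable_tilt_trunc {f : (Fin d → ℤ) → ℝ} (hf : Summable fun y => |f y|) (L : ℝ)
    (l : Fin d → ℝ) : Summable fun y => |tilt (trunc L f) l y| := by
  refine Summable.of_nonneg_of_le (fun _ => abs_nonneg _) (fun y => ?_)
    (hf.mul_left (Real.exp (enormR l * L)))
  unfold tilt trunc
  split_ifs with h
  · rw [abs_mul, abs_of_pos (Real.exp_pos _), mul_comm]
    have h1 : rdotZ l y ≤ enormR l * L :=
      (le_abs_self _).trans ((abs_rdotZ_le l y).trans
        (mul_le_mul_of_nonneg_left h (enormR_nonneg l)))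
    gcongr
  · rw [zero_mul, abs_zero]
    positivity

/-- The drift of a kernel. -/
def drift (Q : (Fin d → ℤ) → ℝ) : Fin d → ℝ := fun j => ∑' y, (y j : ℝ) * Q y

lemma abs_exp_sub_one_le (x : ℝ) : |Real.exp x - 1| ≤ |x| * Real.exp |x| := by
  have h := Complex.norm_exp_sub_sum_le_norm_mul_exp (x : ℂ) 1
  simp only [Finset.range_one, Finset.sum_singleton, pow_zero, Nat.factorial_zero, Nat.cast_one,
    div_one, pow_one] at h
  rwa [← Complex.ofReal_exp, ← Complex.ofReal_one, ← Complex.ofReal_sub, Complex.norm_real,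
    Complex.norm_real, Real.norm_eq_abs, Real.norm_eq_abs] at h

lemma abs_exp_sub_one_sub_le (x : ℝ) : |Real.exp x - 1 - x| ≤ x ^ 2 * Real.exp |x| := by
  have h := Complex.norm_exp_sub_sum_le_norm_mul_exp (x : ℂ) 2
  simp only [Finset.sum_range_succ, Finset.range_zero, Finset.sum_empty, zero_add, pow_zero,
    Nat.factorial_zero, Nat.cast_one, div_one, pow_one, Nat.factorial_one] at h
  rw [← sub_sub, ← Complex.ofReal_exp, ← Complex.ofReal_one, ← Complex.ofReal_sub,
    ← Complex.ofReal_sub, Complex.norm_real, Complex.norm_real, Real.norm_eq_abs,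
    Real.norm_eq_abs, sq_abs] at h
  exact h

namespace Ker

variable {M κ ζ : ℝ} {Q g : (Fin d → ℤ) → ℝ}

lemma summable_coord_mul (h : Ker M κ ζ Q g) (hζ : 0 < ζ) (j : Fin d) :
    Summable fun y => |(y j : ℝ) * Q y| := by
  refine Summable.of_nonneg_of_le (fun _ => abs_nonneg _) (fun y => ?_) h.Qm_sum
  rw [abs_mul]
  refine mul_le_mul_of_nonneg_right ?_ (abs_nonneg _)
  refine (abs_apply_le_enormR (toR y) j).trans ?_
  have := enormZ_rpow_le one_pos (by linarith : (1 : ℝ) ≤ 2 + ζ) y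
  rwa [Real.rpow_one] at this

lemma hasSum_rdotZ_mul (h : Ker M κ ζ Q g) (hζ : 0 < ζ) (l : Fin d → ℝ) :
    HasSum (fun y => rdotZ l y * Q y) (rdot l (drift Q)) := by
  have h1 : HasSum (fun y => ∑ j, l j * ((y j : ℝ) * Q y)) (∑ j, l j * drift Q j) :=
    hasSum_sum fun j _ => ((h.summable_coord_mul hζ j).of_abs.hasSum).mul_left (l j)
  refine h1.congr_fun fun y => ?_
  rw [rdotZ, Finset.sum_mul]
  exact Finset.sum_congr rfl fun j _ => by ring

lemma hatf_kap_re (hQ : Summable fun y => |Q y|) (θ : Fin d → ℝ) :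
    HasSum (fun y => Q y * Real.cos (2 * π * rdotZ θ y)) (hatf Q (kap θ)).re := by
  have h := Complex.hasSum_re (hasSum_hatf_apply hQ (kap θ))
  refine h.congr_fun fun y => ?_
  rw [mFourier_kap, show (2 * π * Complex.I * (rdotZ θ y : ℂ) : ℂ) =
    ((2 * π * rdotZ θ y : ℝ) : ℂ) * Complex.I by push_cast; ring, Complex.re_ofReal_mul,
    Complex.exp_ofReal_mul_I_re]

lemma re_hatf_le (h : Ker M κ ζ Q g) {θ : Fin d → ℝ} (hθ : θ ∈ cube d) :
    (hatf Q (kap θ)).re ≤ (∑' y, Q y) - κ * enormR θ ^ 2 := by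
  linarith [h.infrared θ hθ]

/-- The transform of the truncated tilted kernel. -/
lemma re_hatf_tilt_trunc_le (h : Ker M κ ζ Q g) (hζ : 0 < ζ) (hζ1 : ζ ≤ 1) {L : ℝ} (hL : 0 < L)
    (l : Fin d → ℝ) (θ : Fin d → ℝ) :
    (hatf (tilt (trunc L Q) l) (kap θ)).re ≤ (hatf Q (kap θ)).re + rdot l (drift Q) +
      ((1 + enormR l * L + (enormR l * L) ^ 2 * Real.exp (enormR l * L)) / L ^ 2 +
        2 * π ^ 2 * enormR θ ^ 2 * ((enormR l * L) * Real.exp (enormR l * L) * L ^ (-ζ))) * M := by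
  set ℓ := enormR l with hℓ
  have hℓ0 : 0 ≤ ℓ := enormR_nonneg l
  set E := (1 + ℓ * L + (ℓ * L) ^ 2 * Real.exp (ℓ * L)) / L ^ 2 +
    2 * π ^ 2 * enormR θ ^ 2 * ((ℓ * L) * Real.exp (ℓ * L) * L ^ (-ζ)) with hE
  have hE0 : 0 ≤ E := by positivity
  have key : ∀ y, tilt (trunc L Q) l y * Real.cos (2 * π * rdotZ θ y) ≤
      Q y * Real.cos (2 * π * rdotZ θ y) + rdotZ l y * Q y +
        E * (enormZ y ^ (2 + ζ) * |Q y|) := fun y => by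
    set r := enormZ y with hr
    have hr0 : 0 ≤ r := enormZ_nonneg y
    set s := rdotZ l y with hs
    have hs1 : |s| ≤ ℓ * r := abs_rdotZ_le l y
    set c := Real.cos (2 * π * rdotZ θ y) with hc
    have hc1 : c ≤ 1 := Real.cos_le_one _
    have hcm : -1 ≤ c := Real.neg_one_le_cos _
    have hr2 : r ^ 2 ≤ r ^ (2 + ζ) := by
      have := enormZ_rpow_le two_pos (by linarith : (2 : ℝ) ≤ 2 + ζ) y
      rwa [Real.rpow_two] at this
    by_cases hyL : r ≤ L
    · have hexp : Real.exp |s| ≤ Real.exp (ℓ * L) :=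
        Real.exp_le_exp.mpr (hs1.trans (mul_le_mul_of_nonneg_left hyL hℓ0))
      have hw : |Real.exp s * c - c - s| ≤ E * r ^ (2 + ζ) := by
        have e1 : |Real.exp s - 1 - s| ≤ (ℓ * r) ^ 2 * Real.exp (ℓ * L) := by
          refine (abs_exp_sub_one_sub_le s).trans ?_
          rw [← sq_abs]
          gcongr
        have e2 : |Real.exp s - 1| ≤ (ℓ * r) * Real.exp (ℓ * L) := by
          refine (abs_exp_sub_one_le s).trans ?_
          gcongr
        have e3 : 1 - c ≤ 2 * π ^ 2 * enormR θ ^ 2 * r ^ 2 := by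
          have h3 := Real.one_sub_sq_div_two_le_cos (x := 2 * π * rdotZ θ y)
          have h4 : (rdotZ θ y) ^ 2 ≤ (enormR θ * r) ^ 2 := by
            rw [← sq_abs]
            exact pow_le_pow_left₀ (abs_nonneg _) (abs_rdotZ_le θ y) 2
          have h5 : (2 * π * rdotZ θ y) ^ 2 / 2 = 2 * π ^ 2 * rdotZ θ y ^ 2 := by ring
          rw [h5] at h3
          have h6 := mul_le_mul_of_nonneg_left h4 (by positivity : 0 ≤ 2 * π ^ 2)
          nlinarith
        have e4 : r * r ^ 2 ≤ L * L ^ (-ζ) * r ^ (2 + ζ) := by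
          rcases hr0.eq_or_lt with h0 | h0
          · rw [← h0, zero_mul]
            positivity
          · have h1 : r ^ (1 - ζ) ≤ L ^ (1 - ζ) := Real.rpow_le_rpow hr0 hyL (by linarith)
            calc r * r ^ 2 = r ^ (1 - ζ) * r ^ (2 + ζ) := by
                  rw [← Real.rpow_add h0, show 1 - ζ + (2 + ζ) = (3 : ℕ) by norm_num,
                    Real.rpow_natCast]
                  ring
              _ ≤ L ^ (1 - ζ) * r ^ (2 + ζ) := by gcongr
              _ = _ := by
                  rw [sub_eq_add_neg, Real.rpow_add hL, Real.rpow_one]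
        calc |Real.exp s * c - c - s|
            = |(Real.exp s - 1 - s) - (Real.exp s - 1) * (1 - c)| := by congr 1; ring
          _ ≤ |Real.exp s - 1 - s| + |(Real.exp s - 1) * (1 - c)| := abs_sub _ _
          _ = |Real.exp s - 1 - s| + |Real.exp s - 1| * (1 - c) := by
              rw [abs_mul, abs_of_nonneg (by linarith : 0 ≤ 1 - c)]
          _ ≤ (ℓ * r) ^ 2 * Real.exp (ℓ * L) +
                (ℓ * r) * Real.exp (ℓ * L) * (2 * π ^ 2 * enormR θ ^ 2 * r ^ 2) := by
              have : 0 ≤ 1 - c := by linarith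
              gcongr
          _ = ℓ ^ 2 * Real.exp (ℓ * L) * r ^ 2 +
                2 * π ^ 2 * enormR θ ^ 2 * (ℓ * Real.exp (ℓ * L)) * (r * r ^ 2) := by ring
          _ ≤ ℓ ^ 2 * Real.exp (ℓ * L) * r ^ (2 + ζ) +
                2 * π ^ 2 * enormR θ ^ 2 * (ℓ * Real.exp (ℓ * L)) *
                  (L * L ^ (-ζ) * r ^ (2 + ζ)) := by gcongr
          _ = (ℓ ^ 2 * Real.exp (ℓ * L) + 2 * π ^ 2 * enormR θ ^ 2 *
                ((ℓ * L) * Real.exp (ℓ * L) * L ^ (-ζ))) * r ^ (2 + ζ) := by ring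
          _ ≤ E * r ^ (2 + ζ) := by
              refine mul_le_mul_of_nonneg_right ?_ (Real.rpow_nonneg hr0 _)
              rw [hE, mul_pow]
              refine add_le_add ?_ le_rfl
              rw [le_div_iff₀ (by positivity)]
              nlinarith [mul_nonneg hℓ0 hL.le]
      have ht : tilt (trunc L Q) l y = Q y * Real.exp s := by
        rw [tilt, trunc, if_pos hyL]
      rw [ht]
      have h1 := (abs_le.mp ((abs_mul (Q y) (Real.exp s * c - c - s)).le.trans
        (mul_le_mul_of_nonneg_left hw (abs_nonneg _)))).2
      linarith
    · have ht : tilt (trunc L Q) l y = 0 := by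
        rw [tilt, trunc, if_neg hyL, zero_mul]
      rw [ht, zero_mul]
      push Not at hyL
      have h1 : |c + s| ≤ E * r ^ (2 + ζ) := by
        have hrL : 1 ≤ r / L := (one_le_div hL).mpr hyL.le
        calc |c + s| ≤ |c| + |s| := abs_add_le _ _
          _ ≤ 1 + ℓ * r := add_le_add (abs_le.mpr ⟨hcm, hc1⟩) hs1
          _ = 1 + ℓ * L * (r / L) := by field_simp
          _ ≤ (r / L) ^ 2 + ℓ * L * (r / L) ^ 2 := by
              have : 0 ≤ ℓ * L := by positivity
              have h3 : r / L ≤ (r / L) ^ 2 := by nlinarith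
              have h4 : 1 ≤ (r / L) ^ 2 := by nlinarith
              nlinarith
          _ = (1 + ℓ * L) / L ^ 2 * r ^ 2 := by field_simp
          _ ≤ E * r ^ 2 := by
              refine mul_le_mul_of_nonneg_right ?_ (sq_nonneg _)
              rw [hE]
              refine le_add_of_le_of_nonneg ?_ (by positivity)
              exact div_le_div_of_nonneg_right (le_add_of_nonneg_right (by positivity))
                (by positivity)
          _ ≤ E * r ^ (2 + ζ) := by gcongr
      have h2 := (abs_le.mp ((abs_mul (Q y) (c + s)).le.trans
        (mul_le_mul_of_nonneg_left h1 (abs_nonneg _)))).1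
      linarith
  have hR := ((hatf_kap_re h.Q_sum θ).add (h.hasSum_rdotZ_mul hζ l)).add
    (h.Qm_sum.hasSum.mul_left E)
  refine (hasSum_le key (hatf_kap_re (summable_tilt_trunc h.Q_sum L l) θ) hR).trans ?_
  have := mul_le_mul_of_nonneg_left h.Qm_le hE0
  linarith

end Ker

end Truncation

/-! ### Upper bounds on the kernel semigroup -/

section UpperBound

open NormedSpace

/-- The Fourier coefficients of the semigroup generated by `Q`, with prefactor `g`. -/
def Ik (Q g : (Fin d → ℤ) → ℝ) (t : ℝ) (x : Fin d → ℤ) : ℂ :=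
  (Real.exp (-(t * ∑' y, Q y)) : ℂ) * co (hatf g * exp (t • hatf Q)) x

lemma co_smul (c : ℂ) (F : Tor d) (x : Fin d → ℤ) : co (c • F) x = c * co F x :=
  map_smul (coL x) c F

lemma co_add (F G : Tor d) (x : Fin d → ℤ) : co (F + G) x = co F x + co G x :=
  map_add (coL x) F G

lemma norm_co_tail_mul_le {f : (Fin d → ℤ) → ℝ} (hf : Summable fun y => |f y|) {a p N : ℝ}
    (ha : 0 < a) (hp : 1 ≤ p) (hp2 : p ≤ 2)
    (hs : Summable fun y => (enormZ y ^ (2 * a) * |f y|) ^ p)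
    (hN : ∑' y, (enormZ y ^ (2 * a) * |f y|) ^ p ≤ N) {F : Tor d} {κ t B L : ℝ}
    (hκ : 0 < κ) (ht : 0 ≤ t) (hB : 1 ≤ B) (hL : 0 < L)
    (hF : ∀ θ ∈ cube d, ‖F (kap θ)‖ ≤ B * Real.exp (-(t * κ * enormR θ ^ 2))) (x : Fin d → ℤ) :
    ‖co (hatf (tail L f) * F) x‖ ≤ (B ^ 2 * cGauss d κ * N + N + B ^ 2 * cGauss d κ) *
      (L ^ (-(2 * a)) * (max t 1) ^ (-(d / (2 * p)))) := by
  have hτ : 0 < max t 1 := lt_max_of_lt_right one_pos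
  have hp0 : 0 < p := by linarith
  have hVp : ((max t 1) ^ (-(d / (2 * p)))) ^ p = (max t 1) ^ (-((d : ℝ) / 2)) := by
    rw [← Real.rpow_mul hτ.le]
    congr 1
    field_simp
  have hcG : 0 < cGauss d κ := cGauss_pos κ
  have hle : ∀ y, |tail L f y| ^ p ≤
      (L ^ (-(2 * a))) ^ p * (enormZ y ^ (2 * a) * |f y|) ^ p := fun y => by
    have h0 : 0 ≤ enormZ y ^ (2 * a) * |f y| :=
      mul_nonneg (Real.rpow_nonneg (enormZ_nonneg y) _) (abs_nonneg _)
    rw [← Real.mul_rpow (by positivity) h0]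
    refine Real.rpow_le_rpow (abs_nonneg _) ?_ hp0.le
    unfold tail
    split_ifs with h
    · rw [abs_zero]; positivity
    · push Not at h
      have h1 : L ^ (2 * a) ≤ enormZ y ^ (2 * a) := Real.rpow_le_rpow hL.le h.le (by positivity)
      rw [Real.rpow_neg hL.le, ← mul_assoc]
      refine le_mul_of_one_le_left (abs_nonneg _) ?_
      rw [inv_mul_eq_div, one_le_div (by positivity)]
      exact h1
  have hqs : Summable fun y => |tail L f y| ^ p :=
    Summable.of_nonneg_of_le (fun y => by positivity) hle (hs.mul_left _)
  have hqN : ∑' y, |tail L f y| ^ p ≤ N * (L ^ (-(2 * a))) ^ p := by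
    refine (hqs.tsum_le_tsum hle (hs.mul_left _)).trans ?_
    rw [tsum_mul_left, mul_comm]
    gcongr
  have hsub : Function.Injective fun y : Fin d → ℤ => x - y := sub_right_injective
  have hes : Summable fun y => ‖co F (x - y)‖ ^ 2 := (co_sq F).1.comp_injective hsub
  obtain ⟨h1, h2⟩ := norm_tsum_mul_le (q := fun y => |tail L f y|) (e := fun y => ‖co F (x - y)‖)
    (A := L ^ (-(2 * a))) (V := (max t 1) ^ (-(d / (2 * p)))) (N := N)
    (C := B ^ 2 * cGauss d κ) hp hp2 (by positivity)
    (by positivity) (by positivity) (fun _ => abs_nonneg _) (fun _ => norm_nonneg _) hqs hqN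
    (fun y => by
      rw [hVp]
      refine (norm_co_le_gauss hκ ht (by linarith) hF _).trans ?_
      gcongr
      nlinarith)
    hes (by
      rw [hVp]
      refine le_trans ?_ (tsum_co_sq_le_gauss hκ ht hF)
      exact tsum_comp_le_tsum_of_inj (co_sq F).1 (fun _ => by positivity) hsub)
  refine le_trans ?_ h2
  rw [← (hasSum_co_hatf_mul (summable_tail hf L) F x).tsum_eq]
  refine tsum_of_norm_bounded h1.hasSum fun y => ?_
  rw [norm_mul, Complex.norm_real, Real.norm_eq_abs]

namespace Ker

variable {M κ ζ : ℝ} {Q g : (Fin d → ℤ) → ℝ}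

lemma norm_exp_hatf_le (h : Ker M κ ζ Q g) {t : ℝ} (ht : 0 ≤ t) {θ : Fin d → ℝ}
    (hθ : θ ∈ cube d) : ‖((Real.exp (-(t * ∑' y, Q y)) : ℂ) • exp (t • hatf Q)) (kap θ)‖ ≤
      1 * Real.exp (-(t * κ * enormR θ ^ 2)) := by
  rw [ContinuousMap.smul_apply, tor_exp_apply, norm_smul, Complex.norm_exp, Complex.norm_real,
    Real.norm_of_nonneg (Real.exp_pos _).le, ← Real.exp_add, one_mul, Real.exp_le_exp]
  have h1 := mul_le_mul_of_nonneg_left (h.re_hatf_le hθ) ht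
  have h2 : ((t • hatf Q) (kap θ)).re = t * (hatf Q (kap θ)).re := by
    rw [ContinuousMap.smul_apply, Complex.smul_re, smul_eq_mul]
  rw [h2]
  linarith

lemma Ik_eq (t : ℝ) (x : Fin d → ℤ) :
    Ik Q g t x = co (hatf g * ((Real.exp (-(t * ∑' y, Q y)) : ℂ) • exp (t • hatf Q))) x := by
  rw [mul_smul_comm, co_smul]
  rfl

lemma norm_Ik_le (h : Ker M κ ζ Q g) (hκ : 0 < κ) {t : ℝ} (ht : 0 ≤ t) (x : Fin d → ℤ) :
    ‖Ik Q g t x‖ ≤ M * cGauss d κ * (max t 1) ^ (-((d : ℝ) / 2)) := by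
  rw [Ik_eq]
  refine (norm_co_hatf_mul_le h.g_sum (fun y => norm_co_le_gauss hκ ht zero_le_one
    (fun θ hθ => h.norm_exp_hatf_le ht hθ) y) x).trans ?_
  rw [one_mul, mul_assoc]
  have := cGauss_pos (d := d) κ
  gcongr
  exact h.g_le

lemma norm_co_exp_trunc_le (h : Ker M κ ζ Q g) (hκ : 0 < κ) (hζ : 0 < ζ) (hζ1 : ζ ≤ 1) {L : ℝ}
    (hL : 0 < L) {l : Fin d → ℝ} {s : ℝ} (hs : enormR l * L = s)
    (hsmall : 2 * π ^ 2 * (s * Real.exp s * L ^ (-ζ)) * M ≤ κ / 2) {t : ℝ} (ht : 0 ≤ t)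
    (z : Fin d → ℤ) :
    ‖co ((Real.exp (-(t * ∑' y, Q y)) : ℂ) • exp (t • hatf (trunc L Q))) z‖ ≤
      Real.exp (-rdotZ l z + t * rdot l (drift Q) +
        t * ((1 + s + s ^ 2 * Real.exp s) / L ^ 2 * M)) * cGauss d (κ / 2) *
        (max t 1) ^ (-((d : ℝ) / 2)) := by
  have e1 : co (exp (t • hatf (trunc L Q))) z =
      (Real.exp (-rdotZ l z) : ℂ) * co (exp (t • hatf (tilt (trunc L Q) l))) z := by
    have hf : Summable fun y => |t * trunc L Q y| := by
      simpa only [abs_mul] using (summable_trunc h.Q_sum L).mul_left |t|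
    have ht2 : tilt (fun y => t * trunc L Q y) l = fun y => t * tilt (trunc L Q) l y := by
      funext y
      simp only [tilt, mul_assoc]
    have hf2 : Summable fun y => |tilt (fun y => t * trunc L Q y) l y| := by
      rw [ht2]
      simpa only [abs_mul] using (summable_tilt_trunc h.Q_sum L l).mul_left |t|
    have := co_exp_tilt hf hf2 z
    rw [ht2, hatf_smul, hatf_smul] at this
    rw [this, ← mul_assoc, ← Complex.ofReal_mul, ← Real.exp_add, neg_add_cancel, Real.exp_zero,
      Complex.ofReal_one, one_mul]
  set B := Real.exp (t * (∑' y, Q y) + t * rdot l (drift Q) +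
    t * ((1 + s + s ^ 2 * Real.exp s) / L ^ 2 * M)) with hB
  have hF : ∀ θ ∈ cube d, ‖(exp (t • hatf (tilt (trunc L Q) l))) (kap θ)‖ ≤
      B * Real.exp (-(t * (κ / 2) * enormR θ ^ 2)) := fun θ hθ => by
    rw [tor_exp_apply, Complex.norm_exp, hB, ← Real.exp_add, Real.exp_le_exp,
      ContinuousMap.smul_apply, Complex.smul_re, smul_eq_mul]
    have h1 := h.re_hatf_tilt_trunc_le hζ hζ1 hL l θ
    rw [hs] at h1
    have h2 := h.re_hatf_le hθ
    have h3 := mul_le_mul_of_nonneg_right hsmall (sq_nonneg (enormR θ))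
    have h4 : (hatf (tilt (trunc L Q) l) (kap θ)).re ≤ (∑' y, Q y) + rdot l (drift Q) +
        (1 + s + s ^ 2 * Real.exp s) / L ^ 2 * M - (κ / 2) * enormR θ ^ 2 := by
      linarith
    have := mul_le_mul_of_nonneg_left h4 ht
    linarith
  rw [co_smul, e1, norm_mul, norm_mul, Complex.norm_real, Complex.norm_real,
    Real.norm_of_nonneg (Real.exp_pos _).le, Real.norm_of_nonneg (Real.exp_pos _).le]
  calc Real.exp (-(t * ∑' y, Q y)) * (Real.exp (-rdotZ l z) *
        ‖co (exp (t • hatf (tilt (trunc L Q) l))) z‖)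
      ≤ Real.exp (-(t * ∑' y, Q y)) * (Real.exp (-rdotZ l z) *
        (B * cGauss d (κ / 2) * (max t 1) ^ (-((d : ℝ) / 2)))) := by
        gcongr
        exact norm_co_le_gauss (by positivity) ht (Real.exp_pos _).le hF z
    _ = (Real.exp (-(t * ∑' y, Q y)) * Real.exp (-rdotZ l z) * B) *
        cGauss d (κ / 2) * (max t 1) ^ (-((d : ℝ) / 2)) := by ring
    _ = _ := by
        rw [hB, ← Real.exp_add, ← Real.exp_add]
        congr 3
        ring

lemma tail_norm_le (h : Ker M κ ζ Q g) (hζ : 0 < ζ) {L : ℝ} (hL : 0 < L) :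
    ∑' y, |tail L Q y| ≤ M / L ^ 2 := by
  have h1 : ∀ y, |tail L Q y| ≤ (L ^ 2)⁻¹ * (enormZ y ^ (2 + ζ) * |Q y|) := fun y => by
    unfold tail
    split_ifs with hy
    · rw [abs_zero]
      have := Real.rpow_nonneg (enormZ_nonneg y) (2 + ζ)
      positivity
    · push Not at hy
      have h2 := enormZ_rpow_le two_pos (by linarith : (2 : ℝ) ≤ 2 + ζ) y
      rw [Real.rpow_two] at h2
      rw [← mul_assoc]
      refine le_mul_of_one_le_left (abs_nonneg _) ?_
      rw [inv_mul_eq_div, one_le_div (by positivity)]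
      exact (pow_le_pow_left₀ hL.le hy.le 2).trans h2
  refine ((summable_tail h.Q_sum L).tsum_le_tsum h1 (h.Qm_sum.mul_left _)).trans ?_
  rw [tsum_mul_left, div_eq_inv_mul]
  have := h.Qm_le
  gcongr

end Ker

lemma continuous_dslope_cexp : Continuous (dslope Complex.exp 0) := by
  rw [← continuousOn_univ, continuousOn_dslope Filter.univ_mem]
  exact ⟨Complex.continuous_exp.continuousOn, Complex.differentiable_exp.differentiableAt⟩

lemma mul_dslope_cexp (z : ℂ) : z * dslope Complex.exp 0 z = Complex.exp z - 1 := by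
  have := sub_smul_dslope Complex.exp 0 z
  simpa using this

lemma norm_dslope_cexp_le (z : ℂ) : ‖dslope Complex.exp 0 z‖ ≤ Real.exp ‖z‖ := by
  rcases eq_or_ne z 0 with rfl | hz
  · simp [dslope_same]
  · have h := Complex.norm_exp_sub_sum_le_norm_mul_exp z 1
    simp only [Finset.range_one, Finset.sum_singleton, pow_zero, Nat.factorial_zero, Nat.cast_one,
      div_one, pow_one] at h
    rw [← mul_dslope_cexp, norm_mul] at h
    exact le_of_mul_le_mul_left h (norm_pos_iff.mpr hz)

/-- The difference quotient of the exponential along `W`. -/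
def expQuot (W : Tor d) : Tor d := ⟨fun z => dslope Complex.exp 0 (W z),
  continuous_dslope_cexp.comp W.continuous⟩

lemma exp_add_eq (U W : Tor d) : exp (U + W) = exp U + W * (expQuot W * exp U) := by
  ext z
  simp only [ContinuousMap.add_apply, ContinuousMap.mul_apply, tor_exp_apply, expQuot,
    ContinuousMap.coe_mk]
  rw [← mul_assoc, mul_dslope_cexp, Complex.exp_add]
  ring

end UpperBound

section UpperDecay

open NormedSpace

lemma aExp_pQ_le : 1 - (d : ℝ) / (2 * pQ d) ≤ aExp d - (d : ℝ) / 2 := by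
  unfold pQ aExp
  split_ifs with h
  · norm_num
  · have h4 : (4 : ℝ) ≤ d := by exact_mod_cast (by omega : 4 ≤ d)
    have hp : 0 < min ((d : ℝ) / 3) 2 := lt_min (by linarith) two_pos
    have h1 : 3 / 2 ≤ (d : ℝ) / (2 * min ((d : ℝ) / 3) 2) := by
      rw [le_div_iff₀ (by positivity)]
      nlinarith [min_le_left ((d : ℝ) / 3) 2]
    linarith

lemma aExp_quarter_le : -((d : ℝ) / (2 * 2)) ≤ aExp d - (d : ℝ) / 2 := by
  unfold aExp
  split_ifs with h
  · have h4 : (d : ℝ) ≤ 3 := by exact_mod_cast h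
    linarith
  · have h4 : (4 : ℝ) ≤ d := by exact_mod_cast (by omega : 4 ≤ d)
    linarith

lemma exists_small_rpow {ζ : ℝ} (hζ : 0 < ζ) (B : ℝ) {ε : ℝ} (hε : 0 < ε) :
    ∃ A : ℝ, 1 ≤ A ∧ ∀ u, A ≤ u → B * u ^ (-ζ) ≤ ε := by
  have h : Tendsto (fun u : ℝ => B * u ^ (-ζ)) atTop (𝓝 (B * 0)) :=
    (tendsto_rpow_neg_atTop hζ).const_mul B
  rw [mul_zero] at h
  obtain ⟨A, hA⟩ := eventually_atTop.mp (h.eventually_le_const hε)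
  exact ⟨max A 1, le_max_right _ _, fun u hu => hA u ((le_max_left _ _).trans hu)⟩

lemma poly_exp_le {s : ℝ} (hs : 0 ≤ s) : 1 + s + s ^ 2 * Real.exp s ≤ 4 * Real.exp (4 * s) := by
  have h1 := Real.add_one_le_exp s
  have h2 := Real.quadratic_le_exp_of_nonneg hs
  have h3 : 1 ≤ Real.exp s := Real.one_le_exp hs
  have h4 : Real.exp (4 * s) = Real.exp s ^ 4 := by
    rw [← Real.exp_nat_mul]; norm_num
  rw [h4]
  have h5 : s ^ 2 ≤ 2 * Real.exp s := by linarith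
  have h6 : s ^ 2 * Real.exp s ≤ 2 * Real.exp s ^ 2 := by nlinarith
  have h7 : Real.exp s ≤ Real.exp s ^ 4 := le_self_pow₀ h3 (by norm_num)
  have h8 : Real.exp s ^ 2 ≤ Real.exp s ^ 4 := pow_le_pow_right₀ h3 (by norm_num)
  linarith

lemma norm_co_trunc_mul_le {f : (Fin d → ℤ) → ℝ} (hf : Summable fun x => |f x|) {F : Tor d}
    {B L : ℝ} {x : Fin d → ℤ} (hF : ∀ y, enormZ y ≤ L → ‖co F (x - y)‖ ≤ B) (hB : 0 ≤ B) :
    ‖co (hatf (trunc L f) * F) x‖ ≤ (∑' y, |f y|) * B := by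
  have h1 : ∀ y, ‖(trunc L f y : ℂ) * co F (x - y)‖ ≤ |f y| * B := fun y => by
    rw [norm_mul, Complex.norm_real, Real.norm_eq_abs]
    by_cases hy : enormZ y ≤ L
    · exact mul_le_mul (abs_trunc_le L f y) (hF y hy) (norm_nonneg _) (abs_nonneg _)
    · rw [trunc, if_neg hy, abs_zero, zero_mul]
      positivity
  rw [← (hasSum_co_hatf_mul (summable_trunc hf L) F x).tsum_eq, ← tsum_mul_right]
  exact tsum_of_norm_bounded (hf.mul_right B).hasSum h1

/-- Spatial decay of the kernel semigroup around its drift. -/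
theorem exists_norm_Ik_le_decay (d : ℕ) {M κ ζ : ℝ} (hM : 0 < M) (hκ : 0 < κ) (hζ : 0 < ζ)
    (hζ1 : ζ ≤ 1) : ∃ C A : ℝ, 0 < C ∧ 1 ≤ A ∧ ∀ Q g : (Fin d → ℤ) → ℝ, Ker M κ ζ Q g →
      ∀ t, 0 ≤ t → ∀ x : Fin d → ℤ, ∀ ρ, ρ = enormR (toR x - t • drift Q) →
        A * max t 1 ≤ ρ ^ 2 →
        ‖Ik Q g t x‖ ≤ C * (max t 1) ^ (-((d : ℝ) / 2)) * (max t 1 / ρ ^ 2) ^ aExp d := by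
  set a := aExp d with ha
  have ha1 : 1 ≤ a := one_le_aExp
  set c := ζ / 16 with hc
  have hc0 : 0 < c := by positivity
  set δ := c / (2 * a) with hδ
  have hδ0 : 0 < δ := by positivity
  have hδ1 : δ ≤ 1 / 2 := by
    rw [hδ, div_le_iff₀ (by positivity)]
    linarith
  obtain ⟨A, hA1, hA⟩ := exists_small_rpow (ζ := ζ / 4) (by positivity)
    (2 * π ^ 2 * δ ^ (-ζ) * M) (half_pos hκ)
  set B := Real.exp (2 * (M / δ ^ 2)) with hB
  have hB1 : 1 ≤ B := Real.one_le_exp (by positivity)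
  set G := cGauss d κ with hG
  have hG0 : 0 < G := cGauss_pos κ
  have hG20 : 0 < cGauss d (κ / 2) := cGauss_pos _
  set C1 := M * (Real.exp (4 * M / δ ^ 2) * cGauss d (κ / 2)) with hC1
  set C2 := M * (B ^ 2 * G * M + M + B ^ 2 * G) * δ ^ (-(2 * a)) with hC2
  set C3 := (1 ^ 2 * G * M + M + 1 ^ 2 * G) * δ ^ (-(2 * a)) with hC3
  refine ⟨C1 + C2 + C3, A, by positivity, hA1, ?_⟩
  intro Q g h t ht x ρ hρ hAρ
  set τ := max t 1 with hτ
  have hτ1 : 1 ≤ τ := le_max_right _ _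
  have hτ0 : 0 < τ := by linarith
  have htτ : t ≤ τ := le_max_left _ _
  have hρ0 : 0 < ρ := by
    have h1 : 0 ≤ ρ := hρ ▸ enormR_nonneg _
    have h2 : 0 < ρ ^ 2 := lt_of_lt_of_le (by positivity) hAρ
    exact lt_of_le_of_ne h1 fun h3 => by rw [← h3] at h2; norm_num at h2
  set u := ρ ^ 2 / τ with hu
  have huA : A ≤ u := (le_div_iff₀ hτ0).mpr hAρ
  have hu1 : 1 ≤ u := hA1.trans huA
  have hu0 : 0 < u := by linarith
  have hdec : (τ / ρ ^ 2) ^ a = u ^ (-a) := by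
    rw [hu, Real.rpow_neg (by positivity), ← Real.inv_rpow (by positivity), inv_div]
  rw [hdec]
  set L := δ * ρ with hL
  have hL0 : 0 < L := by positivity
  set s := c * Real.log u with hs
  have hs0 : 0 ≤ s := mul_nonneg hc0.le (Real.log_nonneg hu1)
  have hexps : Real.exp s = u ^ c := by
    rw [Real.rpow_def_of_pos hu0, hs, mul_comm]
  set X := toR x - t • drift Q with hX
  set l : Fin d → ℝ := (s / L / ρ) • X with hl
  have hlL : enormR l * L = s := by
    rw [hl, enormR_smul, ← hρ, abs_of_nonneg (by positivity)]
    field_simp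
  have hlX : rdot l X = s / δ := by
    rw [hl, rdot_smul_left, rdot_self, ← hρ, hL]
    field_simp
  have hL2 : t / L ^ 2 ≤ 1 / (δ ^ 2 * u) := by
    rw [hL, hu, div_le_div_iff₀ (by positivity) (by positivity)]
    have : δ ^ 2 * (ρ ^ 2 / τ) = (δ * ρ) ^ 2 / τ := by ring
    rw [this, mul_div_assoc', div_le_iff₀ hτ0]
    nlinarith [mul_nonneg (sub_nonneg.mpr htτ) (sq_nonneg (δ * ρ))]
  have hsmall : 2 * π ^ 2 * (s * Real.exp s * L ^ (-ζ)) * M ≤ κ / 2 := by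
    refine le_trans ?_ (hA u huA)
    have h1 : s * Real.exp s ≤ u ^ (ζ / 8) := by
      have h2 : s ≤ Real.exp s := by linarith [Real.add_one_le_exp s]
      calc s * Real.exp s ≤ Real.exp s * Real.exp s := by gcongr
        _ = u ^ (ζ / 8) := by
          rw [hexps, ← Real.rpow_add hu0]; congr 1; rw [hc]; ring
    have h2 : L ^ (-ζ) ≤ δ ^ (-ζ) * u ^ (-(ζ / 2)) := by
      rw [hL, Real.mul_rpow hδ0.le hρ0.le]
      refine mul_le_mul_of_nonneg_left ?_ (by positivity)
      have h3 : ρ ^ (-ζ) = (ρ ^ 2) ^ (-(ζ / 2)) := by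
        rw [← Real.rpow_natCast, ← Real.rpow_mul hρ0.le]; congr 1; push_cast; ring
      rw [h3]
      refine Real.rpow_le_rpow_of_nonpos hu0 ?_ (by linarith)
      rw [hu]
      exact div_le_self (sq_nonneg _) hτ1
    calc 2 * π ^ 2 * (s * Real.exp s * L ^ (-ζ)) * M
        ≤ 2 * π ^ 2 * (u ^ (ζ / 8) * (δ ^ (-ζ) * u ^ (-(ζ / 2)))) * M := by gcongr
      _ = 2 * π ^ 2 * δ ^ (-ζ) * M * (u ^ (ζ / 8) * u ^ (-(ζ / 2))) := by ring
      _ ≤ 2 * π ^ 2 * δ ^ (-ζ) * M * u ^ (-(ζ / 4)) := by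
          rw [← Real.rpow_add hu0]
          refine mul_le_mul_of_nonneg_left ?_ (by positivity)
          exact Real.rpow_le_rpow_of_exponent_le hu1 (by linarith)
  have hpoly : t * ((1 + s + s ^ 2 * Real.exp s) / L ^ 2 * M) ≤ 4 * M / δ ^ 2 := by
    have h1 : 1 + s + s ^ 2 * Real.exp s ≤ 4 * u := by
      refine (poly_exp_le hs0).trans ?_
      have : Real.exp (4 * s) ≤ u := by
        have h4 : 4 * c ≤ 1 := by rw [hc]; linarith
        calc Real.exp (4 * s) = u ^ (4 * c) := by
              rw [Real.rpow_def_of_pos hu0, hs]; congr 1; ring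
          _ ≤ u ^ (1 : ℝ) := Real.rpow_le_rpow_of_exponent_le hu1 h4
          _ = u := Real.rpow_one u
      linarith
    calc t * ((1 + s + s ^ 2 * Real.exp s) / L ^ 2 * M)
        = (1 + s + s ^ 2 * Real.exp s) * M * (t / L ^ 2) := by ring
      _ ≤ (4 * u) * M * (1 / (δ ^ 2 * u)) := by gcongr
      _ = 4 * M / δ ^ 2 := by field_simp
  set e0 : ℂ := (Real.exp (-(t * ∑' y, Q y)) : ℂ) with he0
  have hT1 : ‖co (hatf (trunc L g) * (e0 • exp (t • hatf (trunc L Q)))) x‖ ≤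
      C1 * τ ^ (-((d : ℝ) / 2)) * u ^ (-a) := by
    refine (norm_co_trunc_mul_le h.g_sum (B := Real.exp (4 * M / δ ^ 2) * cGauss d (κ / 2) *
      τ ^ (-((d : ℝ) / 2)) * u ^ (-a)) (fun y hy => ?_) (by positivity)).trans ?_
    · refine (h.norm_co_exp_trunc_le hκ hζ hζ1 hL0 hlL hsmall ht (x - y)).trans ?_
      have h1 : -rdotZ l (x - y) + t * rdot l (drift Q) ≤ Real.log u * (-a) := by
        have h2 : rdotZ l (x - y) = rdotZ l x - rdotZ l y := rdotZ_sub l x y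
        have h3 : rdot l X = rdotZ l x - t * rdot l (drift Q) := by
          rw [rdot_comm, hX, rdot_sub_left, rdot_smul_left, rdot_comm, rdot_comm (drift Q)]
          rfl
        have h4 : rdotZ l y ≤ s := by
          rw [← hlL]
          exact (le_abs_self _).trans ((abs_rdotZ_le l y).trans
            (mul_le_mul_of_nonneg_left hy (enormR_nonneg l)))
        have h5 : s / δ = 2 * a * Real.log u := by
          rw [hs, hδ]; field_simp
        have h6 : s ≤ a * Real.log u := by
          rw [hs]
          refine mul_le_mul_of_nonneg_right ?_ (Real.log_nonneg hu1)
          rw [hc]; linarith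
        rw [hlX] at h3
        linarith
      calc Real.exp (-rdotZ l (x - y) + t * rdot l (drift Q) +
            t * ((1 + s + s ^ 2 * Real.exp s) / L ^ 2 * M)) * cGauss d (κ / 2) *
            τ ^ (-((d : ℝ) / 2))
          ≤ Real.exp (Real.log u * (-a) + 4 * M / δ ^ 2) * cGauss d (κ / 2) *
            τ ^ (-((d : ℝ) / 2)) := by gcongr
        _ = _ := by
            rw [Real.exp_add, ← Real.rpow_def_of_pos hu0]
            ring
    · rw [hC1]
      calc (∑' y, |g y|) * (Real.exp (4 * M / δ ^ 2) * cGauss d (κ / 2) *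
            τ ^ (-((d : ℝ) / 2)) * u ^ (-a)) ≤ M * (Real.exp (4 * M / δ ^ 2) * cGauss d (κ / 2) *
            τ ^ (-((d : ℝ) / 2)) * u ^ (-a)) := by
            gcongr
            exact h.g_le
        _ = _ := by ring
  have hpow : ∀ q : ℝ, q ≤ a - (d : ℝ) / 2 → L ^ (-(2 * a)) * τ ^ q ≤
      δ ^ (-(2 * a)) * (τ ^ (-((d : ℝ) / 2)) * u ^ (-a)) := fun q hq => by
    have h1 : u ^ (-a) = ρ ^ (-(2 * a)) * τ ^ a := by
      rw [hu, Real.div_rpow (by positivity) hτ0.le, Real.rpow_neg hτ0.le a, div_inv_eq_mul,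
        ← Real.rpow_natCast, ← Real.rpow_mul hρ0.le]
      congr 2
      push_cast
      ring
    have h2 : τ ^ q ≤ τ ^ (a - (d : ℝ) / 2) := Real.rpow_le_rpow_of_exponent_le hτ1 hq
    rw [h1, hL, Real.mul_rpow hδ0.le hρ0.le]
    calc δ ^ (-(2 * a)) * ρ ^ (-(2 * a)) * τ ^ q
        ≤ δ ^ (-(2 * a)) * ρ ^ (-(2 * a)) * τ ^ (a - (d : ℝ) / 2) := by gcongr
      _ = _ := by
          rw [sub_eq_add_neg, Real.rpow_add hτ0]
          ring
  set W := t • hatf (tail L Q) with hW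
  have hWn : ‖W‖ ≤ M / δ ^ 2 := by
    rw [hW, norm_smul, Real.norm_of_nonneg ht]
    calc t * ‖hatf (tail L Q)‖ ≤ t * (M / L ^ 2) := by
          gcongr
          exact (norm_hatf_le (summable_tail h.Q_sum L)).trans (h.tail_norm_le hζ hL0)
      _ = M * (t / L ^ 2) := by ring
      _ ≤ M * (1 / (δ ^ 2 * u)) := by gcongr
      _ ≤ M * (1 / (δ ^ 2 * 1)) := by gcongr
      _ = _ := by ring
  have hsum : t • hatf Q = t • hatf (trunc L Q) + W := by
    rw [hW, ← hatf_trunc_add_tail h.Q_sum L]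
    ext z
    simp
  have hT2 : ‖co (hatf (trunc L g) * (hatf (tail L Q) *
      (e0 • (expQuot W * exp (t • hatf (trunc L Q)))))) x‖ * t ≤
      C2 * τ ^ (-((d : ℝ) / 2)) * u ^ (-a) := by
    have hF : ∀ θ ∈ cube d, ‖(e0 • (expQuot W * exp (t • hatf (trunc L Q)))) (kap θ)‖ ≤
        B * Real.exp (-(t * κ * enormR θ ^ 2)) := fun θ hθ => by
      have h1 := h.norm_exp_hatf_le ht hθ
      rw [ContinuousMap.smul_apply, norm_smul, one_mul] at h1
      have h2 : ‖W (kap θ)‖ ≤ M / δ ^ 2 := (W.norm_coe_le_norm _).trans hWn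
      have h3 : t • hatf Q = t • hatf (trunc L Q) + W := by
        exact hsum
      have h4 : ‖exp (t • hatf (trunc L Q)) (kap θ)‖ ≤
          ‖exp (t • hatf Q) (kap θ)‖ * Real.exp (M / δ ^ 2) := by
        rw [tor_exp_apply, tor_exp_apply, h3, Complex.norm_exp, Complex.norm_exp,
          ← Real.exp_add, Real.exp_le_exp, ContinuousMap.add_apply, Complex.add_re]
        have := (abs_le.mp ((Complex.abs_re_le_norm (W (kap θ))).trans h2)).1
        linarith
      have h5 : ‖expQuot W (kap θ)‖ ≤ Real.exp (M / δ ^ 2) :=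
        (norm_dslope_cexp_le _).trans (Real.exp_le_exp.mpr h2)
      rw [ContinuousMap.smul_apply, norm_smul, ContinuousMap.mul_apply, norm_mul]
      calc ‖e0‖ * (‖expQuot W (kap θ)‖ * ‖exp (t • hatf (trunc L Q)) (kap θ)‖)
          ≤ ‖e0‖ * (Real.exp (M / δ ^ 2) *
              (‖exp (t • hatf Q) (kap θ)‖ * Real.exp (M / δ ^ 2))) := by gcongr
        _ = (Real.exp (M / δ ^ 2) * Real.exp (M / δ ^ 2)) *
              (‖e0‖ * ‖exp (t • hatf Q) (kap θ)‖) := by ring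
        _ ≤ (Real.exp (M / δ ^ 2) * Real.exp (M / δ ^ 2)) *
              Real.exp (-(t * κ * enormR θ ^ 2)) := by gcongr
        _ = _ := by rw [hB, ← Real.exp_add, two_mul]
    have hG1 := norm_co_tail_mul_le h.Q_sum (by linarith) one_le_pQ pQ_le_two h.Qp_sum h.Qp_le hκ ht
      hB1 hL0 hF
    have h2 := norm_co_trunc_mul_le h.g_sum (L := L) (x := x) (fun y _ => hG1 (x - y))
      (by positivity)
    calc _ ≤ (∑' y, |g y|) * ((B ^ 2 * G * M + M + B ^ 2 * G) *
          (L ^ (-(2 * a)) * τ ^ (-(d / (2 * pQ d))))) * τ := by gcongr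
      _ ≤ M * ((B ^ 2 * G * M + M + B ^ 2 * G) *
          (L ^ (-(2 * a)) * τ ^ (-(d / (2 * pQ d))))) * τ := by
          gcongr
          exact h.g_le
      _ = M * (B ^ 2 * G * M + M + B ^ 2 * G) *
          (L ^ (-(2 * a)) * τ ^ (1 - (d : ℝ) / (2 * pQ d))) := by
          rw [sub_eq_neg_add, Real.rpow_add hτ0, Real.rpow_one]
          ring
      _ ≤ M * (B ^ 2 * G * M + M + B ^ 2 * G) *
          (δ ^ (-(2 * a)) * (τ ^ (-((d : ℝ) / 2)) * u ^ (-a))) := by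
          exact mul_le_mul_of_nonneg_left (hpow _ aExp_pQ_le) (by positivity)
      _ = _ := by rw [hC2]; ring
  have hT3 : ‖co (hatf (tail L g) * (e0 • exp (t • hatf Q))) x‖ ≤
      C3 * τ ^ (-((d : ℝ) / 2)) * u ^ (-a) := by
    refine (norm_co_tail_mul_le h.g_sum (by linarith) one_le_two le_rfl h.g2_sum h.g2_le hκ ht
      le_rfl hL0 (fun θ hθ => h.norm_exp_hatf_le ht hθ) x).trans ?_
    calc _ ≤ (1 ^ 2 * G * M + M + 1 ^ 2 * G) *
          (δ ^ (-(2 * a)) * (τ ^ (-((d : ℝ) / 2)) * u ^ (-a))) := by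
          exact mul_le_mul_of_nonneg_left (hpow _ aExp_quarter_le) (by positivity)
      _ = _ := by rw [hC3]; ring
  have hsplit : Ik Q g t x = co (hatf (trunc L g) * (e0 • exp (t • hatf (trunc L Q)))) x +
      co (hatf (trunc L g) * (hatf (tail L Q) *
        (e0 • (expQuot W * exp (t • hatf (trunc L Q)))))) x * t +
      co (hatf (tail L g) * (e0 • exp (t • hatf Q))) x := by
    have h1 : exp (t • hatf Q) = exp (t • hatf (trunc L Q)) +
        W * (expQuot W * exp (t • hatf (trunc L Q))) := by
      rw [← exp_add_eq, ← hsum]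
    have h2 : W = (t : ℂ) • hatf (tail L Q) := by
      rw [hW]
      ext z
      simp
    rw [Ker.Ik_eq, mul_comm _ (t : ℂ), ← co_smul, ← co_add, ← co_add,
      ← hatf_trunc_add_tail h.g_sum L]
    congr 1
    rw [add_mul]
    congr 1
    rw [h1]
    nth_rw 1 [h2]
    generalize exp (t • hatf (trunc L Q)) = E
    generalize expQuot W = P
    ext z
    simp only [ContinuousMap.add_apply, ContinuousMap.mul_apply, ContinuousMap.smul_apply,
      smul_eq_mul]
    ring
  rw [hsplit]
  refine (norm_add₃_le).trans ?_
  rw [norm_mul, Complex.norm_real, Real.norm_of_nonneg ht]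
  linarith

end UpperDecay

lemma rdot_eq_dotProduct (u v : Fin d → ℝ) : rdot u v = u ⬝ᵥ v := rfl

lemma enormR_sq_eq_dotProduct (u : Fin d → ℝ) : enormR u ^ 2 = u ⬝ᵥ u := by
  rw [enormR_sq, dotProduct]
  exact Finset.sum_congr rfl fun i _ => by ring

lemma continuous_enormR : Continuous (enormR : (Fin d → ℝ) → ℝ) := by
  unfold enormR
  fun_prop

lemma continuous_rdot (X : Fin d → ℝ) : Continuous fun θ : Fin d → ℝ => rdot θ X := by
  unfold rdot
  fun_prop

lemma gauss_fourier_standard {t : ℝ} (ht : 0 < t) (Y : Fin d → ℝ) :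
    ∫ φ : Fin d → ℝ, Complex.exp (-(2 * π * Complex.I) * (rdot φ Y : ℂ)) *
      (Real.exp (-(t * enormR φ ^ 2)) : ℂ) =
      (((π / t) ^ ((d : ℝ) / 2) * Real.exp (-(π ^ 2 / t * enormR Y ^ 2)) : ℝ) : ℂ) := by
  have h := GaussianFourier.integral_cexp_neg_sum_mul_add (ι := Fin d) (b := fun _ => (t : ℂ))
    (fun _ => by simpa using ht) (fun i => -(2 * π * Complex.I) * (Y i : ℂ))
  have h1 : ∀ φ : Fin d → ℝ, Complex.exp (-(2 * π * Complex.I) * (rdot φ Y : ℂ)) *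
      (Real.exp (-(t * enormR φ ^ 2)) : ℂ) =
      Complex.exp (-∑ i, (t : ℂ) * (φ i : ℂ) ^ 2 +
        ∑ i, -(2 * π * Complex.I) * (Y i : ℂ) * (φ i : ℂ)) := fun φ => by
    rw [Complex.ofReal_exp, ← Complex.exp_add, enormR_sq, rdot]
    congr 1
    push_cast
    rw [Finset.mul_sum, Finset.mul_sum, add_comm]
    congr 1
    exact Finset.sum_congr rfl fun i _ => by ring
  simp_rw [h1]
  rw [h, Finset.prod_mul_distrib, ← Complex.exp_sum, Finset.prod_const, Finset.card_univ,
    Fintype.card_fin]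
  push_cast
  congr 1
  · rw [← Complex.ofReal_div, ← Complex.cpow_nat_mul, Complex.ofReal_cpow (by positivity)]
    congr 1
    push_cast
    ring
  · congr 1
    have ht' : (t : ℂ) ≠ 0 := by exact_mod_cast ht.ne'
    rw [← Complex.ofReal_pow (enormR Y), enormR_sq]
    push_cast
    rw [Finset.mul_sum, ← Finset.sum_neg_distrib]
    refine Finset.sum_congr rfl fun i _ => ?_
    rw [mul_pow, neg_sq, mul_pow, Complex.I_sq]
    field_simp
    ring

lemma gauss_fourier {B : Matrix (Fin d) (Fin d) ℝ} (hB : B.det ≠ 0) {t : ℝ} (ht : 0 < t)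
    (X : Fin d → ℝ) :
    ∫ θ : Fin d → ℝ, Complex.exp (-(2 * π * Complex.I) * (rdot θ X : ℂ)) *
      (Real.exp (-(t * enormR (B *ᵥ θ) ^ 2)) : ℂ) =
      ((|(B.det)⁻¹| * ((π / t) ^ ((d : ℝ) / 2) *
        Real.exp (-(π ^ 2 / t * enormR ((B⁻¹)ᵀ *ᵥ X) ^ 2))) : ℝ) : ℂ) := by
  set Y := (B⁻¹)ᵀ *ᵥ X with hY
  set f : (Fin d → ℝ) → ℂ := fun φ => Complex.exp (-(2 * π * Complex.I) * (rdot φ Y : ℂ)) *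
      (Real.exp (-(t * enormR φ ^ 2)) : ℂ) with hf
  have hc : Continuous f := by
    have h1 := continuous_enormR (d := d)
    have h2 := continuous_rdot Y
    fun_prop
  have h1 : ∀ θ : Fin d → ℝ, rdot (B *ᵥ θ) Y = rdot θ X := fun θ => by
    rw [rdot_eq_dotProduct, rdot_eq_dotProduct, hY, dotProduct_mulVec, vecMul_transpose,
      mulVec_mulVec, Matrix.nonsing_inv_mul _ (isUnit_iff_ne_zero.mpr hB), one_mulVec]
  have h2 : ∫ θ, f (B *ᵥ θ) = ∫ φ, f φ ∂(Measure.map (toLin' B) volume) := by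
    rw [integral_map]
    · rfl
    · exact (LinearMap.continuous_of_finiteDimensional _).aemeasurable
    · exact hc.aestronglyMeasurable
  have h3 : ∀ θ : Fin d → ℝ, Complex.exp (-(2 * π * Complex.I) * (rdot θ X : ℂ)) *
      (Real.exp (-(t * enormR (B *ᵥ θ) ^ 2)) : ℂ) = f (B *ᵥ θ) := fun θ => by
    rw [hf]
    simp only [h1]
  simp_rw [h3]
  rw [h2, Real.map_matrix_volume_pi_eq_smul_volume_pi hB, integral_smul_measure,
    gauss_fourier_standard ht, ENNReal.toReal_ofReal (abs_nonneg _), Complex.real_smul]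
  push_cast
  rfl

open scoped MatrixOrder in
lemma exists_gauss_fourier {Λ : Matrix (Fin d) (Fin d) ℝ} (hΛ : Λ.IsHermitian) {κ C : ℝ}
    (hκ : 0 < κ) (hC : 0 < C)
    (hl : ∀ θ : Fin d → ℝ, κ * enormR θ ^ 2 ≤ θ ⬝ᵥ (Λ *ᵥ θ))
    (hu : ∀ θ : Fin d → ℝ, θ ⬝ᵥ (Λ *ᵥ θ) ≤ C * enormR θ ^ 2) {t : ℝ} (ht : 0 < t)
    (X : Fin d → ℝ) :
    ∃ G : ℝ, ∫ θ : Fin d → ℝ, Complex.exp (-(2 * π * Complex.I) * (rdot θ X : ℂ)) *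
      (Real.exp (-(t * (θ ⬝ᵥ (Λ *ᵥ θ)))) : ℂ) = G ∧ 0 ≤ G ∧
      G ≤ (π / κ) ^ ((d : ℝ) / 2) * t ^ (-((d : ℝ) / 2)) ∧
      (enormR X ^ 2 ≤ t →
        (π / C) ^ ((d : ℝ) / 2) * Real.exp (-(π ^ 2 / κ)) * t ^ (-((d : ℝ) / 2)) ≤ G) := by
  have hps : Λ.PosSemidef := PosSemidef.of_dotProduct_mulVec_nonneg hΛ fun θ => by
    refine le_trans ?_ (hl θ)
    positivity
  obtain ⟨B, hB⟩ := CStarAlgebra.nonneg_iff_eq_star_mul_self.mp hps.nonneg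
  have hq : ∀ θ : Fin d → ℝ, θ ⬝ᵥ (Λ *ᵥ θ) = enormR (B *ᵥ θ) ^ 2 := fun θ => by
    rw [enormR_sq_eq_dotProduct, hB, star_eq_conjTranspose, ← mulVec_mulVec, dotProduct_mulVec,
      conjTranspose_eq_transpose_of_trivial, vecMul_transpose]
  have hdet : B.det ≠ 0 := fun h0 => by
    obtain ⟨v, hv, hBv⟩ := Matrix.exists_mulVec_eq_zero_iff.mpr h0
    have h1 := hl v
    rw [hq, hBv, enormR_sq_eq_dotProduct 0, dotProduct_zero, enormR_sq_eq_dotProduct] at h1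
    have h2 : 0 < v ⬝ᵥ v := by
      have := Matrix.dotProduct_star_self_pos_iff.mpr hv
      simpa using this
    nlinarith [mul_pos hκ h2]
  have hinv : ∀ φ : Fin d → ℝ, κ * enormR (B⁻¹ *ᵥ φ) ^ 2 ≤ enormR φ ^ 2 := fun φ => by
    have h1 := hl (B⁻¹ *ᵥ φ)
    rwa [hq, mulVec_mulVec, Matrix.mul_nonsing_inv _ (isUnit_iff_ne_zero.mpr hdet),
      one_mulVec] at h1
  have hY : κ * enormR ((B⁻¹)ᵀ *ᵥ X) ^ 2 ≤ enormR X ^ 2 := by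
    set Y := (B⁻¹)ᵀ *ᵥ X with hY
    have h1 : enormR Y ^ 2 = rdot X (B⁻¹ *ᵥ Y) := by
      rw [enormR_sq_eq_dotProduct, rdot_eq_dotProduct, dotProduct_mulVec, ← mulVec_transpose,
        transpose_transpose,
        dotProduct_comm]
    have h2 := (le_abs_self _).trans (abs_rdot_le X (B⁻¹ *ᵥ Y))
    have h3 := hinv Y
    rw [← h1] at h2
    have h4 : (enormR Y ^ 2) ^ 2 ≤ enormR X ^ 2 * enormR (B⁻¹ *ᵥ Y) ^ 2 := by
      rw [← mul_pow]
      exact pow_le_pow_left₀ (by positivity) h2 2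
    by_cases h0 : enormR Y ^ 2 = 0
    · rw [h0]
      nlinarith [sq_nonneg (enormR X)]
    · have h5 : 0 < enormR Y ^ 2 := lt_of_le_of_ne (by positivity) (Ne.symm h0)
      have h6 : κ * (enormR Y ^ 2) * enormR Y ^ 2 ≤ enormR X ^ 2 * enormR Y ^ 2 := by
        nlinarith [mul_le_mul_of_nonneg_left h3 (sq_nonneg (enormR X))]
      exact le_of_mul_le_mul_right h6 h5
  have hint : ∀ X : Fin d → ℝ, ∫ θ : Fin d → ℝ, Complex.exp (-(2 * π * Complex.I) *
      (rdot θ X : ℂ)) * (Real.exp (-(t * (θ ⬝ᵥ (Λ *ᵥ θ)))) : ℂ) =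
      ((|(B.det)⁻¹| * ((π / t) ^ ((d : ℝ) / 2) *
        Real.exp (-(π ^ 2 / t * enormR ((B⁻¹)ᵀ *ᵥ X) ^ 2))) : ℝ) : ℂ) := fun X => by
    simp_rw [hq]
    exact gauss_fourier hdet ht X
  have h0 : ∫ θ : Fin d → ℝ, Real.exp (-(t * (θ ⬝ᵥ (Λ *ᵥ θ)))) =
      |(B.det)⁻¹| * (π / t) ^ ((d : ℝ) / 2) := by
    have h1 := hint 0
    simp only [rdot_eq_dotProduct, dotProduct_zero, Complex.ofReal_zero, mul_zero,
      Complex.exp_zero, one_mul, mulVec_zero, enormR_sq_eq_dotProduct, neg_zero, Real.exp_zero,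
      mul_one, integral_complex_ofReal] at h1
    exact_mod_cast h1
  have hcont : Continuous fun θ : Fin d → ℝ => Real.exp (-(t * (θ ⬝ᵥ (Λ *ᵥ θ)))) := by
    fun_prop
  have hI : Integrable fun θ : Fin d → ℝ => Real.exp (-(t * (θ ⬝ᵥ (Λ *ᵥ θ)))) := by
    refine (integrable_gauss (d := d) (mul_pos ht hκ)).mono' hcont.aestronglyMeasurable
      (Eventually.of_forall fun θ => ?_)
    rw [Real.norm_of_nonneg (Real.exp_pos _).le, Real.exp_le_exp, neg_le_neg_iff, mul_assoc]
    exact mul_le_mul_of_nonneg_left (hl θ) ht.le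
  have hpow : ∀ b : ℝ, 0 < b → Real.sqrt (π / (t * b)) ^ d =
      (π / b) ^ ((d : ℝ) / 2) * t ^ (-((d : ℝ) / 2)) := fun b hb => by
    rw [sqrt_pow_eq_rpow (by positivity), Real.rpow_neg ht.le, ← div_eq_mul_inv,
      ← Real.div_rpow (by positivity) ht.le]
    congr 1
    field_simp
  have hle : |(B.det)⁻¹| * (π / t) ^ ((d : ℝ) / 2) ≤
      (π / κ) ^ ((d : ℝ) / 2) * t ^ (-((d : ℝ) / 2)) := by
    rw [← h0, ← hpow κ hκ, ← integral_gauss]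
    refine integral_mono hI (integrable_gauss (mul_pos ht hκ)) fun θ => ?_
    simp only [Real.exp_le_exp, neg_le_neg_iff, mul_assoc]
    exact mul_le_mul_of_nonneg_left (hl θ) ht.le
  have hge : (π / C) ^ ((d : ℝ) / 2) * t ^ (-((d : ℝ) / 2)) ≤
      |(B.det)⁻¹| * (π / t) ^ ((d : ℝ) / 2) := by
    rw [← h0, ← hpow C hC, ← integral_gauss]
    refine integral_mono (integrable_gauss (mul_pos ht hC)) hI fun θ => ?_
    simp only [Real.exp_le_exp, neg_le_neg_iff, mul_assoc]
    exact mul_le_mul_of_nonneg_left (hu θ) ht.le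
  refine ⟨_, hint X, by positivity, ?_, fun hX => ?_⟩
  · refine le_trans ?_ hle
    rw [← mul_assoc]
    refine mul_le_of_le_one_right (by positivity) (Real.exp_le_one_iff.mpr ?_)
    rw [neg_nonpos]
    positivity
  · rw [← mul_assoc, mul_right_comm]
    refine mul_le_mul hge (Real.exp_le_exp.mpr (neg_le_neg ?_)) (by positivity) (by positivity)
    rw [div_mul_eq_mul_div, div_le_div_iff₀ ht hκ]
    nlinarith [sq_nonneg π, hY.trans hX]

lemma norm_cexp_mul_I_sub_one_le {ζ : ℝ} (hζ : 0 < ζ) (hζ1 : ζ ≤ 1) (a : ℝ) :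
    ‖Complex.exp (a * Complex.I) - 1‖ ≤ 2 * |a| ^ ζ := by
  have h0 : 0 ≤ |a| := abs_nonneg a
  rcases le_total |a| 1 with h | h
  · have h1 : ‖Complex.exp (a * Complex.I) - 1‖ ≤ |a| := by
      rw [mul_comm]
      exact Real.norm_exp_I_mul_ofReal_sub_one_le
    have h2 : |a| ≤ |a| ^ ζ := by
      simpa using Real.rpow_le_rpow_of_exponent_ge' h0 h hζ.le hζ1
    linarith
  · have h1 : ‖Complex.exp (a * Complex.I) - 1‖ ≤ 1 + 1 := by
      refine (norm_sub_le _ _).trans ?_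
      rw [Complex.norm_exp_ofReal_mul_I, norm_one]
    have h2 : 1 ≤ |a| ^ ζ := Real.one_le_rpow h hζ.le
    linarith

lemma norm_cexp_mul_I_taylor_le {ζ : ℝ} (hζ : 0 < ζ) (hζ1 : ζ ≤ 1) (a : ℝ) :
    ‖Complex.exp (a * Complex.I) - 1 - a * Complex.I + ((a ^ 2 / 2 : ℝ) : ℂ)‖ ≤
      4 * |a| ^ (2 + ζ) := by
  have h0 : 0 ≤ |a| := abs_nonneg a
  rcases le_total |a| 1 with h | h
  · have h1 := Complex.norm_exp_sub_sum_le_norm_mul_exp (a * Complex.I) 3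
    have h2 : ∑ m ∈ Finset.range 3, (a * Complex.I : ℂ) ^ m / m.factorial =
        1 + a * Complex.I - ((a ^ 2 / 2 : ℝ) : ℂ) := by
      simp only [Finset.sum_range_succ, Finset.sum_range_zero, mul_pow, Complex.I_sq,
        Nat.factorial]
      push_cast
      ring
    rw [h2, norm_mul, Complex.norm_I, mul_one, Complex.norm_real, Real.norm_eq_abs] at h1
    have h3 : |a| ^ 3 ≤ |a| ^ (2 + ζ) := by
      rw [← Real.rpow_natCast]
      refine Real.rpow_le_rpow_of_exponent_ge' h0 h (by linarith) ?_
      push_cast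
      linarith
    have h4 : Real.exp |a| ≤ 4 :=
      (Real.exp_le_exp.mpr h).trans (Real.exp_one_lt_d9.le.trans (by norm_num))
    calc _ = ‖Complex.exp (a * Complex.I) - (1 + a * Complex.I - ((a ^ 2 / 2 : ℝ) : ℂ))‖ := by
          congr 1; ring
      _ ≤ |a| ^ 3 * Real.exp |a| := h1
      _ ≤ |a| ^ (2 + ζ) * 4 := by gcongr
      _ = _ := mul_comm _ _
  · have h1 : ‖Complex.exp (a * Complex.I) - 1 - a * Complex.I + ((a ^ 2 / 2 : ℝ) : ℂ)‖ ≤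
        1 + 1 + |a| + a ^ 2 / 2 := by
      refine (norm_add_le _ _).trans (add_le_add ((norm_sub_le _ _).trans (add_le_add
        ((norm_sub_le _ _).trans ?_) ?_)) ?_)
      · rw [Complex.norm_exp_ofReal_mul_I, norm_one]
      · rw [norm_mul, Complex.norm_I, mul_one, Complex.norm_real, Real.norm_eq_abs]
      · rw [Complex.norm_real, Real.norm_of_nonneg (by positivity)]
    have h2 : |a| ^ (2 : ℝ) ≤ |a| ^ (2 + ζ) :=
      Real.rpow_le_rpow_of_exponent_le h (by linarith)
    rw [Real.rpow_two] at h2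
    nlinarith [sq_abs a]

lemma norm_cexp_sub_cexp_le {a b : ℂ} {m : ℝ} (ha : a.re ≤ m) (hb : b.re ≤ m) :
    ‖Complex.exp a - Complex.exp b‖ ≤ ‖a - b‖ * Real.exp m := by
  have h := (convex_halfSpace_re_le m).norm_image_sub_le_of_norm_hasDerivWithin_le
    (f := Complex.exp) (f' := Complex.exp) (C := Real.exp m)
    (fun x _ => (Complex.hasDerivAt_exp x).hasDerivWithinAt)
    (fun x hx => by rw [Complex.norm_exp]; exact Real.exp_le_exp.mpr hx) hb ha
  rw [mul_comm]
  exact h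

/-- The quadratic form `2 π² ∑ Q(y) (θ · y)²` as a matrix. -/
def qmat (Q : (Fin d → ℤ) → ℝ) : Matrix (Fin d) (Fin d) ℝ :=
  Matrix.of fun j l => 2 * π ^ 2 * ∑' y, (y j : ℝ) * (y l : ℝ) * Q y

lemma qmat_isHermitian (Q : (Fin d → ℤ) → ℝ) : (qmat Q).IsHermitian := by
  refine Matrix.IsHermitian.ext fun i j => ?_
  simp only [qmat, Matrix.of_apply, star_trivial]
  congr 2
  ext y
  ring

section

open UnitAddTorus

namespace Ker

variable {M κ ζ : ℝ} {Q g : (Fin d → ℤ) → ℝ}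

lemma summable_sq_mul (h : Ker M κ ζ Q g) (hζ : 0 < ζ) :
    Summable fun y => enormZ y ^ 2 * |Q y| := by
  refine Summable.of_nonneg_of_le (fun y => by positivity) (fun y => ?_) h.Qm_sum
  refine mul_le_mul_of_nonneg_right ?_ (abs_nonneg _)
  rw [← Real.rpow_two]
  exact enormZ_rpow_le two_pos (by linarith) y

lemma tsum_sq_mul_le (h : Ker M κ ζ Q g) (hζ : 0 < ζ) :
    ∑' y, enormZ y ^ 2 * |Q y| ≤ M := by
  refine (Summable.tsum_le_tsum (fun y => ?_) (h.summable_sq_mul hζ) h.Qm_sum).trans h.Qm_le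
  refine mul_le_mul_of_nonneg_right ?_ (abs_nonneg _)
  rw [← Real.rpow_two]
  exact enormZ_rpow_le two_pos (by linarith) y

lemma summable_coord_mul_coord_mul (h : Ker M κ ζ Q g) (hζ : 0 < ζ) (j l : Fin d) :
    Summable fun y => (y j : ℝ) * (y l : ℝ) * Q y := by
  refine Summable.of_norm (Summable.of_nonneg_of_le (fun _ => norm_nonneg _) (fun y => ?_)
    (h.summable_sq_mul hζ))
  rw [norm_mul, norm_mul, Real.norm_eq_abs, Real.norm_eq_abs, Real.norm_eq_abs, sq]
  have h1 := abs_apply_le_enormR (toR y) j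
  have h2 := abs_apply_le_enormR (toR y) l
  have h3 := enormZ_nonneg y
  gcongr
  · exact h1
  · exact h2

lemma hasSum_quad (h : Ker M κ ζ Q g) (hζ : 0 < ζ) (θ : Fin d → ℝ) :
    HasSum (fun y => 2 * π ^ 2 * (rdotZ θ y ^ 2 * Q y)) (θ ⬝ᵥ (qmat Q *ᵥ θ)) := by
  have h1 : HasSum (fun y => ∑ j, θ j * ∑ l, 2 * π ^ 2 * ((y j : ℝ) * (y l : ℝ) * Q y) * θ l)
      (θ ⬝ᵥ (qmat Q *ᵥ θ)) := by
    refine hasSum_sum fun j _ => HasSum.mul_left _ (hasSum_sum fun l _ => HasSum.mul_right _ ?_)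
    exact (h.summable_coord_mul_coord_mul hζ j l).hasSum.mul_left _
  refine h1.congr_fun fun y => ?_
  rw [rdotZ, sq (∑ i, _), Finset.sum_mul_sum]
  simp only [Finset.mul_sum, Finset.sum_mul]
  refine Finset.sum_congr rfl fun j _ => Finset.sum_congr rfl fun l _ => ?_
  ring

lemma quad_le (h : Ker M κ ζ Q g) (hζ : 0 < ζ) (θ : Fin d → ℝ) :
    θ ⬝ᵥ (qmat Q *ᵥ θ) ≤ 2 * π ^ 2 * M * enormR θ ^ 2 := by
  have h1 := hasSum_le (fun y => ?_) (h.hasSum_quad hζ θ)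
    ((h.summable_sq_mul hζ).hasSum.mul_left (2 * π ^ 2 * enormR θ ^ 2))
  · refine h1.trans ?_
    have := mul_le_mul_of_nonneg_left (h.tsum_sq_mul_le hζ)
      (by positivity : 0 ≤ 2 * π ^ 2 * enormR θ ^ 2)
    linarith
  · have h2 : rdotZ θ y ^ 2 ≤ (enormR θ * enormZ y) ^ 2 := by
      rw [← sq_abs]
      exact pow_le_pow_left₀ (abs_nonneg _) (abs_rdotZ_le θ y) 2
    calc 2 * π ^ 2 * (rdotZ θ y ^ 2 * Q y) ≤ 2 * π ^ 2 * ((enormR θ * enormZ y) ^ 2 * |Q y|) := by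
          refine mul_le_mul_of_nonneg_left ?_ (by positivity)
          exact (mul_le_mul_of_nonneg_left (le_abs_self _) (sq_nonneg _)).trans
            (mul_le_mul_of_nonneg_right h2 (abs_nonneg _))
      _ = _ := by ring

lemma norm_hatf_taylor_le (h : Ker M κ ζ Q g) (hζ : 0 < ζ) (hζ1 : ζ ≤ 1) (θ : Fin d → ℝ) :
    ‖hatf Q (kap θ) - (∑' y, Q y : ℝ) - 2 * π * Complex.I * (rdot θ (drift Q) : ℂ) +
      ((θ ⬝ᵥ (qmat Q *ᵥ θ) : ℝ) : ℂ)‖ ≤ 4 * (2 * π) ^ (2 + ζ) * M * enormR θ ^ (2 + ζ) := by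
  have h1 := (((hasSum_hatf_apply h.Q_sum (kap θ)).sub
    (Complex.hasSum_ofReal.mpr h.Q_sum.of_abs.hasSum)).sub
    ((Complex.hasSum_ofReal.mpr (h.hasSum_rdotZ_mul hζ θ)).mul_left (2 * π * Complex.I))).add
    (Complex.hasSum_ofReal.mpr (h.hasSum_quad hζ θ))
  have h2 : ∀ y, ‖(Q y : ℂ) * mFourier y (kap θ) - (Q y : ℂ) -
      2 * π * Complex.I * ((rdotZ θ y * Q y : ℝ) : ℂ) +
      ((2 * π ^ 2 * (rdotZ θ y ^ 2 * Q y) : ℝ) : ℂ)‖ ≤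
      4 * (2 * π * enormR θ) ^ (2 + ζ) * (enormZ y ^ (2 + ζ) * |Q y|) := fun y => by
    set a := 2 * π * rdotZ θ y with ha
    have h3 : (Q y : ℂ) * mFourier y (kap θ) - (Q y : ℂ) -
      2 * π * Complex.I * ((rdotZ θ y * Q y : ℝ) : ℂ) +
      ((2 * π ^ 2 * (rdotZ θ y ^ 2 * Q y) : ℝ) : ℂ) =
      (Q y : ℂ) * (Complex.exp (a * Complex.I) - 1 - a * Complex.I + ((a ^ 2 / 2 : ℝ) : ℂ)) := by
      rw [mFourier_kap, show (2 * π * Complex.I * (rdotZ θ y : ℂ) : ℂ) = a * Complex.I by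
        rw [ha]; push_cast; ring, ha]
      push_cast
      ring
    rw [h3, norm_mul, Complex.norm_real, Real.norm_eq_abs]
    have h4 : |a| ≤ 2 * π * enormR θ * enormZ y := by
      rw [ha, abs_mul, abs_of_pos Real.two_pi_pos, mul_assoc _ (enormR θ)]
      exact mul_le_mul_of_nonneg_left (abs_rdotZ_le θ y) Real.two_pi_pos.le
    have h5 : |a| ^ (2 + ζ) ≤ (2 * π * enormR θ) ^ (2 + ζ) * enormZ y ^ (2 + ζ) := by
      rw [← Real.mul_rpow (mul_nonneg Real.two_pi_pos.le (enormR_nonneg θ)) (enormZ_nonneg y)]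
      exact Real.rpow_le_rpow (abs_nonneg _) h4 (by linarith)
    calc |Q y| * _ ≤ |Q y| * (4 * |a| ^ (2 + ζ)) := by
          gcongr
          exact norm_cexp_mul_I_taylor_le hζ hζ1 a
      _ ≤ |Q y| * (4 * ((2 * π * enormR θ) ^ (2 + ζ) * enormZ y ^ (2 + ζ))) := by gcongr
      _ = _ := by ring
  have hs := h.Qm_sum.hasSum.mul_left (4 * (2 * π * enormR θ) ^ (2 + ζ))
  refine (h1.norm_le_of_bounded hs h2).trans ?_
  rw [Real.mul_rpow Real.two_pi_pos.le (enormR_nonneg θ)]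
  have h6 : 0 ≤ 4 * ((2 * π) ^ (2 + ζ) * enormR θ ^ (2 + ζ)) := by
    have := enormR_nonneg θ
    positivity
  have := mul_le_mul_of_nonneg_left h.Qm_le h6
  linarith

lemma le_quad (h : Ker M κ ζ Q g) (hζ : 0 < ζ) (hζ1 : ζ ≤ 1) (θ : Fin d → ℝ) :
    κ * enormR θ ^ 2 ≤ θ ⬝ᵥ (qmat Q *ᵥ θ) := by
  set C := 4 * (2 * π) ^ (2 + ζ) * M * enormR θ ^ (2 + ζ) with hC
  have key : ∀ᶠ s : ℝ in 𝓝[>] 0, κ * enormR θ ^ 2 ≤ θ ⬝ᵥ (qmat Q *ᵥ θ) + C * s ^ ζ := by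
    have h1 : ∀ᶠ s : ℝ in 𝓝[>] 0, s < 1 / (2 * (enormR θ + 1)) :=
      mem_nhdsWithin_of_mem_nhds (Iio_mem_nhds (by have := enormR_nonneg θ; positivity))
    filter_upwards [h1, self_mem_nhdsWithin] with s hs hs0
    have hs0 : 0 < s := hs0
    have h0 := enormR_nonneg θ
    have hmem : s • θ ∈ cube d := fun i => by
      have h2 : |s * θ i| < 1 / 2 := by
        rw [abs_mul, abs_of_pos hs0]
        calc s * |θ i| ≤ s * enormR θ := by
              gcongr
              exact abs_apply_le_enormR θ i
          _ ≤ s * (enormR θ + 1) := by gcongr; linarith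
          _ < 1 / (2 * (enormR θ + 1)) * (enormR θ + 1) := by gcongr
          _ = 1 / 2 := by field_simp
      have := abs_lt.mp h2
      simp only [Pi.smul_apply, smul_eq_mul, Set.mem_Ioc]
      constructor <;> linarith
    have h2 := h.infrared _ hmem
    have h3 := (Complex.abs_re_le_norm _).trans (h.norm_hatf_taylor_le hζ hζ1 (s • θ))
    have h4 : (2 * π * Complex.I * (rdot (s • θ) (drift Q) : ℂ) : ℂ).re = 0 := by simp
    rw [Complex.add_re, Complex.sub_re, Complex.sub_re, h4, Complex.ofReal_re, Complex.ofReal_re,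
      mulVec_smul, smul_dotProduct, dotProduct_smul, smul_eq_mul, smul_eq_mul, enormR_smul,
      abs_of_pos hs0, Real.mul_rpow hs0.le h0, Real.rpow_add hs0, Real.rpow_two] at h3
    rw [enormR_smul, abs_of_pos hs0] at h2
    have h5 := (abs_le.mp h3).1
    have h6 : s ^ 2 * (κ * enormR θ ^ 2) ≤ s ^ 2 * (θ ⬝ᵥ (qmat Q *ᵥ θ) + C * s ^ ζ) := by
      rw [hC]
      linarith
    exact le_of_mul_le_mul_left h6 (by positivity)
  have hlim : Tendsto (fun s : ℝ => θ ⬝ᵥ (qmat Q *ᵥ θ) + C * s ^ ζ) (𝓝[>] 0)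
      (𝓝 (θ ⬝ᵥ (qmat Q *ᵥ θ) + C * 0 ^ ζ)) := by
    refine Tendsto.mono_left ?_ nhdsWithin_le_nhds
    exact tendsto_const_nhds.add (((Real.continuous_rpow_const hζ.le).tendsto 0).const_mul C)
  rw [Real.zero_rpow hζ.ne', mul_zero, add_zero] at hlim
  exact ge_of_tendsto hlim key

lemma norm_hatf_sub_le (h : Ker M κ ζ Q g) (hζ : 0 < ζ) (hζ1 : ζ ≤ 1) (θ : Fin d → ℝ) :
    ‖hatf g (kap θ) - (∑' y, g y : ℝ)‖ ≤ 2 * (2 * π) ^ ζ * M * enormR θ ^ ζ := by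
  have h1 := (hasSum_hatf_apply h.g_sum (kap θ)).sub
    (Complex.hasSum_ofReal.mpr h.g_sum.of_abs.hasSum)
  have h2 : ∀ y, ‖(g y : ℂ) * mFourier y (kap θ) - (g y : ℂ)‖ ≤
      2 * (2 * π * enormR θ) ^ ζ * (enormZ y ^ ζ * |g y|) := fun y => by
    set a := 2 * π * rdotZ θ y with ha
    have h3 : (g y : ℂ) * mFourier y (kap θ) - (g y : ℂ) =
      (g y : ℂ) * (Complex.exp (a * Complex.I) - 1) := by
      rw [mFourier_kap, show (2 * π * Complex.I * (rdotZ θ y : ℂ) : ℂ) = a * Complex.I by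
        rw [ha]; push_cast; ring]
      ring
    rw [h3, norm_mul, Complex.norm_real, Real.norm_eq_abs]
    have h4 : |a| ≤ 2 * π * enormR θ * enormZ y := by
      rw [ha, abs_mul, abs_of_pos Real.two_pi_pos, mul_assoc _ (enormR θ)]
      exact mul_le_mul_of_nonneg_left (abs_rdotZ_le θ y) Real.two_pi_pos.le
    have h5 : |a| ^ ζ ≤ (2 * π * enormR θ) ^ ζ * enormZ y ^ ζ := by
      rw [← Real.mul_rpow (mul_nonneg Real.two_pi_pos.le (enormR_nonneg θ)) (enormZ_nonneg y)]
      exact Real.rpow_le_rpow (abs_nonneg _) h4 hζ.le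
    calc |g y| * _ ≤ |g y| * (2 * |a| ^ ζ) := by
          gcongr
          exact norm_cexp_mul_I_sub_one_le hζ hζ1 a
      _ ≤ |g y| * (2 * ((2 * π * enormR θ) ^ ζ * enormZ y ^ ζ)) := by gcongr
      _ = _ := by ring
  have hs := h.gz_sum.hasSum.mul_left (2 * (2 * π * enormR θ) ^ ζ)
  refine (h1.norm_le_of_bounded hs h2).trans ?_
  rw [Real.mul_rpow Real.two_pi_pos.le (enormR_nonneg θ)]
  have h6 : 0 ≤ 2 * ((2 * π) ^ ζ * enormR θ ^ ζ) := by
    have := enormR_nonneg θ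
    positivity
  have := mul_le_mul_of_nonneg_left h.gz_le h6
  linarith

end Ker

end

section LocalLimit
open UnitAddTorus

lemma rpow_mul_gauss_le {κ ζ : ℝ} (hκ : 0 < κ) (hζ : 0 < ζ) (hζ1 : ζ ≤ 1) {t : ℝ} (ht : 0 < t)
    {r : ℝ} (hr : 0 ≤ r) :
    r ^ ζ * (1 + t * r ^ 2) * Real.exp (-(t * κ * r ^ 2)) ≤
      (1 / min 1 (κ / 4) ^ 2) * t ^ (-(ζ / 2)) * Real.exp (-(t * (κ / 2) * r ^ 2)) := by
  set m := min 1 (κ / 4) with hm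
  have hm0 : 0 < m := lt_min one_pos (by linarith)
  set s := t * r ^ 2 with hs
  have hs0 : 0 ≤ s := by positivity
  have h1 : r ^ ζ = t ^ (-(ζ / 2)) * s ^ (ζ / 2) := by
    rw [hs, Real.mul_rpow ht.le (sq_nonneg r), ← mul_assoc, ← Real.rpow_add ht, neg_add_cancel,
      Real.rpow_zero, one_mul, ← Real.rpow_natCast, ← Real.rpow_mul hr]
    congr 1
    push_cast
    ring
  have h2 : s ^ (ζ / 2) ≤ 1 + s := by
    calc s ^ (ζ / 2) ≤ (1 + s) ^ (ζ / 2) := by gcongr; linarith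
      _ ≤ (1 + s) ^ (1 : ℝ) :=
          Real.rpow_le_rpow_of_exponent_le (by linarith) (by linarith)
      _ = 1 + s := Real.rpow_one _
  have h3 : m * (1 + s) ≤ Real.exp (s * (κ / 4)) := by
    have h4 := Real.add_one_le_exp (s * (κ / 4))
    have h5 : m ≤ 1 := min_le_left _ _
    have h6 : m * s ≤ (κ / 4) * s := mul_le_mul_of_nonneg_right (min_le_right _ _) hs0
    linarith
  have h7 : (1 + s) ^ 2 ≤ 1 / m ^ 2 * Real.exp (s * (κ / 2)) := by
    have h8 := pow_le_pow_left₀ (by positivity) h3 2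
    rw [← Real.exp_nat_mul, mul_pow] at h8
    rw [one_div, inv_mul_eq_div, le_div_iff₀ (by positivity), mul_comm]
    refine h8.trans_eq ?_
    congr 1
    push_cast
    ring
  calc r ^ ζ * (1 + s) * Real.exp (-(t * κ * r ^ 2))
      ≤ t ^ (-(ζ / 2)) * (1 + s) * (1 + s) * Real.exp (-(t * κ * r ^ 2)) := by
        rw [h1]
        gcongr
    _ = t ^ (-(ζ / 2)) * (1 + s) ^ 2 * Real.exp (-(t * κ * r ^ 2)) := by ring
    _ ≤ t ^ (-(ζ / 2)) * (1 / m ^ 2 * Real.exp (s * (κ / 2))) *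
          Real.exp (-(t * κ * r ^ 2)) := by gcongr
    _ = 1 / m ^ 2 * t ^ (-(ζ / 2)) * (Real.exp (s * (κ / 2)) * Real.exp (-(t * κ * r ^ 2))) := by
        ring
    _ = _ := by
        rw [← Real.exp_add]
        congr 2
        rw [hs]
        ring

/-- The local limit theorem for the evolution generated by the kernel, with a uniform rate. -/
theorem exists_norm_Ik_sub_gauss_le (d : ℕ) {M κ ζ : ℝ} (hM : 0 < M) (hκ : 0 < κ) (hζ : 0 < ζ)
    (hζ1 : ζ ≤ 1) :
    ∃ C2 C3 c4 : ℝ, 0 < C2 ∧ 0 < C3 ∧ 0 < c4 ∧ ∀ Q g : (Fin d → ℤ) → ℝ, Ker M κ ζ Q g →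
      ∀ t : ℝ, 1 ≤ t → ∀ x : Fin d → ℤ, ∃ G : ℝ, 0 ≤ G ∧ G ≤ C3 * t ^ (-((d : ℝ) / 2)) ∧
        (enormR (toR x - t • drift Q) ^ 2 ≤ t → c4 * t ^ (-((d : ℝ) / 2)) ≤ G) ∧
        ‖Ik Q g t x - (((∑' y, g y) * G : ℝ) : ℂ)‖ ≤ C2 * t ^ (-((d : ℝ) / 2) - ζ / 2) := by
  set C0 : ℝ := 4 * (2 * π) ^ (2 + ζ) * M with hC0
  set C1 : ℝ := 2 * (2 * π) ^ ζ * M with hC1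
  set Cb : ℝ := C1 + M * C0 + M * 2 ^ ζ with hCb
  set C5 : ℝ := 1 / min 1 (κ / 4) ^ 2 with hC5
  have hm0 : 0 < min 1 (κ / 4) := lt_min one_pos (by linarith)
  refine ⟨Cb * C5 * (π / (κ / 2)) ^ ((d : ℝ) / 2), (π / κ) ^ ((d : ℝ) / 2),
    (π / (2 * π ^ 2 * M)) ^ ((d : ℝ) / 2) * Real.exp (-(π ^ 2 / κ)), by positivity, by positivity,
    by positivity, ?_⟩
  intro Q g h t ht1 x
  have ht : 0 < t := by linarith
  set X := toR x - t • drift Q with hX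
  set q : (Fin d → ℝ) → ℝ := fun θ => θ ⬝ᵥ (qmat Q *ᵥ θ) with hq
  have hlq : ∀ θ, κ * enormR θ ^ 2 ≤ q θ := h.le_quad hζ hζ1
  obtain ⟨G, hG, hG0, hGu, hGl⟩ := exists_gauss_fourier (qmat_isHermitian Q) hκ
    (by positivity) hlq (h.quad_le hζ) ht X
  refine ⟨G, hG0, hGu, hGl, ?_⟩
  set q0 := ∑' y, Q y with hq0
  set g0 := ∑' y, g y with hg0
  have hg0M : |g0| ≤ M := by
    have h1 := norm_tsum_le_tsum_norm (f := g) h.g_sum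
    exact h1.trans h.g_le
  set D : (Fin d → ℝ) → ℂ := fun θ =>
    hatf Q (kap θ) - (q0 : ℂ) - 2 * π * Complex.I * (rdot θ (drift Q) : ℂ) with hD
  set e : (Fin d → ℝ) → ℂ := fun θ => Complex.exp (-(2 * π * Complex.I) * (rdot θ X : ℂ)) with he
  have hen : ∀ θ, ‖e θ‖ = 1 := fun θ => by
    rw [he]
    simp only
    rw [show -(2 * π * Complex.I) * (rdot θ X : ℂ) = ((-(2 * π * rdot θ X) : ℝ) : ℂ) * Complex.I by
      push_cast; ring, Complex.norm_exp_ofReal_mul_I]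
  have hckap := continuous_kap (d := d)
  have hcr := continuous_rdot (d := d)
  have hce : Continuous e := by
    have := hcr X
    fun_prop
  have hcD : Continuous D := by
    have h1 := hcr (drift Q)
    have h2 : Continuous fun θ : Fin d → ℝ => hatf Q (kap θ) := (hatf Q).continuous.comp hckap
    fun_prop
  set F1 : (Fin d → ℝ) → ℂ := fun θ => e θ * hatf g (kap θ) * Complex.exp (t * D θ) with hF1
  set F2 : (Fin d → ℝ) → ℂ := fun θ => (g0 : ℂ) * (e θ * (Real.exp (-(t * q θ)) : ℂ)) with hF2
  have hcg : Continuous fun θ : Fin d → ℝ => hatf g (kap θ) := (hatf g).continuous.comp hckap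
  have hcF1 : Continuous F1 := by fun_prop
  have hcq : Continuous q := by
    rw [hq]
    fun_prop
  have hcF2 : Continuous F2 := by fun_prop
  have hIk : Ik Q g t x = ∫ θ, (cube d).indicator F1 θ := by
    rw [integral_indicator measurableSet_cube, Ker.Ik_eq, co]
    refine setIntegral_congr_fun measurableSet_cube fun θ _ => ?_
    simp only [ContinuousMap.mul_apply, ContinuousMap.smul_apply, tor_exp_apply, smul_eq_mul]
    have h1 : mFourier (-x) (kap θ) = e θ * Complex.exp (-(t * (2 * π * Complex.I *
        (rdot θ (drift Q) : ℂ)))) := by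
      have h2 : rdotZ θ (-x) = -rdot θ X - t * rdot θ (drift Q) := by
        simp only [rdotZ, rdot, hX, Finset.mul_sum, ← Finset.sum_neg_distrib,
          ← Finset.sum_sub_distrib, toR, Pi.sub_apply, Pi.smul_apply, smul_eq_mul, Pi.neg_apply]
        refine Finset.sum_congr rfl fun i _ => ?_
        push_cast
        ring
      rw [mFourier_kap, h2, he, ← Complex.exp_add]
      congr 1
      push_cast
      ring
    rw [h1, Complex.ofReal_exp]
    have h3 : Complex.exp (t * D θ) = Complex.exp (-(t * (2 * π * Complex.I *
        (rdot θ (drift Q) : ℂ)))) * Complex.exp ((-(t * q0) : ℝ) : ℂ) *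
        Complex.exp (t * hatf Q (kap θ)) := by
      rw [← Complex.exp_add, ← Complex.exp_add, hD]
      congr 1
      push_cast
      ring
    have h4 : (t • hatf Q : Tor d) (kap θ) = (t : ℂ) * hatf Q (kap θ) := by simp
    simp only [hF1]
    rw [h3]
    simp only [Complex.real_smul]
    ring
  have hG' : ((g0 * G : ℝ) : ℂ) = ∫ θ, F2 θ := by
    rw [hF2, integral_const_mul, hG]
    push_cast
    rfl
  have hE2 : ∀ θ, ‖(Real.exp (-(t * q θ)) : ℂ)‖ ≤ Real.exp (-(t * κ * enormR θ ^ 2)) := fun θ => by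
    rw [Complex.norm_real, Real.norm_of_nonneg (Real.exp_pos _).le, Real.exp_le_exp,
      neg_le_neg_iff, mul_assoc]
    exact mul_le_mul_of_nonneg_left (hlq θ) ht.le
  have hmain : ∀ θ, ‖(cube d).indicator F1 θ - F2 θ‖ ≤
      Cb * (C5 * t ^ (-(ζ / 2)) * Real.exp (-(t * (κ / 2) * enormR θ ^ 2))) := fun θ => by
    have hr := enormR_nonneg θ
    have hC00 : 0 ≤ C0 := by positivity
    have hC10 : 0 ≤ C1 := by positivity
    refine le_trans ?_ (mul_le_mul_of_nonneg_left (rpow_mul_gauss_le hκ hζ hζ1 ht hr)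
      (by positivity : 0 ≤ Cb))
    set r := enormR θ with hrd
    set N := Real.exp (-(t * κ * r ^ 2)) with hN
    have hN0 : 0 < N := Real.exp_pos _
    have hrz : 0 ≤ r ^ ζ := Real.rpow_nonneg hr _
    by_cases hθ : θ ∈ cube d
    · rw [Set.indicator_of_mem hθ]
      have h1 : F1 θ - F2 θ = e θ * ((hatf g (kap θ) - (g0 : ℂ)) * Complex.exp (t * D θ) +
          (g0 : ℂ) * (Complex.exp (t * D θ) - Complex.exp (((-(t * q θ) : ℝ) : ℂ)))) := by
        rw [hF1, hF2, ← Complex.ofReal_exp]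
        ring
      have hDre : (t * D θ : ℂ).re ≤ -(t * κ * r ^ 2) := by
        have h2 := h.infrared θ hθ
        have h3 : (D θ).re = (hatf Q (kap θ)).re - q0 := by simp [hD]
        rw [Complex.re_ofReal_mul, h3, mul_assoc, ← mul_neg]
        refine mul_le_mul_of_nonneg_left ?_ ht.le
        linarith
      have hEre : (((-(t * q θ) : ℝ) : ℂ)).re ≤ -(t * κ * r ^ 2) := by
        rw [Complex.ofReal_re, neg_le_neg_iff, mul_assoc]
        exact mul_le_mul_of_nonneg_left (hlq θ) ht.le
      have h4 := norm_cexp_sub_cexp_le hDre hEre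
      have h5 : ‖(t * D θ : ℂ) - ((-(t * q θ) : ℝ) : ℂ)‖ ≤ t * (C0 * r ^ (2 + ζ)) := by
        have h6 := h.norm_hatf_taylor_le hζ hζ1 θ
        have h7 : (t * D θ : ℂ) - ((-(t * q θ) : ℝ) : ℂ) = (t : ℂ) * (D θ + (q θ : ℂ)) := by
          push_cast
          ring
        rw [h7, norm_mul, Complex.norm_real, Real.norm_of_nonneg ht.le]
        exact mul_le_mul_of_nonneg_left h6 ht.le
      have h8 : ‖Complex.exp (t * D θ)‖ ≤ N := by
        rw [Complex.norm_exp]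
        exact Real.exp_le_exp.mpr hDre
      have h9 : ‖(g0 : ℂ)‖ ≤ M := by rwa [Complex.norm_real, Real.norm_eq_abs]
      have h10 : r ^ (2 + ζ) = r ^ ζ * r ^ 2 := by
        rw [add_comm, Real.rpow_add_of_nonneg hr hζ.le zero_le_two, Real.rpow_two]
      rw [h1, norm_mul, hen, one_mul]
      calc _ ≤ ‖hatf g (kap θ) - (g0 : ℂ)‖ * ‖Complex.exp (t * D θ)‖ +
            ‖(g0 : ℂ)‖ * ‖Complex.exp (t * D θ) - Complex.exp (((-(t * q θ) : ℝ) : ℂ))‖ := by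
            rw [← norm_mul, ← norm_mul]
            exact norm_add_le _ _
        _ ≤ C1 * r ^ ζ * N + M * (t * (C0 * r ^ (2 + ζ)) * N) := by
            gcongr
            · exact h.norm_hatf_sub_le hζ hζ1 θ
            · exact h4.trans (mul_le_mul_of_nonneg_right h5 hN0.le)
        _ = (C1 + M * C0 * (t * r ^ 2)) * (r ^ ζ * N) := by rw [h10]; ring
        _ ≤ (Cb * (1 + t * r ^ 2)) * (r ^ ζ * N) := by
            gcongr
            have h11 : 0 ≤ M * C0 := by positivity
            have h12 : 0 ≤ M * 2 ^ ζ := by positivity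
            have h13 : 0 ≤ t * r ^ 2 := by positivity
            rw [hCb]
            nlinarith [mul_nonneg hC10 h13, mul_nonneg h12 h13]
        _ = _ := by ring
    · rw [Set.indicator_of_notMem hθ, zero_sub, norm_neg, hF2, norm_mul, norm_mul, hen, one_mul,
        Complex.norm_real, Real.norm_eq_abs]
      have h1 : 1 / 2 ≤ r := by
        obtain ⟨i, hi⟩ := not_forall.mp hθ
        refine le_trans ?_ (abs_apply_le_enormR θ i)
        by_contra! hlt
        refine hi ?_
        have := abs_lt.mp hlt
        constructor <;> linarith
      have h2 : 1 ≤ 2 ^ ζ * r ^ ζ := by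
        rw [← Real.mul_rpow zero_le_two hr]
        exact Real.one_le_rpow (by linarith) hζ.le
      calc |g0| * ‖(Real.exp (-(t * q θ)) : ℂ)‖ ≤ M * N * 1 := by
            rw [mul_one]
            exact mul_le_mul hg0M (hE2 θ) (norm_nonneg _) hM.le
        _ ≤ M * N * (2 ^ ζ * r ^ ζ) := by gcongr
        _ = M * 2 ^ ζ * 1 * (r ^ ζ * N) := by ring
        _ ≤ Cb * (1 + t * r ^ 2) * (r ^ ζ * N) := by
            have h12 : 0 ≤ M * 2 ^ ζ := by positivity
            have h13 : 0 ≤ t * r ^ 2 := by positivity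
            gcongr
            · rw [hCb]
              nlinarith
            · linarith
        _ = _ := by ring
  have hI2 : Integrable F2 := by
    refine ((integrable_gauss (d := d) (mul_pos ht hκ)).const_mul M).mono'
      hcF2.aestronglyMeasurable (Eventually.of_forall fun θ => ?_)
    rw [hF2, norm_mul, norm_mul, hen, one_mul, Complex.norm_real, Real.norm_eq_abs]
    exact mul_le_mul hg0M (hE2 θ) (norm_nonneg _) hM.le
  have hIb : Integrable fun θ : Fin d → ℝ =>
      Cb * (C5 * t ^ (-(ζ / 2)) * Real.exp (-(t * (κ / 2) * enormR θ ^ 2))) :=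
    ((integrable_gauss (d := d) (by positivity)).const_mul _).const_mul _
  have hIs : Integrable fun θ => (cube d).indicator F1 θ - F2 θ :=
    hIb.mono' ((hcF1.aestronglyMeasurable.indicator measurableSet_cube).sub
      hcF2.aestronglyMeasurable) (Eventually.of_forall hmain)
  have hI1 : Integrable ((cube d).indicator F1) := by
    have := hIs.add hI2
    refine this.congr (Eventually.of_forall fun θ => ?_)
    simp
  rw [hIk, hG', ← integral_sub hI1 hI2]
  refine (norm_integral_le_of_norm_le hIb (Eventually.of_forall hmain)).trans_eq ?_
  rw [integral_const_mul, integral_const_mul, integral_gauss, sqrt_pow_eq_rpow (by positivity),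
    sub_eq_add_neg, Real.rpow_add ht, Real.rpow_neg ht.le ((d : ℝ) / 2),
    show π / (t * (κ / 2)) = π / (κ / 2) / t by field_simp, Real.div_rpow (by positivity) ht.le]
  ring

end LocalLimit

section WindowIntegrals

/-- The decay exponent used to integrate the Gaussian-type majorant. -/
def wexp (d : ℕ) : ℝ := aExp d - 1 / 4

/-- Polynomial majorant of the Gaussian profile of a walk with speed `v` seen from distance `r`. -/
def wgt (d : ℕ) (r v t : ℝ) : ℝ :=
  max t 1 ^ (-((d : ℝ) / 2)) * (1 + (r - v * t) ^ 2 / max t 1) ^ (-wexp d)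

lemma wexp_ge (d : ℕ) : 3 / 4 ≤ wexp d := by
  have := one_le_aExp (d := d)
  unfold wexp; linarith

lemma wexp_sub_ge (d : ℕ) : -(3 / 4) ≤ wexp d - (d : ℝ) / 2 := by
  unfold wexp aExp
  split_ifs with h
  · have : (d : ℝ) ≤ 3 := by exact_mod_cast h
    linarith
  · linarith

lemma wexp_add_ge {d : ℕ} (hd : 1 ≤ d) : 5 / 4 ≤ wexp d + (d : ℝ) / 2 := by
  have := wexp_ge d
  have : (1 : ℝ) ≤ d := by exact_mod_cast hd
  linarith

lemma wgt_nonneg (d : ℕ) (r v t : ℝ) : 0 ≤ wgt d r v t := by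
  unfold wgt; positivity

lemma wgt_le (d : ℕ) {r v t B : ℝ} (hB : 0 < B) (h : B ≤ (r - v * t) ^ 2 / max t 1) :
    wgt d r v t ≤ max t 1 ^ (-((d : ℝ) / 2)) * B ^ (-wexp d) := by
  unfold wgt
  refine mul_le_mul_of_nonneg_left ?_ (by positivity)
  exact Real.rpow_le_rpow_of_nonpos hB (by linarith) (by linarith [wexp_ge d])

lemma continuous_wgt (d : ℕ) (r v : ℝ) : Continuous (wgt d r v) := by
  unfold wgt
  have h1 : ∀ t : ℝ, 0 < max t 1 := fun t => lt_max_of_lt_right one_pos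
  refine Continuous.mul ?_ ?_
  · exact (continuous_id.max continuous_const).rpow_const fun t => Or.inl (h1 t).ne'
  · refine Continuous.rpow_const ?_ fun t => Or.inl ?_
    · exact continuous_const.add (Continuous.div (by fun_prop) (continuous_id.max continuous_const)
        fun t => (h1 t).ne')
    · have := h1 t
      positivity

lemma wgt_le_left (d : ℕ) {r v b t : ℝ} (hr : 0 < r) (hb : 1 ≤ b) (ht : 0 < t) (htb : t ≤ b)
    (hX : r / 2 ≤ r - v * t) :
    wgt d r v t ≤ ((r / 2) ^ 2) ^ (-wexp d) * b ^ (wexp d - (d : ℝ) / 2 + 3 / 4) *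
      t ^ (-(3 / 4) : ℝ) := by
  have hτ : 0 < max t 1 := lt_max_of_lt_right one_pos
  have h1 : (r / 2) ^ 2 / max t 1 ≤ (r - v * t) ^ 2 / max t 1 := by
    gcongr
  refine (wgt_le d (by positivity) h1).trans ?_
  rw [Real.div_rpow (by positivity) hτ.le, Real.rpow_neg hτ.le (wexp d), div_inv_eq_mul]
  calc max t 1 ^ (-((d : ℝ) / 2)) * (((r / 2) ^ 2) ^ (-wexp d) * max t 1 ^ wexp d)
      = ((r / 2) ^ 2) ^ (-wexp d) * (max t 1 ^ (wexp d - (d : ℝ) / 2 + 3 / 4) *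
        max t 1 ^ (-(3 / 4) : ℝ)) := by
        rw [← Real.rpow_add hτ, mul_left_comm, ← Real.rpow_add hτ]; congr 2; ring
    _ ≤ ((r / 2) ^ 2) ^ (-wexp d) * (b ^ (wexp d - (d : ℝ) / 2 + 3 / 4) *
        t ^ (-(3 / 4) : ℝ)) := by
        refine mul_le_mul_of_nonneg_left (mul_le_mul ?_ ?_ (by positivity) (by positivity))
          (by positivity)
        · exact Real.rpow_le_rpow hτ.le (max_le htb hb) (by linarith [wexp_sub_ge d])
        · exact Real.rpow_le_rpow_of_nonpos ht (le_max_left _ _) (by norm_num)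
    _ = _ := by ring

lemma lintegral_ofReal_le {s : Set ℝ} (hs : MeasurableSet s) {f g : ℝ → ℝ} {B : ℝ}
    (hfg : ∀ t ∈ s, f t ≤ g t) (hg0 : ∀ t ∈ s, 0 ≤ g t) (hg : IntegrableOn g s)
    (hB : ∫ t in s, g t ≤ B) :
    ∫⁻ t in s, ENNReal.ofReal (f t) ≤ ENNReal.ofReal B := by
  calc ∫⁻ t in s, ENNReal.ofReal (f t) ≤ ∫⁻ t in s, ENNReal.ofReal (g t) :=
        setLIntegral_mono' hs fun t ht => ENNReal.ofReal_le_ofReal (hfg t ht)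
    _ = ENNReal.ofReal (∫ t in s, g t) :=
        (ofReal_integral_eq_lintegral_ofReal hg
          ((ae_restrict_iff' hs).2 (ae_of_all _ hg0))).symm
    _ ≤ _ := ENNReal.ofReal_le_ofReal hB

lemma lintegral_wgt_left_le (d : ℕ) {r v b : ℝ} (hr : 0 < r) (hb : 1 ≤ b)
    (hX : ∀ t, 0 < t → t ≤ b → r / 2 ≤ r - v * t) :
    ∫⁻ t in Set.Ioc 0 b, ENNReal.ofReal (wgt d r v t) ≤
      ENNReal.ofReal (4 * ((r / 2) ^ 2) ^ (-wexp d) * b ^ (wexp d - (d : ℝ) / 2 + 1)) := by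
  have hb0 : 0 < b := by linarith
  refine lintegral_ofReal_le measurableSet_Ioc
    (fun t ht => wgt_le_left d hr hb ht.1 ht.2 (hX t ht.1 ht.2)) (fun t ht => ?_) ?_ ?_
  · have := ht.1
    positivity
  · refine Integrable.const_mul ?_ _
    exact (intervalIntegrable_iff_integrableOn_Ioc_of_le hb0.le).1
      (intervalIntegral.intervalIntegrable_rpow' (by norm_num))
  · rw [integral_const_mul, ← intervalIntegral.integral_of_le hb0.le,
      integral_rpow (Or.inl (by norm_num)), Real.zero_rpow (by norm_num)]
    have : b ^ (wexp d - (d : ℝ) / 2 + 1) = b ^ (wexp d - (d : ℝ) / 2 + 3 / 4) *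
        b ^ (-(3 / 4) + 1 : ℝ) := by
      rw [← Real.rpow_add hb0]; congr 1; ring
    rw [this]
    apply le_of_eq; ring

lemma lintegral_rpow_Ioi_le {q b c : ℝ} (hq : 5 / 4 ≤ q) (hb : 0 < b) (hc : 0 ≤ c) {f : ℝ → ℝ}
    (hf : ∀ t, b < t → f t ≤ c * t ^ (-q)) :
    ∫⁻ t in Set.Ioi b, ENNReal.ofReal (f t) ≤ ENNReal.ofReal (4 * c * b ^ (1 - q)) := by
  refine lintegral_ofReal_le measurableSet_Ioi (fun t ht => hf t ht) (fun t ht => ?_) ?_ ?_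
  · have : 0 < t := hb.trans ht
    positivity
  · exact (integrableOn_Ioi_rpow_of_lt (by linarith) hb).const_mul c
  · rw [integral_const_mul, integral_Ioi_rpow_of_lt (by linarith) hb,
      show -q + 1 = 1 - q by ring, neg_div, ← div_neg, mul_comm 4 c, mul_assoc]
    refine mul_le_mul_of_nonneg_left ?_ hc
    rw [div_le_iff₀ (by linarith)]
    have : 0 ≤ b ^ (1 - q) := by positivity
    nlinarith

/-- The total mass of the profile `(1 + x²)^(-3/4)`. -/
def profMass : ℝ := ∫ x : ℝ, (1 + ‖x‖ ^ 2) ^ (-(3 / 2) / 2 : ℝ)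

lemma profMass_nonneg : 0 ≤ profMass := integral_nonneg fun x => by positivity

lemma lintegral_wgt_middle_le (d : ℕ) {v b a : ℝ} (hv : 0 < v) (ha : 0 < a) (hb : 1 ≤ b) :
    ∫⁻ t in Set.Ioc b (2 * a), ENNReal.ofReal (wgt d (v * a) v t) ≤
      ENNReal.ofReal (b ^ (-((d : ℝ) / 2)) * ((Real.sqrt (2 * a) / v) * profMass)) := by
  have hb0 : 0 < b := by linarith
  set σ := Real.sqrt (2 * a) / v with hσ
  have hσ0 : 0 < σ := by positivity
  have hI : Integrable fun t : ℝ => b ^ (-((d : ℝ) / 2)) *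
      (1 + ‖(t - a) / σ‖ ^ 2) ^ (-(3 / 2) / 2 : ℝ) := by
    refine Integrable.const_mul ?_ _
    have h1 := integrable_rpow_neg_one_add_norm_sq (E := ℝ) (μ := volume) (r := 3 / 2)
      (by norm_num)
    exact (h1.comp_div hσ0.ne').comp_sub_right a
  refine lintegral_ofReal_le measurableSet_Ioc (g := fun t : ℝ => b ^ (-((d : ℝ) / 2)) *
      (1 + ‖(t - a) / σ‖ ^ 2) ^ (-(3 / 2) / 2 : ℝ)) (fun t ht => ?_) (fun t ht => by positivity)
      hI.integrableOn ?_
  · have ht1 : 1 ≤ t := hb.trans ht.1.le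
    have hs : ‖(t - a) / σ‖ ^ 2 ≤ (v * a - v * t) ^ 2 / t := by
      rw [Real.norm_eq_abs, sq_abs, div_pow, hσ, div_pow, Real.sq_sqrt (by linarith),
        div_div_eq_mul_div, div_le_div_iff₀ (by positivity) (by linarith)]
      have := ht.2
      have h0 : 0 ≤ (v * a - v * t) ^ 2 := sq_nonneg _
      nlinarith
    unfold wgt
    rw [max_eq_left ht1]
    refine mul_le_mul (Real.rpow_le_rpow_of_nonpos hb0 ht.1.le ?_) ?_ (by positivity)
      (by positivity)
    · have : (0 : ℝ) ≤ d := Nat.cast_nonneg d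
      linarith
    · calc (1 + (v * a - v * t) ^ 2 / t) ^ (-wexp d)
          ≤ (1 + (v * a - v * t) ^ 2 / t) ^ (-(3 / 2) / 2 : ℝ) := by
            refine Real.rpow_le_rpow_of_exponent_le ?_ (by linarith [wexp_ge d])
            have : 0 ≤ (v * a - v * t) ^ 2 / t := by positivity
            linarith
        _ ≤ _ := Real.rpow_le_rpow_of_nonpos (by positivity) (by linarith) (by norm_num)
  · refine (setIntegral_le_integral hI (ae_of_all _ fun t => by positivity)).trans ?_
    rw [integral_const_mul]
    have h2 : ∫ t : ℝ, (1 + ‖(t - a) / σ‖ ^ 2) ^ (-(3 / 2) / 2 : ℝ) = σ * profMass := by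
      rw [integral_sub_right_eq_self (fun t : ℝ => (1 + ‖t / σ‖ ^ 2) ^ (-(3 / 2) / 2 : ℝ)) a,
        Measure.integral_comp_div (fun t : ℝ => (1 + ‖t‖ ^ 2) ^ (-(3 / 2) / 2 : ℝ)) σ,
        abs_of_pos hσ0, smul_eq_mul]
      rfl
    rw [h2]

/-- The majorant has mass of order `H`, and the window `[α, β]` carries mass of order `H`. -/
def HasWindow (d : ℕ) (CH cL H r v : ℝ) : Prop :=
  ∃ α β, ∫⁻ t in Set.Ioi 0, ENNReal.ofReal (wgt d r v t) ≤ ENNReal.ofReal (CH * H) ∧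
    1 ≤ α ∧ α ≤ β ∧ β ≤ 2 * α ∧ (∀ t ∈ Set.Icc α β, (r - v * t) ^ 2 ≤ t) ∧
    cL * H ≤ (β - α) * (2 * α) ^ (-((d : ℝ) / 2))

lemma exists_hasWindow_of_le_mul {d : ℕ} (hd : 1 ≤ d) {s : ℝ} (hs : 0 < s) :
    ∃ CH cL, 0 < CH ∧ 0 < cL ∧ ∀ a v, 0 < v → 2 ≤ a → s ≤ v ^ 2 * a →
      HasWindow d CH cL (a ^ (1 - (d : ℝ) / 2) * (v ^ 2 * a) ^ (-(1 / 2) : ℝ)) (v * a) v := by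
  have hw := wexp_ge d
  set w := wexp d with hwdef
  set q : ℝ := (d : ℝ) / 2 with hq
  have hwq : 5 / 4 ≤ w + q := wexp_add_ge hd
  refine ⟨4 * (4 : ℝ) ^ w * (1 / 2 : ℝ) ^ (w - q + 1) * s ^ (1 / 2 - w) +
      (1 / 2 : ℝ) ^ (-q) * (Real.sqrt 2 * profMass) +
      4 * (4 : ℝ) ^ w * (2 : ℝ) ^ (1 - (w + q)) * s ^ (1 / 2 - w),
    min 1 (Real.sqrt s) * (2 : ℝ) ^ (-q), ?_, by positivity, ?_⟩
  · have := profMass_nonneg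
    positivity
  intro a v hv ha hN
  have ha0 : 0 < a := by linarith
  have hN0 : 0 < v ^ 2 * a := by positivity
  obtain ⟨N, hNdef⟩ : ∃ N, N = v ^ 2 * a := ⟨_, rfl⟩
  rw [← hNdef] at hN hN0 ⊢
  have hb1 : (1 : ℝ) ≤ a / 2 := by linarith
  have hNw : N ^ (-w) ≤ s ^ (1 / 2 - w) * N ^ (-(1 / 2) : ℝ) := by
    calc N ^ (-w) = N ^ (1 / 2 - w) * N ^ (-(1 / 2) : ℝ) := by
          rw [← Real.rpow_add hN0]; congr 1; ring
      _ ≤ _ := by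
          refine mul_le_mul_of_nonneg_right ?_ (by positivity)
          exact Real.rpow_le_rpow_of_nonpos hs hN (by linarith)
  refine ⟨a, a + min 1 (Real.sqrt s) * (a / Real.sqrt N), ?_, by linarith, ?_, ?_, ?_, ?_⟩
  · have hsplit : Set.Ioi (0 : ℝ) ⊆ Set.Ioc 0 (a / 2) ∪ Set.Ioc (a / 2) (2 * a) ∪
        Set.Ioi (2 * a) := by
      intro t ht
      rcases le_or_gt t (a / 2) with h | h
      · exact Or.inl (Or.inl ⟨ht, h⟩)
      rcases le_or_gt t (2 * a) with h' | h'
      · exact Or.inl (Or.inr ⟨h, h'⟩)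
      · exact Or.inr h'
    refine (lintegral_mono_set hsplit).trans ((lintegral_union_le _ _ _).trans ?_)
    have hL := lintegral_wgt_left_le d (r := v * a) (v := v) (b := a / 2) (by positivity) hb1
      (fun t ht htb => by nlinarith)
    have hMid := lintegral_wgt_middle_le d (v := v) (b := a / 2) (a := a) hv ha0 hb1
    have hR := lintegral_rpow_Ioi_le (q := w + q) (b := 2 * a) (c := (v ^ 2 / 4) ^ (-w)) hwq
      (by positivity) (by positivity) (f := wgt d (v * a) v) (fun t ht => by
        have ht0 : 0 < t := by linarith
        have ht1 : max t 1 = t := max_eq_left (by linarith)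
        refine (wgt_le d (B := v ^ 2 / 4 * t) (by positivity) ?_).trans ?_
        · rw [ht1, le_div_iff₀ ht0]
          have : v * t / 2 ≤ v * t - v * a := by nlinarith
          nlinarith [mul_pos hv ht0]
        · rw [ht1, Real.mul_rpow (by positivity) ht0.le, mul_left_comm, ← Real.rpow_add ht0]
          apply le_of_eq; congr 2; rw [← hq, ← hwdef]; ring)
    refine (add_le_add (lintegral_union_le _ _ _) le_rfl).trans
      ((add_le_add (add_le_add hL hMid) hR).trans ?_)
    have hpm := profMass_nonneg
    rw [← ENNReal.ofReal_add (by positivity) (by positivity),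
      ← ENNReal.ofReal_add (by positivity) (by positivity)]
    refine ENNReal.ofReal_le_ofReal ?_
    rw [← hwdef, ← hq, add_mul, add_mul]
    have e1 : 4 * ((v * a / 2) ^ 2) ^ (-w) * (a / 2) ^ (w - q + 1) =
        4 * (4 : ℝ) ^ w * (1 / 2 : ℝ) ^ (w - q + 1) * (N ^ (-w) * a ^ (1 - q)) := by
      rw [show (v * a / 2) ^ 2 = N * a / 4 by rw [hNdef]; ring,
        Real.div_rpow (by positivity) (by norm_num), Real.mul_rpow hN0.le ha0.le,
        show a / 2 = 1 / 2 * a by ring, Real.mul_rpow (by norm_num) ha0.le,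
        Real.rpow_neg (by norm_num : (0 : ℝ) ≤ 4), div_inv_eq_mul,
        show a ^ (1 - q) = a ^ (-w) * a ^ (w - q + 1) by
          rw [← Real.rpow_add ha0]; congr 1; ring]
      ring
    have e3 : 4 * (v ^ 2 / 4) ^ (-w) * (2 * a) ^ (1 - (w + q)) =
        4 * (4 : ℝ) ^ w * (2 : ℝ) ^ (1 - (w + q)) * (N ^ (-w) * a ^ (1 - q)) := by
      rw [show v ^ 2 / 4 = N * a⁻¹ / 4 by rw [hNdef]; field_simp,
        Real.div_rpow (by positivity) (by norm_num), Real.mul_rpow hN0.le (by positivity),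
        Real.mul_rpow (by norm_num) ha0.le,
        Real.rpow_neg (by norm_num : (0 : ℝ) ≤ 4), div_inv_eq_mul, Real.inv_rpow ha0.le,
        Real.rpow_neg ha0.le, inv_inv,
        show a ^ (1 - q) = a ^ w * a ^ (1 - (w + q)) by
          rw [← Real.rpow_add ha0]; congr 1; ring]
      ring
    have e2 : (a / 2) ^ (-q) * (Real.sqrt (2 * a) / v * profMass) =
        (1 / 2 : ℝ) ^ (-q) * (Real.sqrt 2 * profMass) *
          (a ^ (1 - q) * N ^ (-(1 / 2) : ℝ)) := by
      rw [show a / 2 = 1 / 2 * a by ring, Real.mul_rpow (by norm_num) ha0.le,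
        Real.rpow_neg hN0.le, ← Real.sqrt_eq_rpow, hNdef, Real.sqrt_mul (sq_nonneg v),
        Real.sqrt_sq hv.le, Real.sqrt_mul (by norm_num : (0 : ℝ) ≤ 2), sub_eq_add_neg,
        Real.rpow_add ha0, Real.rpow_one]
      have h3 : Real.sqrt a ≠ 0 := by positivity
      have h4 : a = Real.sqrt a * Real.sqrt a := (Real.mul_self_sqrt ha0.le).symm
      field_simp
      rw [pow_two, ← h4, mul_comm]
    rw [e1, e2, e3]
    have hkey : N ^ (-w) * a ^ (1 - q) ≤
        s ^ (1 / 2 - w) * (a ^ (1 - q) * N ^ (-(1 / 2) : ℝ)) := by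
      have := mul_le_mul_of_nonneg_right hNw (show 0 ≤ a ^ (1 - q) by positivity)
      linarith
    refine add_le_add (add_le_add ?_ le_rfl) ?_
    · rw [mul_assoc _ (s ^ (1 / 2 - w))]
      exact mul_le_mul_of_nonneg_left hkey (by positivity)
    · rw [mul_assoc _ (s ^ (1 / 2 - w))]
      exact mul_le_mul_of_nonneg_left hkey (by positivity)
  · have : 0 ≤ min 1 (Real.sqrt s) * (a / Real.sqrt N) := by positivity
    linarith
  · have h1 : min 1 (Real.sqrt s) * (a / Real.sqrt N) ≤ a := by
      rw [mul_div_assoc', div_le_iff₀ (by positivity), mul_comm]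
      exact mul_le_mul_of_nonneg_left ((min_le_right _ _).trans (Real.sqrt_le_sqrt hN)) ha0.le
    linarith
  · rintro t ⟨ht1, ht2⟩
    have h1 : t - a ≤ a / Real.sqrt N := by
      have : min 1 (Real.sqrt s) * (a / Real.sqrt N) ≤ 1 * (a / Real.sqrt N) :=
        mul_le_mul_of_nonneg_right (min_le_left _ _) (by positivity)
      linarith
    calc (v * a - v * t) ^ 2 = v ^ 2 * (t - a) ^ 2 := by ring
      _ ≤ v ^ 2 * (a / Real.sqrt N) ^ 2 := by
          refine mul_le_mul_of_nonneg_left (pow_le_pow_left₀ (by linarith) h1 2) (by positivity)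
      _ = a := by rw [div_pow, Real.sq_sqrt hN0.le, hNdef]; field_simp
      _ ≤ t := ht1
  · rw [add_sub_cancel_left, ← hq, Real.mul_rpow (by norm_num) ha0.le, Real.rpow_neg hN0.le,
      ← Real.sqrt_eq_rpow, sub_eq_add_neg, Real.rpow_add ha0, Real.rpow_one]
    apply le_of_eq
    field_simp

lemma exists_hasWindow_of_mul_le {d : ℕ} (hd : 3 ≤ d) :
    ∃ CH cL, 0 < CH ∧ 0 < cL ∧ ∀ r v, 0 < v → 2 ≤ r → v * r ≤ 1 →
      HasWindow d CH cL (r ^ (2 - (d : ℝ))) r v := by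
  set w := wexp d with hwdef
  set q : ℝ := (d : ℝ) / 2 with hq
  have hq5 : 3 / 2 ≤ q := by
    have : (3 : ℝ) ≤ d := by exact_mod_cast hd
    linarith
  refine ⟨4 * (1 / 4 : ℝ) ^ (-w) * (1 / 2 : ℝ) ^ (w - q + 1) + 4 * (1 / 2 : ℝ) ^ (1 - q),
    (2 : ℝ) ^ (-q), by positivity, by positivity, ?_⟩
  intro r v hv hr hvr
  have hr0 : 0 < r := by linarith
  have hr2 : (4 : ℝ) ≤ r ^ 2 := by nlinarith
  have hb1 : (1 : ℝ) ≤ r ^ 2 / 2 := by linarith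
  have epow : r ^ (2 - (d : ℝ)) = (r ^ 2) ^ (1 - q) := by
    rw [← Real.rpow_natCast r 2, ← Real.rpow_mul hr0.le, hq]; congr 1; push_cast; ring
  refine ⟨r ^ 2, 2 * r ^ 2, ?_, by linarith, by linarith, le_rfl, ?_, ?_⟩
  · have hsplit : Set.Ioi (0 : ℝ) ⊆ Set.Ioc 0 (r ^ 2 / 2) ∪ Set.Ioi (r ^ 2 / 2) := by
      intro t ht
      rcases le_or_gt t (r ^ 2 / 2) with h | h
      · exact Or.inl ⟨ht, h⟩
      · exact Or.inr h
    refine (lintegral_mono_set hsplit).trans ((lintegral_union_le _ _ _).trans ?_)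
    have hL := lintegral_wgt_left_le d (r := r) (v := v) (b := r ^ 2 / 2) hr0 hb1
      (fun t ht htb => by nlinarith [mul_le_mul_of_nonneg_left htb hv.le])
    have hR := lintegral_rpow_Ioi_le (q := q) (b := r ^ 2 / 2) (c := 1) (by linarith)
      (by positivity) (by positivity) (f := wgt d r v) (fun t ht => by
        have ht0 : 0 < t := by linarith
        unfold wgt
        rw [max_eq_left (show 1 ≤ t by linarith), ← hq, one_mul]
        refine mul_le_of_le_one_right (by positivity) (Real.rpow_le_one_of_one_le_of_nonpos ?_ ?_)
        · have : 0 ≤ (r - v * t) ^ 2 / t := by positivity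
          linarith
        · linarith [wexp_ge d])
    refine (add_le_add hL hR).trans ?_
    rw [← ENNReal.ofReal_add (by positivity) (by positivity)]
    refine ENNReal.ofReal_le_ofReal (le_of_eq ?_)
    have hR2 : 0 < r ^ 2 := by positivity
    rw [← hwdef, ← hq, epow, show (r / 2) ^ 2 = 1 / 4 * r ^ 2 by ring,
      show r ^ 2 / 2 = 1 / 2 * r ^ 2 by ring, Real.mul_rpow (by norm_num) hR2.le,
      Real.mul_rpow (by norm_num) hR2.le, Real.mul_rpow (by norm_num) hR2.le, add_mul,
      show (r ^ 2) ^ (1 - q) = (r ^ 2) ^ (-w) * (r ^ 2) ^ (w - q + 1) by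
        rw [← Real.rpow_add hR2]; congr 1; ring]
    ring
  · rintro t ⟨ht1, ht2⟩
    have h1 : v * t ≤ 2 * r := by nlinarith [mul_le_mul_of_nonneg_left ht2 hv.le]
    have h0 : 0 ≤ v * t := mul_nonneg hv.le (by linarith)
    nlinarith
  · rw [epow, ← hq, Real.mul_rpow (by norm_num) (sq_nonneg r), sub_eq_add_neg,
      Real.rpow_add (show 0 < r ^ 2 by positivity), Real.rpow_one]
    apply le_of_eq
    ring

end WindowIntegrals

section WindowComparison

lemma exists_rpow_neg_mul_le {p B ε : ℝ} (hp : 0 < p) (hε : 0 < ε) (T : ℝ) :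
    ∃ A, T ≤ A ∧ 1 ≤ A ∧ B * A ^ (-p) ≤ ε := by
  have h := (tendsto_rpow_neg_atTop hp).const_mul B
  rw [mul_zero] at h
  obtain ⟨A, h1, h2, h3⟩ := ((eventually_ge_atTop T).and
    ((eventually_ge_atTop 1).and (h.eventually_lt_const hε))).exists
  exact ⟨A, h1, h2, h3.le⟩

lemma integrableOn_wgt_of_lintegral_le {d : ℕ} {r v B : ℝ} (hB : 0 ≤ B)
    (h : ∫⁻ t in Set.Ioi 0, ENNReal.ofReal (wgt d r v t) ≤ ENNReal.ofReal B) :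
    IntegrableOn (wgt d r v) (Set.Ioi 0) ∧ ∫ t in Set.Ioi 0, wgt d r v t ≤ B := by
  have hm : AEStronglyMeasurable (wgt d r v) (volume.restrict (Set.Ioi 0)) :=
    (continuous_wgt d r v).aestronglyMeasurable
  have h0 : 0 ≤ᵐ[volume.restrict (Set.Ioi 0)] wgt d r v := ae_of_all _ fun t => wgt_nonneg d r v t
  refine ⟨⟨hm, ?_⟩, ?_⟩
  · rw [hasFiniteIntegral_iff_ofReal h0]
    exact h.trans_lt ENNReal.ofReal_lt_top
  · rw [integral_eq_lintegral_of_nonneg_ae h0 hm]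
    exact ENNReal.toReal_le_of_le_ofReal hB h

lemma mul_rpow_neg_le_wgt {d : ℕ} {r v t y q : ℝ} (hq : q = (d : ℝ) / 2)
    (hy : y = (r - v * t) ^ 2 / max t 1) (hy1 : 1 ≤ y) :
    max t 1 ^ (-q) * y ^ (-wexp d) ≤ (2 : ℝ) ^ wexp d * wgt d r v t := by
  have hw := wexp_ge d
  have h1 : (2 * y) ^ (-wexp d) ≤ (1 + y) ^ (-wexp d) :=
    Real.rpow_le_rpow_of_nonpos (by linarith) (by linarith) (by linarith)
  rw [Real.mul_rpow (by norm_num) (by linarith), Real.rpow_neg (by norm_num),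
    inv_mul_le_iff₀ (by positivity)] at h1
  unfold wgt
  rw [← hy, ← hq]
  calc max t 1 ^ (-q) * y ^ (-wexp d)
      ≤ max t 1 ^ (-q) * ((2 : ℝ) ^ wexp d * (1 + y) ^ (-wexp d)) := by gcongr
    _ = _ := by ring

lemma rpow_neg_le_wgt {d : ℕ} {r v t y A q : ℝ} (hq : q = (d : ℝ) / 2)
    (hy : y = (r - v * t) ^ 2 / max t 1) (hyA : y ≤ A) :
    max t 1 ^ (-q) ≤ (1 + A) ^ wexp d * wgt d r v t := by
  have hw := wexp_ge d
  have hy0 : 0 ≤ y := by rw [hy]; positivity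
  have h1 : (1 + A) ^ (-wexp d) ≤ (1 + y) ^ (-wexp d) :=
    Real.rpow_le_rpow_of_nonpos (by linarith) (by linarith) (by linarith)
  have hA : 0 < (1 + A) ^ wexp d := Real.rpow_pos_of_pos (by linarith) _
  rw [Real.rpow_neg (by linarith), inv_le_iff_one_le_mul₀ hA] at h1
  unfold wgt
  rw [← hy, ← hq]
  have := mul_le_mul_of_nonneg_left h1 (show 0 ≤ max t 1 ^ (-q) by positivity)
  linarith

lemma exists_integral_comparison (d : ℕ) {A0 C1 C2 c4 ζ CH cL V : ℝ} (hA0 : 1 ≤ A0)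
    (hC1 : 0 < C1) (hC2 : 0 < C2) (hc4 : 0 < c4) (hζ : 0 < ζ) (hCH : 0 < CH) (hcL : 0 < cL)
    (hV : 0 < V) :
    ∃ R c C, 0 < R ∧ 0 < c ∧ 0 < C ∧ ∀ r v H, R ≤ r → 0 < v → v ≤ V → 0 ≤ H →
      ∀ f : ℝ → ℝ, IntegrableOn f (Set.Ioi 0) →
      (∀ t, 0 < t → A0 * max t 1 ≤ (r - v * t) ^ 2 →
        |f t| ≤ C1 * max t 1 ^ (-((d : ℝ) / 2)) * (max t 1 / (r - v * t) ^ 2) ^ aExp d) →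
      (∀ t, 0 < t → |f t| ≤ C1 * max t 1 ^ (-((d : ℝ) / 2))) →
      (∀ t, 1 ≤ t → ∃ G, 0 ≤ G ∧ ((r - v * t) ^ 2 ≤ t → c4 * t ^ (-((d : ℝ) / 2)) ≤ G) ∧
        |f t - G| ≤ C2 * t ^ (-((d : ℝ) / 2) - ζ / 2)) →
      HasWindow d CH cL H r v →
      c * H ≤ ∫ t in Set.Ioi 0, f t ∧ ∫ t in Set.Ioi 0, f t ≤ C * H := by
  have hw := wexp_ge d
  set w := wexp d with hwdef
  obtain ⟨q, hq⟩ : ∃ q : ℝ, q = (d : ℝ) / 2 := ⟨_, rfl⟩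
  have hq0 : 0 ≤ q := by rw [hq]; positivity
  simp only [← hq]
  set ε := c4 * cL / (2 * CH) with hε
  have hε0 : 0 < ε := by positivity
  obtain ⟨A, hAA0, hA1, hA⟩ := exists_rpow_neg_mul_le (p := 1 / 4) (B := C1 * 2 ^ w) (by norm_num)
    hε0 A0
  obtain ⟨T, hT2, hT1, hT⟩ := exists_rpow_neg_mul_le (p := ζ / 2) (B := C2 * (1 + A) ^ w)
    (by linarith) hε0 2
  refine ⟨V * T + A * T + 1, c4 * cL / 2, C1 * ((2 : ℝ) ^ w + (1 + A) ^ w) * CH, by positivity,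
    by positivity, by positivity, ?_⟩
  rintro r v H hr hv hvV hH f hf h1 h2 h3 ⟨α, β, hI, hα, hαβ, hβ, hwin, hL⟩
  obtain ⟨hwi, hwI⟩ := integrableOn_wgt_of_lintegral_le (by positivity) hI
  have hτ : ∀ t : ℝ, 0 < max t 1 := fun t => lt_max_of_lt_right one_pos
  have hfar : ∀ t, 0 < t → ∀ y, y = (r - v * t) ^ 2 / max t 1 → A ≤ y →
      |f t| ≤ C1 * (2 : ℝ) ^ w * y ^ (-(1 / 4) : ℝ) * wgt d r v t := by
    intro t ht y hy hAy
    have hy0 : 0 < y := by linarith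
    have hle : A0 * max t 1 ≤ (r - v * t) ^ 2 := by
      rw [← le_div_iff₀ (hτ t), ← hy]; linarith
    calc |f t| ≤ C1 * max t 1 ^ (-q) * (max t 1 / (r - v * t) ^ 2) ^ aExp d := h1 t ht hle
      _ = C1 * y ^ (-(1 / 4) : ℝ) * (max t 1 ^ (-q) * y ^ (-w)) := by
          have : (max t 1 / (r - v * t) ^ 2) ^ aExp d = y ^ (-(1 / 4) : ℝ) * y ^ (-w) := by
            rw [← Real.rpow_add hy0, ← inv_div, ← hy, Real.inv_rpow hy0.le, ← Real.rpow_neg hy0.le,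
              hwdef, wexp]
            congr 1; ring
          rw [this]; ring
      _ ≤ C1 * y ^ (-(1 / 4) : ℝ) * ((2 : ℝ) ^ w * wgt d r v t) :=
          mul_le_mul_of_nonneg_left (mul_rpow_neg_le_wgt hq hy (by linarith)) (by positivity)
      _ = _ := by ring
  have hnear : ∀ t, ∀ y, y = (r - v * t) ^ 2 / max t 1 → y ≤ A →
      max t 1 ^ (-q) ≤ (1 + A) ^ w * wgt d r v t := fun t y hy hyA => rpow_neg_le_wgt hq hy hyA
  have hup : ∀ t, 0 < t → f t ≤ C1 * ((2 : ℝ) ^ w + (1 + A) ^ w) * wgt d r v t := by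
    intro t ht
    have hw0 := wgt_nonneg d r v t
    refine (le_abs_self _).trans ?_
    rcases le_total A ((r - v * t) ^ 2 / max t 1) with hy | hy
    · refine (hfar t ht _ rfl hy).trans (mul_le_mul_of_nonneg_right ?_ hw0)
      rw [mul_assoc]
      refine mul_le_mul_of_nonneg_left ?_ hC1.le
      have : ((r - v * t) ^ 2 / max t 1) ^ (-(1 / 4) : ℝ) ≤ 1 :=
        Real.rpow_le_one_of_one_le_of_nonpos (by linarith) (by norm_num)
      have h2w : (0 : ℝ) < 2 ^ w := by positivity
      have hAw : 0 < (1 + A) ^ w := by positivity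
      nlinarith
    · refine (h2 t ht).trans ?_
      rw [mul_assoc]
      refine mul_le_mul_of_nonneg_left ((hnear t _ rfl hy).trans ?_) hC1.le
      refine mul_le_mul_of_nonneg_right ?_ hw0
      have h2w : (0 : ℝ) < 2 ^ w := by positivity
      linarith
  have hlow : ∀ t, 0 < t → (Set.Icc α β).indicator (fun _ => c4 * (2 * α) ^ (-q)) t -
      ε * wgt d r v t ≤ f t := by
    intro t ht
    have hw0 := wgt_nonneg d r v t
    rcases lt_or_ge A ((r - v * t) ^ 2 / max t 1) with hy | hy
    · rw [Set.indicator_of_notMem]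
      · have h4 := hfar t ht _ rfl hy.le
        have h5 : C1 * 2 ^ w * ((r - v * t) ^ 2 / max t 1) ^ (-(1 / 4) : ℝ) ≤ ε := by
          refine le_trans (mul_le_mul_of_nonneg_left ?_ (by positivity)) hA
          exact Real.rpow_le_rpow_of_nonpos (by linarith) hy.le (by norm_num)
        have h6 := mul_le_mul_of_nonneg_right h5 hw0
        have := neg_abs_le (f t)
        linarith
      · intro hmem
        have h7 := hwin t hmem
        have ht1 : 1 ≤ t := hα.trans hmem.1
        rw [max_eq_left ht1, lt_div_iff₀ ht] at hy
        nlinarith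
    · have hTt : T ≤ t := by
        by_contra hlt
        push Not at hlt
        have hmT : max t 1 ≤ T := max_le hlt.le hT1
        have h8 : (r - v * t) ^ 2 ≤ A * T := by
          rw [div_le_iff₀ (hτ t)] at hy
          nlinarith
        have h9 : r - v * t ≤ A * T := by
          have : 1 ≤ A * T := by nlinarith
          nlinarith
        have h10 : v * t ≤ V * T := mul_le_mul hvV hlt.le ht.le hV.le
        linarith
      have ht1 : 1 ≤ t := hT1.trans hTt
      obtain ⟨G, hG0, hGl, hGe⟩ := h3 t ht1
      have herr : C2 * t ^ (-q - ζ / 2) ≤ ε * wgt d r v t := by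
        have h11 := hnear t _ rfl hy
        rw [max_eq_left ht1] at h11
        have h12 : t ^ (-(ζ / 2)) ≤ T ^ (-(ζ / 2)) :=
          Real.rpow_le_rpow_of_nonpos (by linarith) hTt (by linarith)
        rw [sub_eq_add_neg, Real.rpow_add ht]
        calc C2 * (t ^ (-q) * t ^ (-(ζ / 2)))
            ≤ C2 * (((1 + A) ^ w * wgt d r v t) * T ^ (-(ζ / 2))) := by gcongr
          _ = (C2 * (1 + A) ^ w * T ^ (-(ζ / 2))) * wgt d r v t := by ring
          _ ≤ _ := mul_le_mul_of_nonneg_right hT hw0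
      have hind : (Set.Icc α β).indicator (fun _ => c4 * (2 * α) ^ (-q)) t ≤ G := by
        by_cases hmem : t ∈ Set.Icc α β
        · rw [Set.indicator_of_mem hmem]
          refine le_trans (mul_le_mul_of_nonneg_left ?_ hc4.le) (hGl (hwin t hmem))
          exact Real.rpow_le_rpow_of_nonpos ht (hmem.2.trans hβ) (by linarith)
        · rwa [Set.indicator_of_notMem hmem]
      have := (abs_le.1 hGe).1
      linarith
  constructor
  · have hii : IntegrableOn ((Set.Icc α β).indicator fun _ : ℝ => c4 * (2 * α) ^ (-q))
        (Set.Ioi 0) :=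
      ((integrable_indicator_iff measurableSet_Icc).2
        continuous_const.integrableOn_Icc).integrableOn
    have h13 := setIntegral_mono_on (hii.sub (hwi.const_mul ε)) hf measurableSet_Ioi
      fun t ht => hlow t ht
    refine le_trans ?_ h13
    have h14 : Set.Ioi 0 ∩ Set.Icc α β = Set.Icc α β :=
      Set.inter_eq_right.2 fun t ht => lt_of_lt_of_le (by linarith) ht.1
    simp only [Pi.sub_apply]
    rw [integral_sub hii (hwi.const_mul ε), integral_const_mul,
      setIntegral_indicator measurableSet_Icc, h14, setIntegral_const, smul_eq_mul,
      Measure.real, Real.volume_Icc, ENNReal.toReal_ofReal (by linarith)]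
    rw [← hq] at hL
    have h15 : ε * ∫ t in Set.Ioi 0, wgt d r v t ≤ ε * (CH * H) :=
      mul_le_mul_of_nonneg_left hwI hε0.le
    have h16 : ε * (CH * H) = c4 * cL / 2 * H := by rw [hε]; field_simp
    have h17 := mul_le_mul_of_nonneg_left hL hc4.le
    linarith
  · have hc : 0 ≤ C1 * ((2 : ℝ) ^ w + (1 + A) ^ w) := by positivity
    refine (setIntegral_mono_on hf (hwi.const_mul _) measurableSet_Ioi hup).trans ?_
    rw [integral_const_mul, mul_assoc _ CH]
    exact mul_le_mul_of_nonneg_left hwI hc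

end WindowComparison

section OmegaGeometry

variable {S : (Fin d → ℤ) → ℝ}

lemma chi_lt_top_iff (hS : ∀ x, 0 ≤ S x) (μ : Fin d → ℝ) :
    chi S μ < ⊤ ↔ Summable (tilt S μ) := by
  have h0 : ∀ x, 0 ≤ S x * Real.exp (rdotZ μ x) := fun x => mul_nonneg (hS x) (Real.exp_pos _).le
  refine ⟨fun h => ?_, fun h => lt_top_iff_ne_top.2 h.tsum_ofReal_ne_top⟩
  have := ENNReal.summable_toReal h.ne
  simp only [ENNReal.toReal_ofReal (h0 _)] at this
  exact this

lemma mem_Omega_iff (hS : ∀ x, 0 ≤ S x) {μ : Fin d → ℝ} :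
    μ ∈ Omega S ↔ Summable (tilt S μ) := chi_lt_top_iff hS μ

lemma convex_Omega (hS : ∀ x, 0 ≤ S x) : Convex ℝ (Omega S) := by
  intro μ hμ ν hν a b ha hb hab
  rw [mem_Omega_iff hS] at *
  refine Summable.of_nonneg_of_le (fun x => mul_nonneg (hS x) (Real.exp_pos _).le) (fun x => ?_)
    ((hμ.mul_left a).add (hν.mul_left b))
  have h1 := convexOn_exp.2 (Set.mem_univ (rdotZ μ x)) (Set.mem_univ (rdotZ ν x)) ha hb hab
  simp only [smul_eq_mul] at h1
  rw [tilt, rdotZ_add_left, rdotZ_smul, rdotZ_smul]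
  have := mul_le_mul_of_nonneg_left h1 (hS x)
  simp only [tilt]
  linarith

lemma mem_Omega_flip (hS : ∀ x, 0 ≤ S x) (hs : ZdSymmetric S) (ε : Fin d → Bool) {μ : Fin d → ℝ}
    (hμ : μ ∈ Omega S) : (fun i => if ε i then -μ i else μ i) ∈ Omega S := by
  rw [mem_Omega_iff hS] at *
  have hinv : Function.Involutive fun (x : Fin d → ℤ) i => if ε i then -(x i) else x i := by
    intro x
    funext i
    by_cases h : ε i <;> simp [h]
  refine ((Equiv.summable_iff hinv.toPerm).2 hμ).congr fun x => ?_
  simp only [Function.comp, Function.Involutive.coe_toPerm, tilt, hs.2 ε x]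
  congr 2
  refine Finset.sum_congr rfl fun i _ => ?_
  by_cases h : ε i <;> simp [h]

lemma mem_Omega_perm (hS : ∀ x, 0 ≤ S x) (hs : ZdSymmetric S) (σ : Equiv.Perm (Fin d))
    {μ : Fin d → ℝ} (hμ : μ ∈ Omega S) : (fun i => μ (σ i)) ∈ Omega S := by
  rw [mem_Omega_iff hS] at *
  refine ((Equiv.summable_iff (σ.arrowCongr (Equiv.refl ℤ))).2 hμ).congr fun x => ?_
  have h1 : (σ.arrowCongr (Equiv.refl ℤ)) x = fun i => x (σ.symm i) := rfl
  simp only [Function.comp, h1, tilt, hs.1 σ.symm x]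
  congr 2
  refine Fintype.sum_equiv σ.symm _ _ fun i => ?_
  simp

lemma single_mem_Omega (hS : ∀ x, 0 ≤ S x) (hs : ZdSymmetric S) {μ : Fin d → ℝ}
    (hμ : μ ∈ Omega S) (j : Fin d) : Pi.single j (μ j) ∈ Omega S := by
  have h := convex_Omega hS hμ (mem_Omega_flip hS hs (fun i => decide (i ≠ j)) hμ)
    (show (0 : ℝ) ≤ 1 / 2 by norm_num) (show (0 : ℝ) ≤ 1 / 2 by norm_num) (by norm_num)
  convert h using 1
  funext i
  by_cases hij : i = j
  · subst hij
    simp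
    ring
  · simp [hij]

lemma single_neg_mem_Omega (hS : ∀ x, 0 ≤ S x) (hs : ZdSymmetric S) {j : Fin d} {t : ℝ}
    (h : Pi.single j t ∈ Omega S) : Pi.single j (-t) ∈ Omega S := by
  convert mem_Omega_flip hS hs (fun _ => true) h using 1
  funext i
  by_cases hij : i = j
  · subst hij; simp
  · simp [hij]

lemma single_abs_mem_Omega (hS : ∀ x, 0 ≤ S x) (hs : ZdSymmetric S) {j : Fin d} {t : ℝ} :
    Pi.single j |t| ∈ Omega S ↔ Pi.single j t ∈ Omega S := by
  rcases abs_choice t with h | h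
  · rw [h]
  · rw [h]
    exact ⟨fun h' => by simpa using single_neg_mem_Omega hS hs h', single_neg_mem_Omega hS hs⟩

lemma single_swap_mem_Omega (hS : ∀ x, 0 ≤ S x) (hs : ZdSymmetric S) {i : Fin d} {t : ℝ}
    (h : Pi.single i t ∈ Omega S) (j : Fin d) : Pi.single j t ∈ Omega S := by
  convert mem_Omega_perm hS hs (Equiv.swap i j) h using 1
  funext l
  by_cases hlj : l = j
  · subst hlj; simp
  · rw [Pi.single_eq_of_ne hlj, Pi.single_eq_of_ne]
    intro h'
    exact hlj (by rw [Equiv.swap_apply_eq_iff] at h'; simpa using h')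

lemma e1R_eq_single (hd : 1 ≤ d) (t : ℝ) : e1R d t = Pi.single ⟨0, hd⟩ t := by
  funext i
  by_cases h : (i : ℕ) = 0
  · have : i = ⟨0, hd⟩ := Fin.ext h
    subst this
    simp [e1R]
  · have : i ≠ ⟨0, hd⟩ := fun h' => h (by rw [h'])
    simp [e1R, h, this]

lemma AssumptionOmega.bddAbove (hΩ : AssumptionOmega S) :
    BddAbove {t : ℝ | 0 ≤ t ∧ chi S (e1R d t) < ⊤} := by
  obtain ⟨μ₁, h0, h1⟩ := hΩ.exists_not_mem
  refine ⟨μ₁, fun t ht => ?_⟩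
  by_contra hlt
  push Not at hlt
  refine h1 ?_
  have ht0 : 0 < t := h0.trans hlt
  have hc := convex_Omega hΩ.nonneg (show e1R d t ∈ Omega S from ht.2) hΩ.zero_mem
    (show 0 ≤ μ₁ / t by positivity) (show 0 ≤ 1 - μ₁ / t by
      rw [sub_nonneg, div_le_one ht0]; exact hlt.le) (by ring)
  convert hc using 1
  funext i
  simp only [e1R, Pi.add_apply, Pi.smul_apply, smul_eq_mul, Pi.zero_apply, mul_zero, add_zero]
  split_ifs
  · field_simp
  · simp

lemma AssumptionOmega.abs_apply_le_mass (hΩ : AssumptionOmega S) {μ : Fin d → ℝ} (hd : 1 ≤ d)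
    (hμ : μ ∈ Omega S) (j : Fin d) : |μ j| ≤ mass S := by
  refine le_csSup hΩ.bddAbove ⟨abs_nonneg _, ?_⟩
  have h1 := single_mem_Omega hΩ.nonneg hΩ.symm hμ j
  have h2 := single_swap_mem_Omega hΩ.nonneg hΩ.symm h1 ⟨0, hd⟩
  rw [← single_abs_mem_Omega hΩ.nonneg hΩ.symm, ← e1R_eq_single hd] at h2
  exact h2

lemma AssumptionOmega.abs_apply_le_mass_of_mem_closure (hΩ : AssumptionOmega S) {μ : Fin d → ℝ}
    (hd : 1 ≤ d) (hμ : μ ∈ closure (Omega S)) (j : Fin d) : |μ j| ≤ mass S := by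
  have hcl : IsClosed {μ : Fin d → ℝ | |μ j| ≤ mass S} :=
    isClosed_le (by fun_prop) continuous_const
  exact closure_minimal (fun ν hν => hΩ.abs_apply_le_mass hd hν j) hcl hμ

lemma AssumptionOmega.single_mem_of_lt_mass (hΩ : AssumptionOmega S) {t : ℝ} (hd : 1 ≤ d)
    (h0 : 0 ≤ t) (ht : t < mass S) (j : Fin d) : Pi.single j t ∈ Omega S := by
  have hne : {t : ℝ | 0 ≤ t ∧ chi S (e1R d t) < ⊤}.Nonempty := by
    refine ⟨0, le_rfl, ?_⟩
    rw [e1R_eq_single hd, Pi.single_zero]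
    exact hΩ.zero_mem
  obtain ⟨s, ⟨hs0, hs⟩, hts⟩ := exists_lt_of_lt_csSup hne ht
  refine single_swap_mem_Omega hΩ.nonneg hΩ.symm (i := ⟨0, hd⟩) ?_ j
  have hs1 : 0 < s := h0.trans_lt hts
  have hc := convex_Omega hΩ.nonneg (show e1R d s ∈ Omega S from hs) hΩ.zero_mem
    (show 0 ≤ t / s by positivity) (show 0 ≤ 1 - t / s by
      rw [sub_nonneg, div_le_one hs1]; exact hts.le) (by ring)
  rw [e1R_eq_single hd, smul_zero, add_zero, ← Pi.single_smul, smul_eq_mul,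
    div_mul_cancel₀ _ hs1.ne'] at hc
  exact hc

lemma AssumptionOmega.mass_pos (hΩ : AssumptionOmega S) (hd : 1 ≤ d) : 0 < mass S := by
  have hcont : Tendsto (fun t : ℝ => e1R d t) (𝓝 0) (𝓝 0) := by
    have : Continuous fun t : ℝ => e1R d t := by
      refine continuous_pi fun i => ?_
      unfold e1R
      split_ifs
      · exact continuous_id
      · exact continuous_const
    convert this.tendsto 0
    rw [e1R_eq_single hd, Pi.single_zero]
  have hev := hcont.eventually (hΩ.open_Omega.mem_nhds hΩ.zero_mem)
  obtain ⟨t, ht, ht0⟩ := ((hev.filter_mono nhdsWithin_le_nhds).and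
    (self_mem_nhdsWithin : Set.Ioi (0 : ℝ) ∈ 𝓝[>] 0)).exists
  exact lt_of_lt_of_le ht0 (le_csSup hΩ.bddAbove ⟨le_of_lt ht0, ht⟩)

lemma AssumptionOmega.isCompact_closure (hΩ : AssumptionOmega S) (hd : 1 ≤ d) :
    IsCompact (closure (Omega S)) := by
  refine Metric.isCompact_of_isClosed_isBounded isClosed_closure ?_
  refine (Metric.isBounded_closedBall (x := (0 : Fin d → ℝ)) (r := mass S)).subset fun μ hμ => ?_
  rw [mem_closedBall_zero_iff, pi_norm_le_iff_of_nonneg (hΩ.mass_pos hd).le]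
  exact fun i => hΩ.abs_apply_le_mass_of_mem_closure hd hμ i

lemma AssumptionOmega.exists_isOptTilt (hΩ : AssumptionOmega S) (hd : 1 ≤ d) {x : Fin d → ℝ}
    (hx : x ≠ 0) :
    ∃ μ, IsOptTilt S x μ := by
  obtain ⟨μ, hμ, hmax⟩ := (hΩ.isCompact_closure hd).exists_isMaxOn
    ⟨0, subset_closure hΩ.zero_mem⟩ (f := fun ν => rdot ν x)
    ((continuous_finsetSum _ fun i _ => by fun_prop).continuousOn)
  refine ⟨μ, ?_, hmax⟩
  rw [hΩ.open_Omega.frontier_eq]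
  refine ⟨hμ, fun hmem => ?_⟩
  have hcont : Tendsto (fun t : ℝ => μ + t • x) (𝓝 0) (𝓝 μ) := by
    have : Continuous fun t : ℝ => μ + t • x := by fun_prop
    convert this.tendsto 0
    simp
  have hev := hcont.eventually (hΩ.open_Omega.mem_nhds hmem)
  obtain ⟨t, ht, ht0⟩ := ((hev.filter_mono nhdsWithin_le_nhds).and
    (self_mem_nhdsWithin : Set.Ioi (0 : ℝ) ∈ 𝓝[>] 0)).exists
  have h1 : rdot (μ + t • x) x ≤ rdot μ x := hmax (subset_closure ht)
  rw [rdot_add_left, rdot_smul_left, rdot_self] at h1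
  have h2 : 0 < enormR x := by
    rw [enormR_eq_norm, norm_pos_iff]
    exact fun h => hx (by simpa using h)
  have ht0' : 0 < t := ht0
  have : 0 < t * enormR x ^ 2 := by positivity
  linarith

lemma AssumptionOmega.mass_mul_normS (hΩ : AssumptionOmega S) (hd : 1 ≤ d) {x μ : Fin d → ℝ}
    (hμ : IsOptTilt S x μ) :
    mass S * normS S x = rdot μ x := by
  have h : IsGreatest ((fun μ => rdot μ x) '' closure (Omega S)) (rdot μ x) :=
    ⟨⟨μ, frontier_subset_closure hμ.1, rfl⟩, by rintro _ ⟨ν, hν, rfl⟩; exact hμ.2 ν hν⟩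
  rw [normS, h.csSup_eq, mul_div_cancel₀ _ (hΩ.mass_pos hd).ne']

lemma AssumptionOmega.mass_mul_abs_apply_le (hΩ : AssumptionOmega S) (hd : 1 ≤ d) {x μ : Fin d → ℝ}
    (hμ : IsOptTilt S x μ) (j : Fin d) : mass S * |x j| ≤ rdot μ x := by
  have hkey : ∀ t, 0 ≤ t → t < mass S → t * |x j| ≤ rdot μ x := by
    intro t h0 ht
    have h1 := hΩ.single_mem_of_lt_mass hd h0 ht j
    have hr : ∀ s : ℝ, rdot (Pi.single j s) x = s * x j := fun s => by
      simp [rdot, Pi.single_apply]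
    rcases abs_choice (x j) with h | h
    · have := hμ.2 _ (subset_closure h1)
      rwa [hr, ← h] at this
    · have := hμ.2 _ (subset_closure (single_neg_mem_Omega hΩ.nonneg hΩ.symm h1))
      rw [hr] at this
      rw [h]; linarith
  have hm := hΩ.mass_pos hd
  by_contra hlt
  push Not at hlt
  have hx0 : 0 < |x j| := by
    by_contra h0
    have h00 : |x j| = 0 := le_antisymm (not_lt.1 h0) (abs_nonneg _)
    have := hkey 0 le_rfl hm
    rw [h00] at hlt
    linarith
  rw [← div_lt_iff₀ hx0] at hlt
  obtain ⟨t, ht1, ht2⟩ := exists_between (max_lt hlt hm)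
  have := hkey t ((le_max_right _ _).trans ht1.le) ht2
  rw [← le_div_iff₀ hx0] at this
  exact absurd ((le_max_left _ _).trans_lt ht1) (not_lt.2 this)

lemma enormR_le_sum_abs (x : Fin d → ℝ) : enormR x ≤ ∑ i, |x i| := by
  refine Real.sqrt_le_iff.2 ⟨Finset.sum_nonneg fun i _ => abs_nonneg _, ?_⟩
  calc ∑ i, x i ^ 2 = ∑ i, |x i| ^ 2 := by simp
    _ ≤ _ := Finset.sum_sq_le_sq_sum_of_nonneg fun i _ => abs_nonneg _

lemma AssumptionOmega.mass_mul_enormR_le (hΩ : AssumptionOmega S) (hd : 1 ≤ d) {x μ : Fin d → ℝ}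
    (hμ : IsOptTilt S x μ) : mass S * enormR x ≤ d * rdot μ x := by
  calc mass S * enormR x ≤ mass S * ∑ i, |x i| :=
        mul_le_mul_of_nonneg_left (enormR_le_sum_abs x) (hΩ.mass_pos hd).le
    _ = ∑ i, mass S * |x i| := by rw [Finset.mul_sum]
    _ ≤ ∑ _i : Fin d, rdot μ x := Finset.sum_le_sum fun j _ => hΩ.mass_mul_abs_apply_le hd hμ j
    _ = d * rdot μ x := by simp

lemma AssumptionOmega.enormR_le_mass (hΩ : AssumptionOmega S) (hd : 1 ≤ d) {μ : Fin d → ℝ}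
    (hμ : μ ∈ closure (Omega S)) : enormR μ ≤ d * mass S := by
  refine (enormR_le_sum_abs μ).trans ?_
  calc ∑ i, |μ i| ≤ ∑ _i : Fin d, mass S :=
        Finset.sum_le_sum fun j _ => hΩ.abs_apply_le_mass_of_mem_closure hd hμ j
    _ = _ := by simp

end OmegaGeometry

section TiltedKernels

variable {S J h : (Fin d → ℤ) → ℝ} {M K ζ : ℝ}

lemma exp_mul_le_one_add_exp {s : ℝ} (h0 : 0 ≤ s) (h1 : s ≤ 1) (a : ℝ) :
    Real.exp (s * a) ≤ 1 + Real.exp a := by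
  have h := convexOn_exp.2 (Set.mem_univ (0 : ℝ)) (Set.mem_univ a) (sub_nonneg.2 h1) h0 (by ring)
  simp only [smul_eq_mul, mul_zero, zero_add, Real.exp_zero, mul_one] at h
  nlinarith [Real.exp_pos a]

lemma tilt_smul (f : (Fin d → ℤ) → ℝ) (s : ℝ) (μ : Fin d → ℝ) (y : Fin d → ℤ) :
    tilt f (s • μ) y = f y * Real.exp (s * rdotZ μ y) := by rw [tilt, rdotZ_smul]

lemma tilt_zero (f : (Fin d → ℤ) → ℝ) : tilt f 0 = f := by
  funext y
  simp [tilt, rdotZ]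

lemma abs_tilt (f : (Fin d → ℤ) → ℝ) (μ : Fin d → ℝ) (y : Fin d → ℤ) :
    |tilt f μ y| = |f y| * Real.exp (rdotZ μ y) := by
  rw [tilt, abs_mul, Real.abs_exp]

lemma tiltSum_eq (f : (Fin d → ℤ) → ℝ) (μ : Fin d → ℝ) : tiltSum f μ = ∑' y, tilt f μ y := rfl

lemma continuousOn_tsum_tilt {E : Type*} [NormedAddCommGroup E] [NormedSpace ℝ E]
    [CompleteSpace E] {f : (Fin d → ℤ) → E} {μ : Fin d → ℝ} (h0 : Summable fun y => ‖f y‖)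
    (h1 : Summable fun y => ‖f y‖ * Real.exp (rdotZ μ y)) :
    ContinuousOn (fun s : ℝ => ∑' y, Real.exp (s * rdotZ μ y) • f y) (Set.Icc 0 1) := by
  refine continuousOn_tsum (u := fun y => ‖f y‖ + ‖f y‖ * Real.exp (rdotZ μ y))
    (fun y => by fun_prop) (h0.add h1) fun y s hs => ?_
  rw [norm_smul, Real.norm_eq_abs, Real.abs_exp, mul_comm]
  calc ‖f y‖ * Real.exp (s * rdotZ μ y) ≤ ‖f y‖ * (1 + Real.exp (rdotZ μ y)) :=
        mul_le_mul_of_nonneg_left (exp_mul_le_one_add_exp hs.1 hs.2 _) (norm_nonneg _)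
    _ = _ := by ring

lemma continuousOn_tsum_tilt_real {f : (Fin d → ℤ) → ℝ} {μ : Fin d → ℝ}
    (h0 : Summable fun y => |f y|) (h1 : Summable fun y => |tilt f μ y|) :
    ContinuousOn (fun s : ℝ => ∑' y, tilt f (s • μ) y) (Set.Icc 0 1) := by
  have h2 : Summable fun y => ‖f y‖ * Real.exp (rdotZ μ y) := by
    simpa only [abs_tilt, Real.norm_eq_abs] using h1
  have h3 := continuousOn_tsum_tilt (E := ℝ) (f := f) h0 h2
  simp only [smul_eq_mul] at h3
  refine h3.congr fun s _ => tsum_congr fun y => ?_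
  rw [tilt_smul, mul_comm]

lemma continuousOn_hatf_tilt {f : (Fin d → ℤ) → ℝ} {μ : Fin d → ℝ}
    (h0 : Summable fun y => |f y|) (h1 : Summable fun y => |tilt f μ y|) :
    ContinuousOn (fun s : ℝ => hatf (tilt f (s • μ))) (Set.Icc 0 1) := by
  simp only [abs_tilt] at h1
  have hn : ∀ y, ‖(f y : ℂ) • UnitAddTorus.mFourier (d := Fin d) y‖ = |f y| := fun y => by
    rw [norm_smul, UnitAddTorus.mFourier_norm, mul_one, Complex.norm_real, Real.norm_eq_abs]
  refine (continuousOn_tsum_tilt (f := fun y => (f y : ℂ) • UnitAddTorus.mFourier y) (μ := μ)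
    (by simpa only [hn] using h0) (by simpa only [hn] using h1)).congr fun s _ => ?_
  refine tsum_congr fun y => ?_
  rw [tilt_smul, ← Complex.coe_smul, smul_smul, ← Complex.ofReal_mul, mul_comm]

lemma hatf_kap_zero {f : (Fin d → ℤ) → ℝ} (hf : Summable fun y => |f y|) :
    hatf f (kap 0) = ((∑' y, f y : ℝ) : ℂ) := by
  have h1 := hasSum_hatf_apply hf (kap 0)
  have h2 : ∀ y : Fin d → ℤ, UnitAddTorus.mFourier y (kap (0 : Fin d → ℝ)) = 1 := fun y => by
    rw [mFourier_kap]
    simp [rdotZ]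
  simp only [h2, mul_one] at h1
  rw [← h1.tsum_eq, Complex.ofReal_tsum]

lemma AssumptionJ.ker (hJ : AssumptionJ S J h M K ζ) (hd : 1 ≤ d) {μ : Fin d → ℝ}
    (hμ : μ ∈ closure (Omega S)) :
    Ker ((M + 1) ^ 2) (4 * π ^ 2 * K) (min ζ 1) (tilt J μ) (tilt h μ) :=
  (hJ.memQ μ hμ).ker hd hJ.M_pos hJ.zeta_pos

lemma AssumptionJ.min_zeta_pos (hJ : AssumptionJ S J h M K ζ) : 0 < min ζ 1 :=
  lt_min hJ.zeta_pos one_pos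

lemma AssumptionOmega.smul_mem (hΩ : AssumptionOmega S) {μ : Fin d → ℝ}
    (hμ : μ ∈ closure (Omega S)) {s : ℝ} (h0 : 0 ≤ s) (h1 : s < 1) : s • μ ∈ Omega S := by
  have h := (convex_Omega hΩ.nonneg).combo_interior_closure_mem_interior
    (x := 0) (y := μ) (by rw [hΩ.open_Omega.interior_eq]; exact hΩ.zero_mem) hμ
    (sub_pos.2 h1) h0 (by ring)
  rw [hΩ.open_Omega.interior_eq] at h
  simpa using h

lemma tilt_OZ (hJ : AssumptionJ S J h M K ζ) (μ : Fin d → ℝ) (x : Fin d → ℤ) :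
    tilt S μ x = tilt h μ x + conv (tilt J μ) (tilt S μ) x := by
  have h1 : conv (tilt J μ) (tilt S μ) x = conv J S x * Real.exp (rdotZ μ x) := by
    rw [conv, conv, ← tsum_mul_right]
    refine tsum_congr fun y => ?_
    rw [tilt, tilt, rdotZ_sub, Real.exp_sub]
    field_simp
  rw [h1, tilt, tilt, ← add_mul, ← hJ.OZ_eq]

lemma summable_abs_tilt (hΩ : AssumptionOmega S) {μ : Fin d → ℝ} (hμ : μ ∈ Omega S) :
    Summable fun y => |tilt S μ y| := ((mem_Omega_iff hΩ.nonneg).1 hμ).abs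

lemma hatf_tilt_OZ (hΩ : AssumptionOmega S) (hJ : AssumptionJ S J h M K ζ) (hd : 1 ≤ d)
    {μ : Fin d → ℝ} (hμ : μ ∈ Omega S) :
    hatf (tilt S μ) = hatf (tilt h μ) + hatf (tilt J μ) * hatf (tilt S μ) :=
  have hk := hJ.ker hd (subset_closure hμ)
  hatf_of_conv (summable_abs_tilt hΩ hμ) hk.Q_sum hk.g_sum (tilt_OZ hJ μ)

lemma tiltSum_OZ (hΩ : AssumptionOmega S) (hJ : AssumptionJ S J h M K ζ) (hd : 1 ≤ d)
    {μ : Fin d → ℝ} (hμ : μ ∈ Omega S) :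
    tiltSum S μ * (1 - tiltSum J μ) = tiltSum h μ := by
  have hk := hJ.ker hd (subset_closure hμ)
  have h1 := congrArg (fun F : Tor d => F (kap 0)) (hatf_tilt_OZ hΩ hJ hd hμ)
  simp only [ContinuousMap.add_apply, ContinuousMap.mul_apply] at h1
  rw [hatf_kap_zero (summable_abs_tilt hΩ hμ), hatf_kap_zero hk.Q_sum, hatf_kap_zero hk.g_sum]
    at h1
  have h2 : tiltSum S μ = tiltSum h μ + tiltSum J μ * tiltSum S μ := by exact_mod_cast h1
  linarith

lemma tiltSum_nonneg (hΩ : AssumptionOmega S) (μ : Fin d → ℝ) : 0 ≤ tiltSum S μ :=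
  tsum_nonneg fun y => mul_nonneg (hΩ.nonneg y) (Real.exp_pos _).le

lemma tiltSum_lt_one (hΩ : AssumptionOmega S) (hJ : AssumptionJ S J h M K ζ) (hd : 1 ≤ d)
    {μ : Fin d → ℝ} (hμ : μ ∈ Omega S) : tiltSum J μ < 1 := by
  have h1 := tiltSum_OZ hΩ hJ hd hμ
  have h2 := hJ.hhat_pos μ (subset_closure hμ)
  have h3 := tiltSum_nonneg hΩ μ
  by_contra hlt
  nlinarith

lemma AssumptionJ.ker_zero (hΩ : AssumptionOmega S) (hJ : AssumptionJ S J h M K ζ) (hd : 1 ≤ d) :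
    Ker ((M + 1) ^ 2) (4 * π ^ 2 * K) (min ζ 1) J h := by
  have := hJ.ker hd (subset_closure hΩ.zero_mem)
  rwa [tilt_zero, tilt_zero] at this

lemma tendsto_tiltSum_smul (hJ : AssumptionJ S J h M K ζ) (hd : 1 ≤ d)
    {μ : Fin d → ℝ} (hμ : μ ∈ closure (Omega S)) :
    Tendsto (fun s : ℝ => tiltSum J (s • μ)) (𝓝[<] 1) (𝓝 (tiltSum J μ)) := by
  have h1 := (continuousOn_tsum_tilt_real hJ.J_summable (hJ.ker hd hμ).Q_sum) 1
    (Set.right_mem_Icc.2 zero_le_one)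
  have h2 := h1.tendsto
  rw [one_smul] at h2
  refine h2.mono_left ?_
  rw [← nhdsWithin_Ico_eq_nhdsLT (zero_lt_one' ℝ)]
  exact nhdsWithin_mono _ Set.Ico_subset_Icc_self

lemma eventually_mem_Ico : ∀ᶠ s : ℝ in 𝓝[<] 1, s ∈ Set.Ico (0 : ℝ) 1 :=
  Ico_mem_nhdsLT zero_lt_one

lemma tiltSum_le_one (hΩ : AssumptionOmega S) (hJ : AssumptionJ S J h M K ζ) (hd : 1 ≤ d)
    {μ : Fin d → ℝ} (hμ : μ ∈ closure (Omega S)) : tiltSum J μ ≤ 1 :=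
  le_of_tendsto (tendsto_tiltSum_smul hJ hd hμ) <| eventually_mem_Ico.mono fun _ hs =>
    (tiltSum_lt_one hΩ hJ hd (hΩ.smul_mem hμ hs.1 hs.2)).le

lemma tiltSum_eq_one (hΩ : AssumptionOmega S) (hJ : AssumptionJ S J h M K ζ) (hd : 1 ≤ d)
    {μ : Fin d → ℝ} (hμ : μ ∈ frontier (Omega S)) : tiltSum J μ = 1 := by
  have hcl := frontier_subset_closure hμ
  refine le_antisymm (tiltSum_le_one hΩ hJ hd hcl) ?_
  by_contra hlt
  push Not at hlt
  have hnot : μ ∉ Omega S := by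
    rw [hΩ.open_Omega.frontier_eq] at hμ
    exact hμ.2
  refine hnot ((mem_Omega_iff hΩ.nonneg).2 ?_)
  set ε := (1 - tiltSum J μ) / 2 with hε
  have hε0 : 0 < ε := by linarith
  have hev : ∀ᶠ s : ℝ in 𝓝[<] 1, tiltSum J (s • μ) < 1 - ε :=
    (tendsto_tiltSum_smul hJ hd hcl).eventually_lt_const (by linarith)
  refine summable_of_sum_le (c := (M + 1) ^ 2 / ε)
    (fun x => mul_nonneg (hΩ.nonneg x) (Real.exp_pos _).le) fun F => ?_
  have hlim : Tendsto (fun s : ℝ => ∑ x ∈ F, tilt S (s • μ) x) (𝓝[<] 1)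
      (𝓝 (∑ x ∈ F, tilt S μ x)) := by
    have : Continuous fun s : ℝ => ∑ x ∈ F, tilt S (s • μ) x := by
      simp only [tilt_smul]
      fun_prop
    have h2 := this.tendsto 1
    rw [one_smul] at h2
    exact h2.mono_left nhdsWithin_le_nhds
  refine le_of_tendsto hlim ?_
  filter_upwards [hev, eventually_mem_Ico] with s h1 h2
  have hs := hΩ.smul_mem hcl h2.1 h2.2
  have hsum := (mem_Omega_iff hΩ.nonneg).1 hs
  have hk := hJ.ker hd (subset_closure hs)
  have h3 : tiltSum h (s • μ) ≤ (M + 1) ^ 2 :=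
    ((le_abs_self _).trans (by
      have := norm_tsum_le_tsum_norm (f := tilt h (s • μ)) hk.g_sum
      simpa [Real.norm_eq_abs, tiltSum_eq] using this)).trans hk.g_le
  have h4 := tiltSum_OZ hΩ hJ hd hs
  have h5 := tiltSum_nonneg hΩ (s • μ)
  calc ∑ x ∈ F, tilt S (s • μ) x ≤ tiltSum S (s • μ) :=
        hsum.sum_le_tsum F fun x _ => mul_nonneg (hΩ.nonneg x) (Real.exp_pos _).le
    _ ≤ (M + 1) ^ 2 / ε := by
        rw [le_div_iff₀ hε0]
        nlinarith

end TiltedKernels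

section DriftGeometry

variable {S J h : (Fin d → ℤ) → ℝ} {M K ζ : ℝ}

lemma abs_exp_sub_one_le_mul (a : ℝ) : |Real.exp a - 1| ≤ |a| * (1 + Real.exp a) := by
  rcases le_total 0 a with ha | ha
  · refine (abs_exp_sub_one_le a).trans ?_
    rw [abs_of_nonneg ha]
    nlinarith [Real.exp_pos a]
  · rw [abs_of_nonpos (sub_nonpos.2 (Real.exp_le_one_iff.2 ha)), abs_of_nonpos ha]
    nlinarith [Real.exp_pos a, Real.add_one_le_exp a]

lemma abs_exp_sub_one_sub_le_mul (a : ℝ) : |Real.exp a - 1 - a| ≤ a ^ 2 * (1 + Real.exp a) := by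
  rcases le_total 0 a with ha | ha
  · refine (abs_exp_sub_one_sub_le a).trans ?_
    rw [abs_of_nonneg ha]
    nlinarith [Real.exp_pos a, sq_nonneg a]
  · rcases le_total (-1) a with h1 | h1
    · have := Real.abs_exp_sub_one_sub_id_le (abs_le.2 ⟨h1, by linarith⟩)
      nlinarith [Real.exp_pos a, sq_nonneg a, mul_nonneg (sq_nonneg a) (Real.exp_pos a).le]
    · rw [abs_le]
      constructor <;>
      nlinarith [Real.exp_pos a, Real.exp_le_one_iff.2 ha, Real.add_one_le_exp a, sq_nonneg a,
        mul_nonneg (sq_nonneg a) (Real.exp_pos a).le]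

lemma ZdSymmetric.neg {f : (Fin d → ℤ) → ℝ} (hf : ZdSymmetric f) (y : Fin d → ℤ) :
    f (-y) = f y := by simpa [Pi.neg_def] using hf.2 (fun _ => true) y

lemma rdotZ_neg (l : Fin d → ℝ) (y : Fin d → ℤ) : rdotZ l (-y) = -rdotZ l y := by
  simp [rdotZ]

lemma ZdSymmetric.tsum_rdotZ_mul_eq_zero {f : (Fin d → ℤ) → ℝ} (hf : ZdSymmetric f)
    (l : Fin d → ℝ) : ∑' y, rdotZ l y * f y = 0 := by
  have h := (Equiv.neg (Fin d → ℤ)).tsum_eq fun y => rdotZ l y * f y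
  simp only [Equiv.neg_apply, rdotZ_neg, hf.neg, neg_mul, tsum_neg] at h
  linarith

lemma sq_rdotZ_le (l : Fin d → ℝ) (y : Fin d → ℤ) :
    rdotZ l y ^ 2 ≤ enormR l ^ 2 * enormZ y ^ 2 := by
  rw [← mul_pow, ← sq_abs]
  exact pow_le_pow_left₀ (abs_nonneg _) (abs_rdotZ_le l y) 2

lemma enormZ_le_sq (y : Fin d → ℤ) : enormZ y ≤ enormZ y ^ 2 := by
  by_cases hy : y = 0
  · simp [hy, enormZ_zero]
  · nlinarith [one_le_enormZ hy]

variable {μ ν : Fin d → ℝ}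

lemma AssumptionJ.abs_tiltSum_sub_le (hJ : AssumptionJ S J h M K ζ) (hd : 1 ≤ d)
    (hμ : μ ∈ closure (Omega S)) (hν : ν ∈ closure (Omega S)) :
    |tiltSum J ν - tiltSum J μ - rdot (ν - μ) (drift (tilt J μ))| ≤
      2 * (M + 1) ^ 2 * enormR (ν - μ) ^ 2 := by
  have hkμ := hJ.ker hd hμ
  have hkν := hJ.ker hd hν
  have hζ := hJ.min_zeta_pos
  have h1 := ((hkν.Q_sum.of_abs).hasSum.sub (hkμ.Q_sum.of_abs).hasSum).sub
    (hkμ.hasSum_rdotZ_mul hζ (ν - μ))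
  rw [tiltSum_eq, tiltSum_eq, ← h1.tsum_eq, ← Real.norm_eq_abs]
  have h2 := ((hkμ.summable_sq_mul hζ).add (hkν.summable_sq_mul hζ)).mul_left
    (enormR (ν - μ) ^ 2)
  refine (tsum_of_norm_bounded h2.hasSum fun y => ?_).trans ?_
  · have h3 : rdotZ ν y = rdotZ (ν - μ) y + rdotZ μ y := by
      rw [← rdotZ_add_left, sub_add_cancel]
    have h4 : tilt J ν y - tilt J μ y - rdotZ (ν - μ) y * tilt J μ y =
        tilt J μ y * (Real.exp (rdotZ (ν - μ) y) - 1 - rdotZ (ν - μ) y) := by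
      rw [tilt, tilt, h3, Real.exp_add]
      ring
    have h5 : |tilt J μ y| + |tilt J ν y| =
        |tilt J μ y| * (1 + Real.exp (rdotZ (ν - μ) y)) := by
      rw [abs_tilt, abs_tilt, h3, Real.exp_add]
      ring
    rw [h4, Real.norm_eq_abs, abs_mul, ← mul_add, h5]
    calc _ ≤ |tilt J μ y| * (rdotZ (ν - μ) y ^ 2 * (1 + Real.exp (rdotZ (ν - μ) y))) := by
          gcongr
          exact abs_exp_sub_one_sub_le_mul _
      _ ≤ |tilt J μ y| * ((enormR (ν - μ) ^ 2 * enormZ y ^ 2) *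
          (1 + Real.exp (rdotZ (ν - μ) y))) := by
          gcongr
          exact sq_rdotZ_le _ _
      _ = _ := by ring
  · rw [tsum_mul_left, (hkμ.summable_sq_mul hζ).tsum_add (hkν.summable_sq_mul hζ)]
    have h6 := hkμ.tsum_sq_mul_le hζ
    have h7 := hkν.tsum_sq_mul_le hζ
    nlinarith [sq_nonneg (enormR (ν - μ))]

lemma AssumptionJ.enormR_drift_le (hJ : AssumptionJ S J h M K ζ) (hd : 1 ≤ d)
    (hμ : μ ∈ closure (Omega S)) : enormR (drift (tilt J μ)) ≤ (M + 1) ^ 2 := by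
  have hk := hJ.ker hd hμ
  have hζ := hJ.min_zeta_pos
  set η := drift (tilt J μ) with hη
  have h1 := hk.hasSum_rdotZ_mul hζ η
  rw [← hη, rdot_self] at h1
  have h2 := (hk.summable_sq_mul hζ).mul_left (enormR η)
  have h3 := tsum_of_norm_bounded h2.hasSum (f := fun y => rdotZ η y * tilt J μ y) fun y => by
    rw [Real.norm_eq_abs, abs_mul, ← mul_assoc]
    gcongr
    exact (abs_rdotZ_le η y).trans
      (mul_le_mul_of_nonneg_left (enormZ_le_sq y) (enormR_nonneg η))
  rw [h1.tsum_eq, tsum_mul_left, Real.norm_eq_abs, abs_of_nonneg (sq_nonneg _)] at h3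
  have h4 := mul_le_mul_of_nonneg_left (hk.tsum_sq_mul_le hζ) (enormR_nonneg η)
  rcases (enormR_nonneg η).eq_or_lt with h0 | h0
  · rw [← h0]; positivity
  · nlinarith

lemma AssumptionJ.enormR_drift_le_mul (hΩ : AssumptionOmega S) (hJ : AssumptionJ S J h M K ζ)
    (hd : 1 ≤ d) (hμ : μ ∈ closure (Omega S)) :
    enormR (drift (tilt J μ)) ≤ 2 * (M + 1) ^ 2 * enormR μ := by
  have hk := hJ.ker hd hμ
  have hk0 := AssumptionJ.ker_zero hΩ hJ hd
  have hζ := hJ.min_zeta_pos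
  set η := drift (tilt J μ) with hη
  have h0 := (hk0.hasSum_rdotZ_mul hζ η).summable.hasSum
  rw [hJ.J_symm.tsum_rdotZ_mul_eq_zero] at h0
  have h1 := (hk.hasSum_rdotZ_mul hζ η).sub h0
  rw [← hη, rdot_self, sub_zero] at h1
  have h2 := ((hk0.summable_sq_mul hζ).add (hk.summable_sq_mul hζ)).mul_left
    (enormR η * enormR μ)
  have h3 := tsum_of_norm_bounded h2.hasSum
    (f := fun y => rdotZ η y * tilt J μ y - rdotZ η y * J y) fun y => by
      have h4 : rdotZ η y * tilt J μ y - rdotZ η y * J y =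
          rdotZ η y * J y * (Real.exp (rdotZ μ y) - 1) := by
        rw [tilt]
        ring
      rw [h4, Real.norm_eq_abs, abs_mul, abs_mul, abs_tilt]
      calc |rdotZ η y| * |J y| * |Real.exp (rdotZ μ y) - 1|
          ≤ (enormR η * enormZ y) * |J y| *
            ((enormR μ * enormZ y) * (1 + Real.exp (rdotZ μ y))) := by
            have hc := mul_le_mul_of_nonneg_right (abs_rdotZ_le μ y)
              (show 0 ≤ 1 + Real.exp (rdotZ μ y) by positivity)
            have he := enormR_nonneg η
            have hz := enormZ_nonneg y
            gcongr
            · exact abs_rdotZ_le η y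
            · exact (abs_exp_sub_one_le_mul _).trans hc
        _ = _ := by ring
  rw [h1.tsum_eq, tsum_mul_left, (hk0.summable_sq_mul hζ).tsum_add (hk.summable_sq_mul hζ),
    Real.norm_eq_abs, abs_of_nonneg (sq_nonneg _)] at h3
  have h4 := mul_le_mul_of_nonneg_left
    (add_le_add (hk0.tsum_sq_mul_le hζ) (hk.tsum_sq_mul_le hζ))
    (mul_nonneg (enormR_nonneg η) (enormR_nonneg μ))
  rcases (enormR_nonneg η).eq_or_lt with h0 | h0
  · rw [← h0]
    have := enormR_nonneg μ
    positivity
  · nlinarith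

lemma integral_mul_exp_mul (a : ℝ) : ∫ s in (0 : ℝ)..1, a * Real.exp (s * a) = Real.exp a - 1 := by
  have h : ∀ s ∈ Set.uIcc (0 : ℝ) 1,
      HasDerivAt (fun s => Real.exp (s * a)) (a * Real.exp (s * a)) s := fun s _ => by
    have := ((hasDerivAt_id s).mul_const a).exp
    simpa [mul_comm] using this
  rw [intervalIntegral.integral_eq_sub_of_hasDerivAt h
    (Continuous.intervalIntegrable (by fun_prop) _ _)]
  simp

lemma AssumptionJ.le_rdot_drift (hΩ : AssumptionOmega S) (hJ : AssumptionJ S J h M K ζ)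
    (hd : 1 ≤ d) (hμ : μ ∈ closure (Omega S)) :
    2 * K * enormR μ ^ 2 ≤ rdot μ (drift (tilt J μ)) := by
  have hk := hJ.ker hd hμ
  have hk0 := AssumptionJ.ker_zero hΩ hJ hd
  have hζ := hJ.min_zeta_pos
  set f : (Fin d → ℤ) → ℝ := fun y => rdotZ μ y ^ 2 * J y with hf
  have hsum : ∀ {Q g : (Fin d → ℤ) → ℝ}, Ker ((M + 1) ^ 2) (4 * π ^ 2 * K) (min ζ 1) Q g →
      Summable fun y => |rdotZ μ y ^ 2 * Q y| := fun hkQ => by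
    refine Summable.of_nonneg_of_le (fun y => abs_nonneg _) (fun y => ?_)
      ((hkQ.summable_sq_mul hζ).mul_left (enormR μ ^ 2))
    rw [abs_mul, abs_of_nonneg (sq_nonneg _), ← mul_assoc]
    gcongr
    exact sq_rdotZ_le μ y
  have htf : ∀ s : ℝ, ∀ y, tilt f (s • μ) y = rdotZ μ y ^ 2 * tilt J (s • μ) y := fun s y => by
    simp only [tilt, hf]
    ring
  have hf0 : Summable fun y => |f y| := hsum hk0
  have hf1 : Summable fun y => |tilt f μ y| := by
    have := hsum hk
    refine this.congr fun y => ?_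
    have := htf 1 y
    rw [one_smul] at this
    rw [this]
  have hcont := continuousOn_tsum_tilt_real hf0 hf1
  have hb : Summable fun y => |f y| * (1 + Real.exp (rdotZ μ y)) :=
    (hf0.add hf1).congr fun y => by rw [abs_tilt]; ring
  have hdom := intervalIntegral.hasSum_integral_of_dominated_convergence (μ := volume)
    (a := 0) (b := 1) (F := fun y s => tilt f (s • μ) y)
    (f := fun s => ∑' y, tilt f (s • μ) y)
    (fun y _ => |f y| * (1 + Real.exp (rdotZ μ y)))
    (fun y => by
      simp only [tilt_smul]
      exact (Continuous.aestronglyMeasurable (by fun_prop)))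
    (fun y => ae_of_all _ fun s hs => by
      rw [Set.uIoc_of_le zero_le_one] at hs
      rw [tilt_smul, Real.norm_eq_abs, abs_mul, Real.abs_exp]
      gcongr
      exact exp_mul_le_one_add_exp hs.1.le hs.2 _)
    (ae_of_all _ fun s _ => hb) intervalIntegrable_const
    (ae_of_all _ fun s hs => by
      rw [Set.uIoc_of_le zero_le_one] at hs
      refine (Summable.of_norm_bounded hb fun y => ?_).hasSum
      rw [tilt_smul, Real.norm_eq_abs, abs_mul, Real.abs_exp]
      gcongr
      exact exp_mul_le_one_add_exp hs.1.le hs.2 _)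
  have hterm : ∀ y, ∫ s in (0 : ℝ)..1, tilt f (s • μ) y =
      rdotZ μ y * tilt J μ y - rdotZ μ y * J y := fun y => by
    have : ∀ s : ℝ, tilt f (s • μ) y =
        rdotZ μ y * J y * (rdotZ μ y * Real.exp (s * rdotZ μ y)) := fun s => by
      rw [tilt_smul, hf]
      ring
    simp only [this]
    rw [intervalIntegral.integral_const_mul, integral_mul_exp_mul, tilt]
    ring
  simp only [hterm] at hdom
  have h0 := (hk0.hasSum_rdotZ_mul hζ μ).summable.hasSum
  rw [hJ.J_symm.tsum_rdotZ_mul_eq_zero] at h0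
  have h1 := (hk.hasSum_rdotZ_mul hζ μ).sub h0
  rw [sub_zero] at h1
  rw [h1.unique hdom]
  have hint : ∫ _s in (0 : ℝ)..1, 2 * K * enormR μ ^ 2 = 2 * K * enormR μ ^ 2 := by simp
  rw [← hint]
  refine intervalIntegral.integral_mono_on zero_le_one intervalIntegrable_const
    (hcont.intervalIntegrable_of_Icc zero_le_one) fun s hs => ?_
  have hks : Ker ((M + 1) ^ 2) (4 * π ^ 2 * K) (min ζ 1) (tilt J (s • μ)) (tilt h (s • μ)) := by
    rcases hs.2.eq_or_lt with h1 | h1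
    · rw [h1, one_smul]; exact hk
    · exact hJ.ker hd (subset_closure (hΩ.smul_mem hμ hs.1 h1))
  have h2 := hks.hasSum_quad hζ μ
  have h3 := hks.le_quad hζ (min_le_right _ _) μ
  rw [← h2.tsum_eq, tsum_mul_left] at h3
  simp only [htf]
  have hπ : 0 < π ^ 2 := by positivity
  nlinarith

end DriftGeometry

section Parallel

variable {S J h : (Fin d → ℤ) → ℝ} {M K ζ : ℝ} {x μ : Fin d → ℝ}

lemma rdot_smul_right (t : ℝ) (x y : Fin d → ℝ) : rdot x (t • y) = t * rdot x y := by
  rw [rdot_comm, rdot_smul_left, rdot_comm]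

lemma rdot_sub_right (x y z : Fin d → ℝ) : rdot x (y - z) = rdot x y - rdot x z := by
  rw [rdot_comm, rdot_sub_left, rdot_comm y, rdot_comm z]

lemma eq_zero_of_enormR_eq_zero {z : Fin d → ℝ} (hz : enormR z = 0) : z = 0 := by
  funext i
  have := abs_apply_le_enormR z i
  rw [hz] at this
  exact abs_nonpos_iff.1 this

lemma enormR_pos {z : Fin d → ℝ} (hz : z ≠ 0) : 0 < enormR z :=
  (enormR_nonneg z).lt_of_ne fun h => hz (eq_zero_of_enormR_eq_zero h.symm)

lemma AssumptionOmega.exists_smul_mem_frontier (hΩ : AssumptionOmega S)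
    {ν : Fin d → ℝ} (hν : ν ∉ closure (Omega S)) {s : ℝ} (h1 : s ≤ 1)
    (hs : s • ν ∈ closure (Omega S)) :
    ∃ l, s ≤ l ∧ l ≤ 1 ∧ l • ν ∈ frontier (Omega S) := by
  have hcont : Continuous fun l : ℝ => l • ν := by fun_prop
  have hcpt : IsCompact (Set.Icc s 1 ∩ (fun l : ℝ => l • ν) ⁻¹' closure (Omega S)) :=
    isCompact_Icc.inter_right (isClosed_closure.preimage hcont)
  obtain ⟨l, ⟨hl, hmem⟩, hmax⟩ := hcpt.exists_isGreatest ⟨s, ⟨le_rfl, h1⟩, hs⟩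
  refine ⟨l, hl.1, hl.2, ?_⟩
  rw [hΩ.open_Omega.frontier_eq]
  refine ⟨hmem, fun hin => ?_⟩
  have hlt : l < 1 := hl.2.lt_of_ne fun h => hν (by rw [h] at hmem; simpa using hmem)
  have hev : ∀ᶠ l' in 𝓝[>] l, l' • ν ∈ Omega S :=
    nhdsWithin_le_nhds ((hΩ.open_Omega.preimage hcont).mem_nhds hin)
  obtain ⟨l', h2, h3⟩ := (hev.and (Ioc_mem_nhdsGT hlt)).exists
  exact absurd (hmax ⟨⟨hl.1.trans h3.1.le, h3.2⟩, subset_closure h2⟩) (not_le.2 h3.1)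

lemma AssumptionJ.rdot_drift_nonneg (hΩ : AssumptionOmega S) (hJ : AssumptionJ S J h M K ζ)
    (hd : 1 ≤ d) (hμ : IsOptTilt S x μ) {w : Fin d → ℝ} (hw : 0 < rdot w x) :
    0 ≤ rdot w (drift (tilt J μ)) := by
  by_contra hneg
  push Not at hneg
  set η := drift (tilt J μ) with hη
  have hcl := frontier_subset_closure hμ.1
  obtain ⟨τ, hτw, hτ⟩ : ∃ τ : ℝ, τ • w ∈ Omega S ∧ 0 < τ := by
    have hcont : Continuous fun l : ℝ => l • w := by fun_prop
    have hev : ∀ᶠ l in 𝓝[>] (0 : ℝ), l • w ∈ Omega S :=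
      nhdsWithin_le_nhds ((hΩ.open_Omega.preimage hcont).mem_nhds
        (by simpa using hΩ.zero_mem))
    exact (hev.and self_mem_nhdsWithin).exists
  set u := τ • w with hu
  have hux : 0 < rdot u x := by rw [hu, rdot_smul_left]; positivity
  set b := -rdot u η with hb
  have hb0 : 0 < b := by
    rw [hb, hu, rdot_smul_left]
    nlinarith
  set D := enormR μ + enormR u with hD
  have hD0 : 0 ≤ D := add_nonneg (enormR_nonneg _) (enormR_nonneg _)
  set L := 4 * (M + 1) ^ 2 * D ^ 2 with hL
  have hL0 : 0 ≤ L := by positivity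
  set ε := b / (L + b) with hε
  have hε0 : 0 < ε := by positivity
  have hε1 : ε ≤ 1 := by rw [hε, div_le_one (by positivity)]; linarith
  have hεL : L * ε < b := by
    rw [hε, mul_div_assoc', div_lt_iff₀ (by positivity)]
    nlinarith [sq_pos_of_pos hb0]
  set ν := μ + ε • u with hν
  have hνnot : ν ∉ closure (Omega S) := fun hmem => by
    have h1 := hμ.2 ν hmem
    rw [hν, rdot_add_left, rdot_smul_left] at h1
    nlinarith [mul_pos hε0 hux]
  have hs : (1 / (1 + ε)) • ν ∈ closure (Omega S) := by
    have h1 := (convex_Omega hΩ.nonneg).closure hcl (subset_closure hτw)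
      (show 0 ≤ 1 / (1 + ε) by positivity) (show 0 ≤ ε / (1 + ε) by positivity)
      (by field_simp)
    convert h1 using 1
    rw [hν, smul_add, smul_smul]
    congr 2
    ring
  obtain ⟨l, hl, hl1, hlf⟩ := hΩ.exists_smul_mem_frontier hνnot
    (by rw [div_le_one (by positivity)]; linarith) hs
  have hl' : 1 ≤ l * (1 + ε) := by rwa [div_le_iff₀ (by positivity)] at hl
  have hT := hJ.abs_tiltSum_sub_le hd hcl (frontier_subset_closure hlf)
  rw [tiltSum_eq_one hΩ hJ hd hμ.1, tiltSum_eq_one hΩ hJ hd hlf, sub_self, zero_sub, abs_neg]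
    at hT
  have hΔ : l • ν - μ = (-(1 - l)) • μ + (l * ε) • u := by
    rw [hν]
    module
  have hl0 : 0 ≤ l := by nlinarith
  have hnorm : enormR (l • ν - μ) ≤ ε * D := by
    rw [hΔ]
    refine (enormR_add_le _ _).trans ?_
    rw [enormR_smul, enormR_smul, abs_neg, abs_of_nonneg (sub_nonneg.2 hl1),
      abs_of_nonneg (mul_nonneg hl0 hε0.le), hD]
    have h1 : 1 - l ≤ ε := by nlinarith
    have h2 : l * ε ≤ ε := by nlinarith
    have := mul_le_mul_of_nonneg_right h1 (enormR_nonneg μ)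
    have := mul_le_mul_of_nonneg_right h2 (enormR_nonneg u)
    nlinarith
  have hημ : 0 ≤ rdot μ η :=
    le_trans (by have := hJ.K_pos; positivity) (hJ.le_rdot_drift hΩ hd hcl)
  have hlow : ε / 2 * b ≤ |rdot (l • ν - μ) η| := by
    refine le_trans ?_ (neg_le_abs _)
    rw [hΔ, rdot_add_left, rdot_smul_left, rdot_smul_left]
    have h1 : 1 / 2 ≤ l := by nlinarith
    have h2 : rdot u η = -b := by rw [hb, neg_neg]
    rw [h2]
    have := mul_nonneg (sub_nonneg.2 hl1) hημ
    have := mul_le_mul_of_nonneg_right h1 (mul_pos hε0 hb0).le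
    nlinarith
  have hsq : enormR (l • ν - μ) ^ 2 ≤ (ε * D) ^ 2 :=
    pow_le_pow_left₀ (enormR_nonneg _) hnorm 2
  have h3 : ε / 2 * b ≤ 2 * (M + 1) ^ 2 * (ε * D) ^ 2 :=
    hlow.trans (hT.trans (mul_le_mul_of_nonneg_left hsq (by positivity)))
  have h4 : 2 * (M + 1) ^ 2 * (ε * D) ^ 2 = ε / 2 * (L * ε) := by rw [hL]; ring
  rw [h4] at h3
  have := le_of_mul_le_mul_left h3 (by positivity)
  linarith

lemma AssumptionOmega.rdot_pos (hΩ : AssumptionOmega S) (hd : 1 ≤ d) (hμ : IsOptTilt S x μ)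
    (hx : x ≠ 0) : 0 < rdot μ x := by
  have h1 := hΩ.mass_mul_enormR_le hd hμ
  have h2 := mul_pos (hΩ.mass_pos hd) (enormR_pos hx)
  have h3 : (0 : ℝ) < d := by exact_mod_cast hd
  by_contra h
  push Not at h
  nlinarith

lemma AssumptionJ.enormR_drift_pos (hΩ : AssumptionOmega S) (hJ : AssumptionJ S J h M K ζ)
    (hd : 1 ≤ d) (hμ : IsOptTilt S x μ) (hx : x ≠ 0) : 0 < enormR (drift (tilt J μ)) := by
  refine enormR_pos fun h0 => ?_
  have h1 := hJ.le_rdot_drift hΩ hd (frontier_subset_closure hμ.1)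
  have h2 : μ ≠ 0 := fun h => by
    have := hΩ.rdot_pos hd hμ hx
    simp [h, rdot] at this
  have h3 := enormR_pos h2
  have := hJ.K_pos
  have h4 : rdot μ (drift (tilt J μ)) = 0 := by simp [h0, rdot]
  have : 0 < 2 * K * enormR μ ^ 2 := by positivity
  linarith

lemma AssumptionJ.drift_parallel (hΩ : AssumptionOmega S) (hJ : AssumptionJ S J h M K ζ)
    (hd : 1 ≤ d) (hμ : IsOptTilt S x μ) (hx : x ≠ 0) :
    enormR (drift (tilt J μ)) • x = enormR x • drift (tilt J μ) := by
  have hv := hJ.enormR_drift_pos hΩ hd hμ hx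
  have hr := enormR_pos hx
  set η := drift (tilt J μ) with hη
  set w := enormR η • x - enormR x • η with hw
  have hwx : rdot w x = enormR x * (enormR η * enormR x - rdot η x) := by
    rw [hw, rdot_sub_left, rdot_smul_left, rdot_smul_left, rdot_self]
    ring
  have hwη : rdot w η = -(enormR η * (enormR η * enormR x - rdot η x)) := by
    rw [hw, rdot_sub_left, rdot_smul_left, rdot_smul_left, rdot_self, rdot_comm x]
    ring
  have hle : rdot η x ≤ enormR η * enormR x := (le_abs_self _).trans (abs_rdot_le η x)
  have heq : enormR η * enormR x - rdot η x = 0 := by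
    refine le_antisymm ?_ (sub_nonneg.2 hle)
    by_contra hlt
    push Not at hlt
    have h1 : 0 < rdot w x := by rw [hwx]; positivity
    have h2 := hJ.rdot_drift_nonneg hΩ hd hμ h1
    rw [← hη, hwη] at h2
    nlinarith [mul_pos hv hlt]
  have h0 : enormR w ^ 2 = 0 := by
    rw [← rdot_self]
    nth_rewrite 2 [hw]
    rw [rdot_sub_right, rdot_smul_right, rdot_smul_right, hwx, hwη, heq]
    ring
  exact sub_eq_zero.1 (eq_zero_of_enormR_eq_zero (pow_eq_zero_iff two_ne_zero |>.1 h0))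

lemma AssumptionJ.enormR_sub_smul_drift (hΩ : AssumptionOmega S) (hJ : AssumptionJ S J h M K ζ)
    (hd : 1 ≤ d) (hμ : IsOptTilt S x μ) (hx : x ≠ 0) (t : ℝ) :
    enormR (x - t • drift (tilt J μ)) = |enormR x - enormR (drift (tilt J μ)) * t| := by
  have hr := enormR_pos hx
  have h1 := hJ.drift_parallel hΩ hd hμ hx
  set η := drift (tilt J μ) with hη
  have h2 : enormR x • (x - t • η) = (enormR x - enormR η * t) • x := by
    rw [smul_sub, smul_comm, ← h1]
    module
  have h3 := congrArg enormR h2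
  rw [enormR_smul, enormR_smul, abs_of_pos hr, mul_comm] at h3
  exact mul_right_cancel₀ hr.ne' h3

/-- The speed of the tilted kernel is comparable to the mass. -/
lemma AssumptionJ.mass_le_mul_enormR_drift (hΩ : AssumptionOmega S)
    (hJ : AssumptionJ S J h M K ζ) (hd : 1 ≤ d) (hμ : IsOptTilt S x μ) (hx : x ≠ 0) :
    2 * K * mass S ≤ d * enormR (drift (tilt J μ)) := by
  have hr := enormR_pos hx
  have h1 := hJ.le_rdot_drift hΩ hd (frontier_subset_closure hμ.1)
  have h2 := hΩ.mass_mul_enormR_le hd hμ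
  have h3 := (le_abs_self _).trans (abs_rdot_le μ x)
  have h4 := (le_abs_self _).trans (abs_rdot_le μ (drift (tilt J μ)))
  have hK := hJ.K_pos
  have hd0 : (0 : ℝ) < d := by exact_mod_cast hd
  have h5 : mass S ≤ d * enormR μ := by
    refine le_of_mul_le_mul_right (h2.trans ?_) hr
    nlinarith
  have hμ0 : 0 < enormR μ := by
    have := hΩ.mass_pos hd
    by_contra hn
    push Not at hn
    nlinarith
  have h6 : 2 * K * enormR μ ≤ enormR (drift (tilt J μ)) := by
    refine le_of_mul_le_mul_left ?_ hμ0
    nlinarith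
  nlinarith

lemma AssumptionJ.enormR_drift_le_mass (hΩ : AssumptionOmega S)
    (hJ : AssumptionJ S J h M K ζ) (hd : 1 ≤ d) (hμ : μ ∈ closure (Omega S)) :
    enormR (drift (tilt J μ)) ≤ 2 * (M + 1) ^ 2 * d * mass S := by
  refine (hJ.enormR_drift_le_mul hΩ hd hμ).trans ?_
  rw [mul_assoc _ (d : ℝ)]
  exact mul_le_mul_of_nonneg_left (hΩ.enormR_le_mass hd hμ) (by positivity)

end Parallel

section Representation

open NormedSpace

variable {S J h : (Fin d → ℤ) → ℝ} {M K ζ : ℝ} {μ : Fin d → ℝ}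

lemma re_hatf_apply_le {Q g : (Fin d → ℤ) → ℝ} {κ : ℝ} (hk : Ker M κ ζ Q g) (hκ : 0 < κ)
    (z : UnitAddTorus (Fin d)) : (hatf Q z).re ≤ ∑' y, Q y := by
  obtain ⟨θ, hθ, rfl⟩ := kap_surj z
  have := hk.re_hatf_le hθ
  nlinarith [sq_nonneg (enormR θ)]

lemma co_mul_exp_neg_one_sub (Q g : (Fin d → ℤ) → ℝ) (t : ℝ) (x : Fin d → ℤ) :
    co (hatf g * exp (t • -(1 - hatf Q))) x =
      (Real.exp (-(t * (1 - ∑' y, Q y))) : ℂ) * Ik Q g t x := by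
  have h1 : exp (t • -(1 - hatf Q)) = (Real.exp (-t) : ℂ) • exp (t • hatf Q) := by
    ext z
    rw [ContinuousMap.smul_apply, tor_exp_apply, tor_exp_apply, smul_eq_mul,
      Complex.ofReal_exp, ← Complex.exp_add]
    congr 1
    simp
    ring
  rw [h1, mul_smul_comm, co_smul, Ik, ← mul_assoc, ← Complex.ofReal_mul, ← Real.exp_add]
  congr 4
  ring

lemma continuous_Ik (Q g : (Fin d → ℤ) → ℝ) (x : Fin d → ℤ) : Continuous fun t => Ik Q g t x := by
  have := continuous_co_exp (hatf g) (hatf Q) x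
  unfold Ik
  fun_prop

lemma integral_Ik_of_mem_Omega (hΩ : AssumptionOmega S) (hJ : AssumptionJ S J h M K ζ)
    (hd : 1 ≤ d) (hμ : μ ∈ Omega S) (x : Fin d → ℤ) :
    ∫ t in Set.Ioi (0 : ℝ), (Real.exp (-(t * (1 - tiltSum J μ))) : ℂ) *
      Ik (tilt J μ) (tilt h μ) t x = (tilt S μ x : ℂ) := by
  have hk := hJ.ker hd (subset_closure hμ)
  have hκ : 0 < 4 * π ^ 2 * K := by have := hJ.K_pos; positivity
  have h1 : hatf (tilt S μ) * (1 - hatf (tilt J μ)) = hatf (tilt h μ) := by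
    have := hatf_tilt_OZ hΩ hJ hd hμ
    linear_combination this
  have h2 := integral_co_exp h1 (sub_pos.2 (tiltSum_lt_one hΩ hJ hd hμ)) (fun z => by
    have := re_hatf_apply_le hk hκ z
    rw [ContinuousMap.sub_apply, Complex.sub_re, ContinuousMap.one_apply, Complex.one_re,
      tiltSum_eq]
    linarith) x
  rw [co_hatf (summable_abs_tilt hΩ hμ)] at h2
  simpa only [co_mul_exp_neg_one_sub, ← tiltSum_eq] using h2

lemma tendsto_smul_left {E : Type*} [TopologicalSpace E] {F : ℝ → E}
    (hF : ContinuousOn F (Set.Icc 0 1)) : Tendsto F (𝓝[<] 1) (𝓝 (F 1)) := by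
  refine (hF 1 (Set.right_mem_Icc.2 zero_le_one)).tendsto.mono_left ?_
  rw [← nhdsWithin_Ico_eq_nhdsLT (zero_lt_one' ℝ)]
  exact nhdsWithin_mono _ Set.Ico_subset_Icc_self

lemma tendsto_Ik_tilt (hΩ : AssumptionOmega S) (hJ : AssumptionJ S J h M K ζ)
    (hd : 1 ≤ d) (hμ : μ ∈ closure (Omega S)) (t : ℝ) (x : Fin d → ℤ) :
    Tendsto (fun s : ℝ => Ik (tilt J (s • μ)) (tilt h (s • μ)) t x) (𝓝[<] 1)
      (𝓝 (Ik (tilt J μ) (tilt h μ) t x)) := by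
  have hk := hJ.ker hd hμ
  have hk0 := AssumptionJ.ker_zero hΩ hJ hd
  have h1 := tendsto_smul_left (continuousOn_hatf_tilt hk0.Q_sum hk.Q_sum)
  have h2 := tendsto_smul_left (continuousOn_hatf_tilt hk0.g_sum hk.g_sum)
  have h3 := tendsto_tiltSum_smul hJ hd hμ
  simp only [one_smul] at h1 h2
  have h4 : Tendsto (fun s : ℝ => hatf (tilt h (s • μ)) * exp (t • hatf (tilt J (s • μ))))
      (𝓝[<] 1) (𝓝 (hatf (tilt h μ) * exp (t • hatf (tilt J μ)))) :=
    h2.mul ((exp_continuous.tendsto _).comp (h1.const_smul t))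
  have h5 := ((coL x).continuous.tendsto _).comp h4
  simp only [Function.comp_def, coL_apply] at h5
  refine Tendsto.mul ?_ h5
  have h6 : Continuous fun u : ℝ => ((Real.exp (-(t * u)) : ℝ) : ℂ) := by fun_prop
  exact (h6.tendsto _).comp h3

lemma tendsto_drift_tilt (hΩ : AssumptionOmega S) (hJ : AssumptionJ S J h M K ζ)
    (hd : 1 ≤ d) (hμ : μ ∈ closure (Omega S)) :
    Tendsto (fun s : ℝ => drift (tilt J (s • μ))) (𝓝[<] 1) (𝓝 (drift (tilt J μ))) := by
  have hk := hJ.ker hd hμ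
  have hk0 := AssumptionJ.ker_zero hΩ hJ hd
  have hζ := hJ.min_zeta_pos
  refine tendsto_pi_nhds.2 fun j => ?_
  have ht : ∀ (l : Fin d → ℝ) (y : Fin d → ℤ),
      tilt (fun y => (y j : ℝ) * J y) l y = (y j : ℝ) * tilt J l y := fun l y => by
    rw [tilt, tilt, mul_assoc]
  have h1 := tendsto_smul_left (continuousOn_tsum_tilt_real (μ := μ)
    (f := fun y => (y j : ℝ) * J y) (hk0.summable_coord_mul hζ j)
    (by simpa only [ht] using hk.summable_coord_mul hζ j))
  simp only [ht, one_smul] at h1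
  exact h1

lemma integrableOn_piecewise_rpow (T B C : ℝ) {p : ℝ} (hT : 0 < T) (hp : 1 < p) :
    IntegrableOn ((Set.Iic T).piecewise (fun _ => B) fun t => C * t ^ (-p)) (Set.Ioi 0) := by
  refine Integrable.piecewise measurableSet_Iic ?_ ?_
  · rw [IntegrableOn, Measure.restrict_restrict measurableSet_Iic, Set.inter_comm,
      Set.Ioi_inter_Iic]
    exact integrable_const _
  · rw [IntegrableOn, Measure.restrict_restrict measurableSet_Iic.compl, Set.compl_Iic,
      Set.Ioi_inter_Ioi, max_eq_left hT.le]
    exact (integrableOn_Ioi_rpow_of_lt (by linarith) hT).const_mul C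

/-- Ornstein–Zernike representation of the tilted two-point function at a boundary tilt. -/
lemma integral_Ik_of_mem_frontier (hΩ : AssumptionOmega S) (hJ : AssumptionJ S J h M K ζ)
    (hd : 1 ≤ d) (hμ : μ ∈ frontier (Omega S)) (hη : drift (tilt J μ) ≠ 0) (x : Fin d → ℤ) :
    IntegrableOn (fun t => Ik (tilt J μ) (tilt h μ) t x) (Set.Ioi 0) ∧
      ∫ t in Set.Ioi (0 : ℝ), Ik (tilt J μ) (tilt h μ) t x = (tilt S μ x : ℂ) := by
  have hcl := frontier_subset_closure hμ
  have hκ : 0 < 4 * π ^ 2 * K := by have := hJ.K_pos; positivity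
  obtain ⟨C, A, hC, hA, hdec⟩ := exists_norm_Ik_le_decay d
    (show 0 < (M + 1) ^ 2 by have := hJ.M_pos; positivity) hκ hJ.min_zeta_pos (min_le_right ζ 1)
  set v := enormR (drift (tilt J μ)) with hv
  have hv0 : 0 < v := enormR_pos hη
  set a := aExp d with ha
  have ha1 : 1 ≤ a := one_le_aExp
  have hd0 : (1 : ℝ) ≤ d := by exact_mod_cast hd
  set T := 1 + 4 * enormR (toR x) / v + 16 * A / v ^ 2 with hT
  have hx0 := enormR_nonneg (toR x)
  have hT1 : 1 ≤ T := by
    have : 0 ≤ 4 * enormR (toR x) / v + 16 * A / v ^ 2 := by positivity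
    linarith
  have hT2 : 4 * enormR (toR x) ≤ T * v := by
    rw [← div_le_iff₀ hv0]
    have : 0 ≤ 16 * A / v ^ 2 := by positivity
    linarith
  have hT3 : 16 * A ≤ T * v ^ 2 := by
    rw [← div_le_iff₀ (by positivity)]
    have : 0 ≤ 4 * enormR (toR x) / v := by positivity
    linarith
  set B := (M + 1) ^ 2 * cGauss d (4 * π ^ 2 * K) with hB
  have hB0 : 0 ≤ B := by
    have := cGauss_pos (d := d) (4 * π ^ 2 * K)
    positivity
  set bound : ℝ → ℝ :=
    (Set.Iic T).piecewise (fun _ => B) fun t => C * (16 / v ^ 2) ^ a * t ^ (-((d : ℝ) / 2 + a))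
    with hbound
  have hbint : IntegrableOn bound (Set.Ioi 0) :=
    integrableOn_piecewise_rpow T B _ (by linarith) (by linarith)
  have hev : ∀ᶠ s : ℝ in 𝓝[<] 1, v / 2 < enormR (drift (tilt J (s • μ))) :=
    ((continuous_enormR.tendsto _).comp (tendsto_drift_tilt hΩ hJ hd hcl)).eventually_const_lt
      (by rw [← hv]; linarith)
  have hIb : ∀ s : ℝ, Ker ((M + 1) ^ 2) (4 * π ^ 2 * K) (min ζ 1) (tilt J (s • μ))
      (tilt h (s • μ)) → v / 2 < enormR (drift (tilt J (s • μ))) → ∀ t ∈ Set.Ioi (0 : ℝ),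
      ‖Ik (tilt J (s • μ)) (tilt h (s • μ)) t x‖ ≤ bound t := by
    intro s hk hvs t ht
    have ht0 : 0 < t := ht
    by_cases htT : t ≤ T
    · rw [hbound, Set.piecewise_eq_of_mem _ _ _ (Set.mem_Iic.2 htT)]
      refine (hk.norm_Ik_le hκ ht0.le x).trans (mul_le_of_le_one_right hB0 ?_)
      exact Real.rpow_le_one_of_one_le_of_nonpos (le_max_right _ _)
        (neg_nonpos.2 (by positivity))
    · rw [hbound, Set.piecewise_eq_of_notMem _ _ _ (by simpa using htT)]
      push Not at htT
      have ht1 : 1 ≤ t := hT1.trans htT.le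
      set ρ := enormR (toR x - t • drift (tilt J (s • μ))) with hρ
      have h1 : t * enormR (drift (tilt J (s • μ))) ≤ ρ + enormR (toR x) := by
        have h2 := enormR_add_le (t • drift (tilt J (s • μ)) - toR x) (toR x)
        rw [sub_add_cancel, enormR_smul, abs_of_pos ht0, ← neg_sub, enormR_neg] at h2
        exact h2
      have h2 : t * v / 4 ≤ ρ := by
        have := mul_le_mul_of_nonneg_left hvs.le ht0.le
        have := mul_le_mul_of_nonneg_right htT.le hv0.le
        linarith
      have h3 : (t * v / 4) ^ 2 ≤ ρ ^ 2 := pow_le_pow_left₀ (by positivity) h2 2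
      have h4 : A * max t 1 ≤ ρ ^ 2 := by
        rw [max_eq_left ht1]
        have := mul_le_mul_of_nonneg_right htT.le (sq_nonneg v)
        refine le_trans ?_ h3
        nlinarith
      have h5 := hdec _ _ hk t ht0.le x ρ hρ h4
      rw [max_eq_left ht1] at h5
      refine h5.trans ?_
      have h6 : t / ρ ^ 2 ≤ 16 / v ^ 2 * t⁻¹ := by
        calc t / ρ ^ 2 ≤ t / (t * v / 4) ^ 2 := by gcongr
          _ = _ := by field_simp; ring
      calc C * t ^ (-((d : ℝ) / 2)) * (t / ρ ^ 2) ^ a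
          ≤ C * t ^ (-((d : ℝ) / 2)) * (16 / v ^ 2 * t⁻¹) ^ a := by gcongr
        _ = _ := by
          rw [Real.mul_rpow (by positivity) (by positivity), Real.inv_rpow ht0.le,
            ← Real.rpow_neg ht0.le, neg_add, Real.rpow_add ht0]
          ring
  have hint : IntegrableOn (fun t => Ik (tilt J μ) (tilt h μ) t x) (Set.Ioi 0) := by
    refine Integrable.mono' hbint (continuous_Ik _ _ x).aestronglyMeasurable ?_
    refine (ae_restrict_iff' measurableSet_Ioi).2 (ae_of_all _ fun t ht => ?_)
    have := hIb 1 (by rw [one_smul]; exact hJ.ker hd hcl) (by rw [one_smul, ← hv]; linarith) t ht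
    rwa [one_smul] at this
  refine ⟨hint, ?_⟩
  have hlim := tendsto_integral_filter_of_dominated_convergence
    (μ := volume.restrict (Set.Ioi (0 : ℝ))) (l := 𝓝[<] (1 : ℝ))
    (F := fun s t => (Real.exp (-(t * (1 - tiltSum J (s • μ)))) : ℂ) *
      Ik (tilt J (s • μ)) (tilt h (s • μ)) t x)
    (f := fun t => Ik (tilt J μ) (tilt h μ) t x) bound
    (Eventually.of_forall fun s => by
      have := continuous_Ik (tilt J (s • μ)) (tilt h (s • μ)) x
      exact Continuous.aestronglyMeasurable (by fun_prop))
    (by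
      filter_upwards [hev, eventually_mem_Ico] with s h1 h2
      have hs := hΩ.smul_mem hcl h2.1 h2.2
      refine (ae_restrict_iff' measurableSet_Ioi).2 (ae_of_all _ fun t ht => ?_)
      have ht0 : 0 < t := ht
      rw [norm_mul, Complex.norm_real, Real.norm_eq_abs, Real.abs_exp]
      refine (mul_le_of_le_one_left (norm_nonneg _) ?_).trans
        (hIb s (hJ.ker hd (subset_closure hs)) h1 t ht)
      rw [Real.exp_le_one_iff, neg_nonpos]
      exact mul_nonneg ht0.le (sub_nonneg.2 (tiltSum_lt_one hΩ hJ hd hs).le))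
    hbint
    (ae_of_all _ fun t => by
      have h1 : Continuous fun u : ℝ => ((Real.exp (-(t * (1 - u))) : ℝ) : ℂ) := by fun_prop
      have h2 := ((h1.tendsto _).comp (tendsto_tiltSum_smul hJ hd hcl)).mul
        (tendsto_Ik_tilt hΩ hJ hd hcl t x)
      rw [tiltSum_eq_one hΩ hJ hd hμ, sub_self, mul_zero, neg_zero, Real.exp_zero,
        Complex.ofReal_one, one_mul] at h2
      exact h2)
  have hlim2 : Tendsto (fun s : ℝ => (tilt S (s • μ) x : ℂ)) (𝓝[<] 1) (𝓝 (tilt S μ x : ℂ)) := by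
    have h1 : Continuous fun s : ℝ => ((tilt S (s • μ) x : ℝ) : ℂ) := by
      simp only [tilt_smul]
      fun_prop
    have h2 := h1.tendsto 1
    rw [one_smul] at h2
    exact h2.mono_left nhdsWithin_le_nhds
  refine tendsto_nhds_unique hlim (hlim2.congr' ?_)
  filter_upwards [eventually_mem_Ico] with s hs
  exact (integral_Ik_of_mem_Omega hΩ hJ hd (hΩ.smul_mem hcl hs.1 hs.2) x).symm

end Representation

section Assembly

lemma rpow_le_mul_rpow_of_comparable {a b k : ℝ} (ha : 0 < a) (hb : 0 < b) (hk : 1 ≤ k)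
    (hab : a ≤ k * b) (hba : b ≤ k * a) (p : ℝ) : a ^ p ≤ k ^ |p| * b ^ p := by
  have hk0 : 0 < k := one_pos.trans_le hk
  rcases le_total 0 p with hp | hp
  · rw [abs_of_nonneg hp, ← Real.mul_rpow hk0.le hb.le]
    exact Real.rpow_le_rpow ha.le hab hp
  · rw [abs_of_nonpos hp]
    have h1 : b / k ≤ a := by rwa [div_le_iff₀ hk0, mul_comm]
    refine (Real.rpow_le_rpow_of_nonpos (div_pos hb hk0) h1 hp).trans_eq ?_
    rw [Real.div_rpow hb.le hk0.le, Real.rpow_neg hk0.le]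
    ring

lemma rpow_mul_rpow_le_of_comparable {a b a' b' k : ℝ} (ha : 0 < a) (hb : 0 < b) (ha' : 0 < a')
    (hb' : 0 < b') (hk : 1 ≤ k) (h1 : a ≤ k * b) (h2 : b ≤ k * a) (h3 : a' ≤ k * b')
    (h4 : b' ≤ k * a') (p q : ℝ) :
    a ^ p * a' ^ q ≤ k ^ (|p| + |q|) * (b ^ p * b' ^ q) := by
  rw [Real.rpow_add (one_pos.trans_le hk)]
  have h5 := rpow_le_mul_rpow_of_comparable ha hb hk h1 h2 p
  have h6 := rpow_le_mul_rpow_of_comparable ha' hb' hk h3 h4 q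
  calc a ^ p * a' ^ q ≤ (k ^ |p| * b ^ p) * (k ^ |q| * b' ^ q) := by gcongr
    _ = _ := by ring

variable {S J h : (Fin d → ℤ) → ℝ} {M K ζ : ℝ}

/-- Two-sided bound on the tilted two-point function by the height of the time window in which the
representing integral is concentrated. -/
lemma exists_window_bounds (hd : 1 ≤ d) (hM : 0 < M) (hK : 0 < K) (hζ : 0 < ζ) {CH cL : ℝ}
    (hCH : 0 < CH) (hcL : 0 < cL) :
    ∃ R c C : ℝ, 0 < R ∧ 0 < c ∧ 0 < C ∧
      ∀ S J h : (Fin d → ℤ) → ℝ, AssumptionOmega S → AssumptionJ S J h M K ζ →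
      (∀ μ ∈ frontier (Omega S), M⁻¹ ≤ tiltSum h μ) →
      ∀ (x : Fin d → ℤ) (μ : Fin d → ℝ), IsOptTilt S (toR x) μ → R ≤ enormZ x →
      ∀ H, 0 ≤ H → HasWindow d CH cL H (enormZ x) (enormR (drift (tilt J μ))) →
        c * H ≤ tilt S μ x ∧ tilt S μ x ≤ C * H := by
  have hM' : 0 < (M + 1) ^ 2 := by positivity
  have hκ : 0 < 4 * π ^ 2 * K := by positivity
  have hζ' : 0 < min ζ 1 := lt_min hζ one_pos
  have hζ1 : min ζ 1 ≤ 1 := min_le_right _ _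
  obtain ⟨C1, A, hC1, hA, hdec⟩ := exists_norm_Ik_le_decay d hM' hκ hζ' hζ1
  obtain ⟨C2, C3, c4, hC2, -, hc4, hgauss⟩ := exists_norm_Ik_sub_gauss_le d hM' hκ hζ' hζ1
  set B := (M + 1) ^ 2 * cGauss d (4 * π ^ 2 * K) with hB
  obtain ⟨R, c, C, hR, hc, hC, hmain⟩ := exists_integral_comparison d hA
    (lt_max_of_lt_left hC1 : 0 < max C1 B) hC2 (mul_pos (inv_pos.2 hM) hc4) hζ' hCH hcL hM'
  refine ⟨R, c, C, hR, hc, hC, fun S J h hΩ hJ hlow x μ hμ hx H hH hwin => ?_⟩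
  have hcl := frontier_subset_closure hμ.1
  have hk := hJ.ker hd hcl
  have hx0 : toR x ≠ 0 := fun h0 => by
    rw [enormZ_eq, h0] at hx
    simp only [enormR, Pi.zero_apply, ne_eq, OfNat.ofNat_ne_zero, not_false_eq_true, zero_pow,
      Finset.sum_const_zero, Real.sqrt_zero] at hx
    linarith
  have hv := hJ.enormR_drift_pos hΩ hd hμ hx0
  have hdist : ∀ t, enormR (toR x - t • drift (tilt J μ)) ^ 2 =
      (enormZ x - enormR (drift (tilt J μ)) * t) ^ 2 := fun t => by
    rw [hJ.enormR_sub_smul_drift hΩ hd hμ hx0, sq_abs, enormZ_eq]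
  obtain ⟨hint, hval⟩ := integral_Ik_of_mem_frontier hΩ hJ hd hμ.1
    (fun h0 => hv.ne' (by simp [h0, enormR])) x
  have hval' : ∫ t in Set.Ioi (0 : ℝ), (Ik (tilt J μ) (tilt h μ) t x).re = tilt S μ x := by
    have := integral_re (𝕜 := ℂ) hint
    rw [hval] at this
    simpa using this
  rw [← hval']
  refine hmain _ _ H hx hv (hJ.enormR_drift_le hd hcl) hH _ hint.re ?_ ?_ ?_ hwin
  · intro t ht hAt
    refine (Complex.abs_re_le_norm _).trans ?_
    rw [← hdist] at hAt ⊢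
    refine (hdec _ _ hk t ht.le x _ rfl hAt).trans ?_
    gcongr
    exact le_max_left _ _
  · intro t ht
    refine (Complex.abs_re_le_norm _).trans ((hk.norm_Ik_le hκ ht.le x).trans ?_)
    gcongr
    exact le_max_right _ _
  · intro t ht
    obtain ⟨G, hG0, -, hG1, hG2⟩ := hgauss _ _ hk t ht x
    have hh : M⁻¹ ≤ ∑' y, tilt h μ y := hlow μ hμ.1
    have hh0 : 0 < ∑' y, tilt h μ y := (inv_pos.2 hM).trans_le hh
    refine ⟨(∑' y, tilt h μ y) * G, by positivity, fun hcond => ?_, ?_⟩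
    · rw [← hdist] at hcond
      rw [mul_assoc]
      exact mul_le_mul hh (hG1 hcond) (by positivity) hh0.le
    · refine le_trans ?_ hG2
      refine le_trans (le_of_eq ?_) (Complex.abs_re_le_norm _)
      rw [Complex.sub_re, Complex.ofReal_re]

lemma le_and_le_of_comparable {c C k X E F H : ℝ} (hc : 0 < c) (hC : 0 < C) (hk : 0 < k)
    (hE : 0 < E) (hX : c * H ≤ X * E ∧ X * E ≤ C * H) (h1 : F ≤ k * H) (h2 : H ≤ k * F) :
    c / k * (F * E⁻¹) ≤ X ∧ X ≤ C * k * (F * E⁻¹) := by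
  constructor
  · rw [← mul_assoc, ← div_eq_mul_inv, div_le_iff₀ hE]
    refine le_trans ?_ hX.1
    rw [div_mul_eq_mul_div, div_le_iff₀ hk, mul_assoc, mul_comm H]
    exact mul_le_mul_of_nonneg_left h1 hc.le
  · rw [← mul_assoc, ← div_eq_mul_inv, le_div_iff₀ hE, mul_assoc]
    exact hX.2.trans (mul_le_mul_of_nonneg_left h2 hC.le)

/-- Comparability of length with the adapted norm, and of speed with mass. -/
lemma exists_comparable (d : ℕ) (hM : 0 < M) (hK : 0 < K) :
    ∃ k : ℝ, 1 ≤ k ∧ ∀ (S J h : (Fin d → ℤ) → ℝ), 1 ≤ d → AssumptionOmega S →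
      AssumptionJ S J h M K ζ →
      ∀ x μ, IsOptTilt S x μ → x ≠ 0 →
        0 < normS S x ∧ enormR x ≤ k * normS S x ∧ normS S x ≤ k * enormR x ∧
        mass S ≤ k * enormR (drift (tilt J μ)) ∧ enormR (drift (tilt J μ)) ≤ k * mass S := by
  refine ⟨1 + d + d / (2 * K) + 2 * (M + 1) ^ 2 * d, ?_, ?_⟩
  · have : (0 : ℝ) ≤ d + d / (2 * K) + 2 * (M + 1) ^ 2 * d := by positivity
    linarith
  intro S J h hd hΩ hJ x μ hμ hx
  set k : ℝ := 1 + d + d / (2 * K) + 2 * (M + 1) ^ 2 * d with hk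
  have hd0 : (0 : ℝ) < d := by exact_mod_cast hd
  have hk1 : (d : ℝ) ≤ k := by
    have : (0 : ℝ) ≤ 1 + d / (2 * K) + 2 * (M + 1) ^ 2 * d := by positivity
    linarith
  have hk2 : d / (2 * K) ≤ k := by
    have : (0 : ℝ) ≤ 1 + d + 2 * (M + 1) ^ 2 * d := by positivity
    linarith
  have hk3 : 2 * (M + 1) ^ 2 * d ≤ k := by
    have : (0 : ℝ) ≤ 1 + d + d / (2 * K) := by positivity
    linarith
  have hm := hΩ.mass_pos hd
  have hr := enormR_pos hx
  have hmn := hΩ.mass_mul_normS hd hμ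
  have hcl := frontier_subset_closure hμ.1
  have hv := hJ.enormR_drift_pos hΩ hd hμ hx
  have hn : 0 < normS S x := by
    have := hΩ.rdot_pos hd hμ hx
    rw [← hmn] at this
    exact pos_of_mul_pos_right this hm.le
  refine ⟨hn, ?_, ?_, ?_, ?_⟩
  · have h1 := hΩ.mass_mul_enormR_le hd hμ
    rw [← hmn] at h1
    have h2 : enormR x ≤ d * normS S x := by
      refine le_of_mul_le_mul_left ?_ hm
      linarith
    exact h2.trans (mul_le_mul_of_nonneg_right hk1 hn.le)
  · have h1 := (le_abs_self _).trans (abs_rdot_le μ x)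
    have h2 := mul_le_mul_of_nonneg_right (hΩ.enormR_le_mass hd hcl) hr.le
    rw [← hmn] at h1
    have h3 : normS S x ≤ d * enormR x := by
      refine le_of_mul_le_mul_left ?_ hm
      linarith
    exact h3.trans (mul_le_mul_of_nonneg_right hk1 hr.le)
  · have h1 := hJ.mass_le_mul_enormR_drift hΩ hd hμ hx
    have h2 : mass S ≤ d / (2 * K) * enormR (drift (tilt J μ)) := by
      rw [div_mul_eq_mul_div, le_div_iff₀ (by positivity)]
      linarith
    exact h2.trans (mul_le_mul_of_nonneg_right hk2 hv.le)
  · exact (hJ.enormR_drift_le_mass hΩ hd hcl).trans (mul_le_mul_of_nonneg_right hk3 hm.le)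

lemma window_height_eq {r v : ℝ} (hr : 0 < r) (hv : 0 < v) (δ : ℝ) :
    (r / v) ^ (1 - δ / 2) * (v ^ 2 * (r / v)) ^ (-(1 / 2) : ℝ) =
      r ^ ((1 - δ) / 2) * v ^ ((δ - 3) / 2) := by
  have h1 : v ^ 2 * (r / v) = r * v := by field_simp
  rw [h1, Real.div_rpow hr.le hv.le, Real.mul_rpow hr.le hv.le, div_eq_mul_inv,
    ← Real.rpow_neg hv.le]
  rw [show r ^ (1 - δ / 2) * v ^ (-(1 - δ / 2)) * (r ^ (-(1 / 2) : ℝ) * v ^ (-(1 / 2) : ℝ)) =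
    (r ^ (1 - δ / 2) * r ^ (-(1 / 2) : ℝ)) * (v ^ (-(1 - δ / 2)) * v ^ (-(1 / 2) : ℝ)) by ring,
    ← Real.rpow_add hr, ← Real.rpow_add hv]
  congr 2 <;> ring

/-- Two-sided bounds in the regime where speed times distance is bounded below. -/
lemma exists_bounds_of_le_mul (hd : 1 ≤ d) (hM : 0 < M) (hK : 0 < K) (hζ : 0 < ζ) {s : ℝ}
    (hs : 0 < s) :
    ∃ R c C : ℝ, 0 < R ∧ 0 < c ∧ 0 < C ∧
      ∀ S J h : (Fin d → ℤ) → ℝ, AssumptionOmega S → AssumptionJ S J h M K ζ →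
      (∀ μ ∈ frontier (Omega S), M⁻¹ ≤ tiltSum h μ) →
      ∀ (x : Fin d → ℤ) (μ : Fin d → ℝ), IsOptTilt S (toR x) μ → R ≤ enormZ x →
      ∀ v, v = enormR (drift (tilt J μ)) → s ≤ v * enormZ x →
        c * (enormZ x ^ ((1 - (d : ℝ)) / 2) * v ^ (((d : ℝ) - 3) / 2)) ≤ tilt S μ x ∧
        tilt S μ x ≤ C * (enormZ x ^ ((1 - (d : ℝ)) / 2) * v ^ (((d : ℝ) - 3) / 2)) := by
  obtain ⟨CH, cL, hCH, hcL, hwin⟩ := exists_hasWindow_of_le_mul hd hs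
  obtain ⟨R, c, C, hR, hc, hC, hmain⟩ := exists_window_bounds hd hM hK hζ hCH hcL
  refine ⟨max R (2 * (M + 1) ^ 2), c, C, lt_max_of_lt_left hR, hc, hC,
    fun S J h hΩ hJ hlow x μ hμ hx v hv hvs => ?_⟩
  have hr : 0 < enormZ x := hR.trans_le ((le_max_left _ _).trans hx)
  have hv0 : 0 < v := by
    by_contra hn
    push Not at hn
    nlinarith
  have hvM : v ≤ (M + 1) ^ 2 := hv ▸ hJ.enormR_drift_le hd (frontier_subset_closure hμ.1)
  have h2 := (le_max_right _ _).trans hx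
  have hw := hwin (enormZ x / v) v hv0 (by rw [le_div_iff₀ hv0]; linarith)
    (hvs.trans_eq (by field_simp))
  rw [mul_div_cancel₀ _ hv0.ne', window_height_eq hr hv0, hv] at hw
  rw [hv]
  exact hmain S J h hΩ hJ hlow x μ hμ ((le_max_left _ _).trans hx) _
    (mul_nonneg (Real.rpow_nonneg hr.le _) (Real.rpow_nonneg (enormR_nonneg _) _)) hw

/-- Two-sided bounds in the regime where speed times distance is at most one. -/
lemma exists_bounds_of_mul_le (hd : 3 ≤ d) (hM : 0 < M) (hK : 0 < K) (hζ : 0 < ζ) :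
    ∃ R c C : ℝ, 0 < R ∧ 0 < c ∧ 0 < C ∧
      ∀ S J h : (Fin d → ℤ) → ℝ, AssumptionOmega S → AssumptionJ S J h M K ζ →
      (∀ μ ∈ frontier (Omega S), M⁻¹ ≤ tiltSum h μ) →
      ∀ (x : Fin d → ℤ) (μ : Fin d → ℝ), IsOptTilt S (toR x) μ → R ≤ enormZ x →
      0 < enormR (drift (tilt J μ)) → enormR (drift (tilt J μ)) * enormZ x ≤ 1 →
        c * enormZ x ^ (2 - (d : ℝ)) ≤ tilt S μ x ∧
        tilt S μ x ≤ C * enormZ x ^ (2 - (d : ℝ)) := by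
  obtain ⟨CH, cL, hCH, hcL, hwin⟩ := exists_hasWindow_of_mul_le hd
  obtain ⟨R, c, C, hR, hc, hC, hmain⟩ :=
    exists_window_bounds (d := d) (by omega) hM hK hζ hCH hcL
  refine ⟨max R 2, c, C, lt_max_of_lt_left hR, hc, hC,
    fun S J h hΩ hJ hlow x μ hμ hx hv hvr => ?_⟩
  exact hmain S J h hΩ hJ hlow x μ hμ ((le_max_left _ _).trans hx) _
    (Real.rpow_nonneg (enormZ_nonneg x) _)
    (hwin _ _ hv ((le_max_right _ _).trans hx) hvr)

/-- Two-sided bounds in dimensions above two, in terms of Euclidean length and speed. -/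
lemma exists_bounds_of_two_lt (hd : 2 < d) (hM : 0 < M) (hK : 0 < K) (hζ : 0 < ζ) :
    ∃ R c C : ℝ, 0 < R ∧ 0 < c ∧ 0 < C ∧
      ∀ S J h : (Fin d → ℤ) → ℝ, AssumptionOmega S → AssumptionJ S J h M K ζ →
      (∀ μ ∈ frontier (Omega S), M⁻¹ ≤ tiltSum h μ) →
      ∀ (x : Fin d → ℤ) (μ : Fin d → ℝ), IsOptTilt S (toR x) μ → R ≤ enormZ x →
      ∀ v, v = enormR (drift (tilt J μ)) → 0 < v →
        c * (max 1 (v * enormZ x) ^ (((d : ℝ) - 3) / 2) * enormZ x ^ (2 - (d : ℝ))) ≤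
          tilt S μ x ∧
        tilt S μ x ≤
          C * (max 1 (v * enormZ x) ^ (((d : ℝ) - 3) / 2) * enormZ x ^ (2 - (d : ℝ))) := by
  obtain ⟨R₁, c₁, C₁, hR₁, hc₁, hC₁, h₁⟩ :=
    exists_bounds_of_le_mul (s := 1) (show 1 ≤ d by omega) hM hK hζ one_pos
  obtain ⟨R₂, c₂, C₂, hR₂, hc₂, hC₂, h₂⟩ := exists_bounds_of_mul_le hd hM hK hζ
  refine ⟨max R₁ R₂, min c₁ c₂, max C₁ C₂, lt_max_of_lt_left hR₁, lt_min hc₁ hc₂,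
    lt_max_of_lt_left hC₁, fun S J h hΩ hJ hlow x μ hμ hx v hv hv0 => ?_⟩
  have hr : 0 < enormZ x := hR₁.trans_le ((le_max_left _ _).trans hx)
  have hH : 0 ≤ max 1 (v * enormZ x) ^ (((d : ℝ) - 3) / 2) * enormZ x ^ (2 - (d : ℝ)) := by
    positivity
  rcases le_total 1 (v * enormZ x) with hvr | hvr
  · have h3 := h₁ S J h hΩ hJ hlow x μ hμ ((le_max_left _ _).trans hx) v hv hvr
    have h4 : max 1 (v * enormZ x) ^ (((d : ℝ) - 3) / 2) * enormZ x ^ (2 - (d : ℝ)) =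
        enormZ x ^ ((1 - (d : ℝ)) / 2) * v ^ (((d : ℝ) - 3) / 2) := by
      rw [max_eq_right hvr, Real.mul_rpow hv0.le hr.le, mul_assoc, ← Real.rpow_add hr, mul_comm]
      congr 2
      ring
    rw [← h4] at h3
    exact ⟨(mul_le_mul_of_nonneg_right (min_le_left _ _) hH).trans h3.1,
      h3.2.trans (mul_le_mul_of_nonneg_right (le_max_left _ _) hH)⟩
  · have h3 := h₂ S J h hΩ hJ hlow x μ hμ ((le_max_right _ _).trans hx) (hv ▸ hv0) (hv ▸ hvr)
    have h4 : max 1 (v * enormZ x) ^ (((d : ℝ) - 3) / 2) * enormZ x ^ (2 - (d : ℝ)) =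
        enormZ x ^ (2 - (d : ℝ)) := by
      rw [max_eq_left hvr, Real.one_rpow, one_mul]
    rw [← h4] at h3
    exact ⟨(mul_le_mul_of_nonneg_right (min_le_right _ _) hH).trans h3.1,
      h3.2.trans (mul_le_mul_of_nonneg_right (le_max_right _ _) hH)⟩

lemma toR_ne_zero_of_normS_pos {S : (Fin d → ℤ) → ℝ} (hΩ : AssumptionOmega S) {x : Fin d → ℤ}
    (hx : 0 < normS S (toR x)) : toR x ≠ 0 := fun h0 => by
  have h1 : (fun μ : Fin d → ℝ => rdot μ (toR x)) '' closure (Omega S) = {0} := by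
    rw [h0]
    simp only [rdot, Pi.zero_apply, mul_zero, Finset.sum_const_zero]
    exact Set.Nonempty.image_const ⟨0, subset_closure hΩ.zero_mem⟩ 0
  rw [normS, h1, csSup_singleton, zero_div] at hx
  exact lt_irrefl _ hx

lemma tilt_eq_mul_exp {S : (Fin d → ℤ) → ℝ} (hΩ : AssumptionOmega S) (hd : 1 ≤ d)
    {x : Fin d → ℤ} {μ : Fin d → ℝ} (hμ : IsOptTilt S (toR x) μ) :
    tilt S μ x = S x * Real.exp (mass S * normS S (toR x)) := by
  rw [hΩ.mass_mul_normS hd hμ, tilt, rdotZ_eq]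

end Assembly

section FinalBounds

variable {M K ζ : ℝ}

lemma max_one_le_mul_max_one {a b k : ℝ} (hk : 1 ≤ k) (h : a ≤ k * b) :
    max 1 a ≤ k * max 1 b :=
  max_le (hk.trans (le_mul_of_one_le_right (by linarith) (le_max_left _ _)))
    (h.trans (mul_le_mul_of_nonneg_left (le_max_right _ _) (by linarith)))

lemma mul_le_sq_mul_mul {a b a' b' k : ℝ} (hk : 0 ≤ k) (ha' : 0 ≤ a') (hb : 0 ≤ b)
    (h : a ≤ k * b) (h' : a' ≤ k * b') : a * a' ≤ k ^ 2 * (b * b') :=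
  (mul_le_mul h h' ha' (mul_nonneg hk hb)).trans_eq (by ring)

/-- Two-sided bounds in dimensions above two. -/
theorem exists_bounds_normS_of_two_lt (hd : 2 < d) (hM : 0 < M) (hK : 0 < K) (hζ : 0 < ζ) :
    ∃ R c C : ℝ, 0 < R ∧ 0 < c ∧ c ≤ C ∧
      ∀ S J h : (Fin d → ℤ) → ℝ, AssumptionOmega S → AssumptionJ S J h M K ζ →
      (∀ μ ∈ frontier (Omega S), M⁻¹ ≤ tiltSum h μ) →
      ∀ x : Fin d → ℤ, R ≤ normS S (toR x) →
        c * (max 1 (mass S * normS S (toR x)) ^ (((d : ℝ) - 3) / 2) /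
              normS S (toR x) ^ ((d : ℝ) - 2) *
            Real.exp (-(mass S * normS S (toR x)))) ≤ S x ∧
        S x ≤ C * (max 1 (mass S * normS S (toR x)) ^ (((d : ℝ) - 3) / 2) /
              normS S (toR x) ^ ((d : ℝ) - 2) *
            Real.exp (-(mass S * normS S (toR x)))) := by
  have hd1 : 1 ≤ d := by omega
  obtain ⟨k, hk, hcomp⟩ := exists_comparable d hM hK
  obtain ⟨R, c, C, hR, hc, hC, hmain⟩ := exists_bounds_of_two_lt hd hM hK hζ
  have hk0 : 0 < k := by linarith
  have hk2 : 1 ≤ k ^ 2 := one_le_pow₀ hk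
  have hkk : k ≤ k ^ 2 := by nlinarith
  set q := (k ^ 2) ^ (|((d : ℝ) - 3) / 2| + |2 - (d : ℝ)|) with hq
  have hq0 : 0 < q := by positivity
  refine ⟨k * R, c / q, max (c / q) (C * q), mul_pos hk0 hR, div_pos hc hq0, le_max_left _ _,
    fun S J h hΩ hJ hlow x hx => ?_⟩
  have hx0 := toR_ne_zero_of_normS_pos hΩ ((mul_pos hk0 hR).trans_le hx)
  obtain ⟨μ, hμ⟩ := hΩ.exists_isOptTilt hd1 hx0
  obtain ⟨hn, hrn, hnr, hmv, hvm⟩ := hcomp S J h hd1 hΩ hJ _ μ hμ hx0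
  have hv := hJ.enormR_drift_pos hΩ hd1 hμ hx0
  have hr : 0 < enormR (toR x) := enormR_pos hx0
  have hm := hΩ.mass_pos hd1
  have hbd := hmain S J h hΩ hJ hlow x μ hμ (le_of_mul_le_mul_left (hx.trans hnr) hk0) _ rfl hv
  rw [tilt_eq_mul_exp hΩ hd1 hμ, enormZ_eq] at hbd
  generalize normS S (toR x) = n at *
  generalize mass S = m at *
  generalize enormR (drift (tilt J μ)) = v at *
  generalize enormR (toR x) = r at *
  have h1 : max 1 (m * n) ≤ k ^ 2 * max 1 (v * r) :=
    max_one_le_mul_max_one hk2 (mul_le_sq_mul_mul hk0.le hn.le hv.le hmv hnr)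
  have h2 : max 1 (v * r) ≤ k ^ 2 * max 1 (m * n) :=
    max_one_le_mul_max_one hk2 (mul_le_sq_mul_mul hk0.le hr.le hm.le hvm hrn)
  have hrn' : r ≤ k ^ 2 * n := hrn.trans (mul_le_mul_of_nonneg_right hkk hn.le)
  have hnr' : n ≤ k ^ 2 * r := hnr.trans (mul_le_mul_of_nonneg_right hkk hr.le)
  have hmn1 : 0 < max 1 (m * n) := by positivity
  have hvr1 : 0 < max 1 (v * r) := by positivity
  have hF : max 1 (m * n) ^ (((d : ℝ) - 3) / 2) / n ^ ((d : ℝ) - 2) =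
      max 1 (m * n) ^ (((d : ℝ) - 3) / 2) * n ^ (2 - (d : ℝ)) := by
    rw [div_eq_mul_inv, ← Real.rpow_neg hn.le, neg_sub]
  rw [hF, Real.exp_neg]
  have h3 := le_and_le_of_comparable hc hC hq0 (Real.exp_pos (m * n)) hbd
    (rpow_mul_rpow_le_of_comparable hmn1 hvr1 hn hr hk2 h1 h2 hnr' hrn' _ _)
    (rpow_mul_rpow_le_of_comparable hvr1 hmn1 hr hn hk2 h2 h1 hrn' hnr' _ _)
  exact ⟨h3.1, h3.2.trans (mul_le_mul_of_nonneg_right (le_max_right _ _) (by positivity))⟩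

/-- Two-sided bounds away from the critical regime, in any dimension. -/
theorem exists_bounds_normS_of_div_mass_le (hd : 1 ≤ d) (hM : 0 < M) (hK : 0 < K) (hζ : 0 < ζ)
    {s : ℝ} (hs : 0 < s) :
    ∃ R c C : ℝ, 0 < R ∧ 0 < c ∧ c ≤ C ∧
      ∀ S J h : (Fin d → ℤ) → ℝ, AssumptionOmega S → AssumptionJ S J h M K ζ →
      (∀ μ ∈ frontier (Omega S), M⁻¹ ≤ tiltSum h μ) →
      ∀ x : Fin d → ℤ, max R (s / mass S) ≤ normS S (toR x) →
        c * (Real.exp (-(mass S * normS S (toR x))) /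
              (mass S ^ ((3 - (d : ℝ)) / 2) * normS S (toR x) ^ (((d : ℝ) - 1) / 2))) ≤ S x ∧
        S x ≤ C * (Real.exp (-(mass S * normS S (toR x))) /
              (mass S ^ ((3 - (d : ℝ)) / 2) * normS S (toR x) ^ (((d : ℝ) - 1) / 2))) := by
  obtain ⟨k, hk, hcomp⟩ := exists_comparable d hM hK
  have hk0 : 0 < k := by linarith
  obtain ⟨R, c, C, hR, hc, hC, hmain⟩ :=
    exists_bounds_of_le_mul hd hM hK hζ (div_pos hs (pow_pos hk0 2))
  set q := k ^ (|(1 - (d : ℝ)) / 2| + |((d : ℝ) - 3) / 2|) with hq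
  have hq0 : 0 < q := by positivity
  refine ⟨k * R, c / q, max (c / q) (C * q), mul_pos hk0 hR, div_pos hc hq0, le_max_left _ _,
    fun S J h hΩ hJ hlow x hx => ?_⟩
  have hx1 := (le_max_left _ _).trans hx
  have hx2 := (le_max_right _ _).trans hx
  have hx0 := toR_ne_zero_of_normS_pos hΩ ((mul_pos hk0 hR).trans_le hx1)
  obtain ⟨μ, hμ⟩ := hΩ.exists_isOptTilt hd hx0
  obtain ⟨hn, hrn, hnr, hmv, hvm⟩ := hcomp S J h hd hΩ hJ _ μ hμ hx0
  have hv := hJ.enormR_drift_pos hΩ hd hμ hx0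
  have hr : 0 < enormR (toR x) := enormR_pos hx0
  have hm := hΩ.mass_pos hd
  have hbd := hmain S J h hΩ hJ hlow x μ hμ (le_of_mul_le_mul_left (hx1.trans hnr) hk0) _ rfl
  rw [tilt_eq_mul_exp hΩ hd hμ, enormZ_eq] at hbd
  generalize normS S (toR x) = n at *
  generalize mass S = m at *
  generalize enormR (drift (tilt J μ)) = v at *
  generalize enormR (toR x) = r at *
  rw [div_le_iff₀ hm] at hx2
  have hbd' := hbd (by
    rw [div_le_iff₀ (pow_pos hk0 2)]
    have := mul_le_sq_mul_mul hk0.le hn.le hv.le hmv hnr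
    linarith)
  have hF : Real.exp (-(m * n)) / (m ^ ((3 - (d : ℝ)) / 2) * n ^ (((d : ℝ) - 1) / 2)) =
      n ^ ((1 - (d : ℝ)) / 2) * m ^ (((d : ℝ) - 3) / 2) * (Real.exp (m * n))⁻¹ := by
    rw [Real.exp_neg, show (1 - (d : ℝ)) / 2 = -(((d : ℝ) - 1) / 2) by ring,
      show ((d : ℝ) - 3) / 2 = -((3 - (d : ℝ)) / 2) by ring, Real.rpow_neg hn.le,
      Real.rpow_neg hm.le, div_eq_mul_inv, mul_inv]
    ring
  rw [hF]
  have h3 := le_and_le_of_comparable hc hC hq0 (Real.exp_pos (m * n)) hbd'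
    (rpow_mul_rpow_le_of_comparable hn hr hm hv hk hnr hrn hmv hvm _ _)
    (rpow_mul_rpow_le_of_comparable hr hn hv hm hk hrn hnr hvm hmv _ _)
  exact ⟨h3.1, h3.2.trans (mul_le_mul_of_nonneg_right (le_max_right _ _) (by positivity))⟩

end FinalBounds

theorem statement7 (d : ℕ) (hd : 1 ≤ d) (M K ζ : ℝ)
    (hM : 0 < M) (hK : 0 < K) (hζ : 0 < ζ) :
    (2 < d → ∃ R c C : ℝ, 0 < R ∧ 0 < c ∧ c ≤ C ∧
      ∀ S J h : (Fin d → ℤ) → ℝ, AssumptionOmega S → AssumptionJ S J h M K ζ →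
      (∀ μ ∈ frontier (Omega S), M⁻¹ ≤ tiltSum h μ) →
      ∀ x : Fin d → ℤ, R ≤ normS S (toR x) →
        c * (max 1 (mass S * normS S (toR x)) ^ (((d : ℝ) - 3) / 2) /
              normS S (toR x) ^ ((d : ℝ) - 2) *
            Real.exp (-(mass S * normS S (toR x)))) ≤ S x ∧
        S x ≤ C * (max 1 (mass S * normS S (toR x)) ^ (((d : ℝ) - 3) / 2) /
              normS S (toR x) ^ ((d : ℝ) - 2) *
            Real.exp (-(mass S * normS S (toR x))))) ∧
    (d ≤ 2 → ∀ s₀ : ℝ, 0 < s₀ → ∃ R c C : ℝ, 0 < R ∧ 0 < c ∧ c ≤ C ∧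
      ∀ S J h : (Fin d → ℤ) → ℝ, AssumptionOmega S → AssumptionJ S J h M K ζ →
      (∀ μ ∈ frontier (Omega S), M⁻¹ ≤ tiltSum h μ) →
      ∀ x : Fin d → ℤ, max R (s₀ / mass S) ≤ normS S (toR x) →
        c * (Real.exp (-(mass S * normS S (toR x))) /
              (mass S ^ ((3 - (d : ℝ)) / 2) * normS S (toR x) ^ (((d : ℝ) - 1) / 2))) ≤ S x ∧
        S x ≤ C * (Real.exp (-(mass S * normS S (toR x))) /
              (mass S ^ ((3 - (d : ℝ)) / 2) * normS S (toR x) ^ (((d : ℝ) - 1) / 2)))) := by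
  exact ⟨fun hd' => exists_bounds_normS_of_two_lt hd' hM hK hζ,
    fun _ _ hs => exists_bounds_normS_of_div_mass_le hd hM hK hζ hs⟩

end OZpaper
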